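/- Let u be a variational solution of the one-phase free boundary problem in an open set Ω ⊆ ℝ² which is Lipschitz continuous and non-degenerate, and assume 0 ∈ F(u). Let r_j → 0⁺ and suppose the rescalings v_j(x) = r_j^{-1} u(r_j x) converge uniformly on compact subsets of ℝ² to a function v. Then there is a rotation ρ of ℝ² such that either v∘ρ = P or v∘ρ = W_s for some 0 < s < ∞. If in addition u is a viscosity solution, then v is a viscosity solution and, up to rotation, either v = P or v = W_s for some 0 < s ≤ 1. -/

import Mathlib

open Complex Metric Set Filter MeasureTheory
open scoped Topology Classical NNReal

noncomputable section

/-- The positive phase of `u` in `Ω`. -/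
def posSet (Ω : Set ℂ) (u : ℂ → ℝ) : Set ℂ := {z ∈ Ω | 0 < u z}

/-- The free boundary of `u` in `Ω`. -/
def FB (Ω : Set ℂ) (u : ℂ → ℝ) : Set ℂ := Ω ∩ frontier (posSet Ω u)

/-- The gradient of `u : ℂ → ℝ`, viewed as a complex number `∂ₓu + i ∂ᵧu`. -/
def grad2 (u : ℂ → ℝ) (z : ℂ) : ℂ :=
  ((fderiv ℝ u z 1 : ℝ) : ℂ) + ((fderiv ℝ u z Complex.I : ℝ) : ℂ) * Complex.I

/-- Second derivative (Hessian) of `u : ℂ → ℝ` at `z` in directions `v, w`. -/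
def hess (u : ℂ → ℝ) (z v w : ℂ) : ℝ := fderiv ℝ (fun x => fderiv ℝ u x v) z w

/-- `u` is harmonic on `s`: twice continuously differentiable with vanishing Laplacian. -/
def HarmonicOn2 (u : ℂ → ℝ) (s : Set ℂ) : Prop :=
  ContDiffOn ℝ 2 u s ∧ ∀ z ∈ s, hess u z 1 1 + hess u z Complex.I Complex.I = 0

/-- A classical solution of the one-phase free boundary problem `Δu = 0` in `{u>0}`,
`|∇u| = 1` on the free boundary, in the open set `Ω ⊆ ℝ² ≅ ℂ`. -/
structure IsClassicalSolution (Ω : Set ℂ) (u : ℂ → ℝ) : Prop where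
  contOn : ContinuousOn u Ω
  nonneg : ∀ z ∈ Ω, 0 ≤ u z
  harm : HarmonicOn2 u (posSet Ω u)
  smooth_ext : ∃ v : ℂ → ℝ, ContDiffOn ℝ (⊤ : ℕ∞) v (Ω ∩ closure (posSet Ω u)) ∧
    Set.EqOn u v (Ω ∩ closure (posSet Ω u))
  fb_manifold : ∀ z ∈ FB Ω u, ∃ V : Set ℂ, IsOpen V ∧ z ∈ V ∧ V ⊆ Ω ∧
    ∃ φ : ℂ → ℝ, ContDiffOn ℝ (⊤ : ℕ∞) φ V ∧ (∀ w ∈ V, fderiv ℝ φ w ≠ 0) ∧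
      V ∩ posSet Ω u = {w ∈ V | 0 < φ w} ∧
      V ∩ {w | u w = 0} = {w ∈ V | φ w ≤ 0} ∧
      V ∩ FB Ω u = {w ∈ V | φ w = 0}
  grad_one : ∀ z ∈ FB Ω u,
    Filter.Tendsto (fun w => ‖grad2 u w‖) (nhdsWithin z (posSet Ω u)) (nhds 1)

/-- One-plane solution `P(z) = max (Re z) 0`. -/
def Pfun (z : ℂ) : ℝ := max z.re 0

/-- Wedge solution `W_s(z) = s |Re z|`. -/
def Wfun (s : ℝ) (z : ℂ) : ℝ := s * |z.re|

/-- Two-plane solution `TP_a`. -/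
def TPfun (a : ℝ) (z : ℂ) : ℝ := max z.re 0 + max (-z.re - a) 0

/-- Rotation of the plane by angle `θ`. -/
def rot (θ : ℝ) (z : ℂ) : ℂ := Complex.exp (θ * Complex.I) * z

/-- The strip `S = {|Im ζ| < π/2}`. -/
def Sstrip : Set ℂ := {ζ : ℂ | |ζ.im| < Real.pi / 2}

/-- The hairpin domain `Ω₁ = {|x₂| < π/2 + cosh x₁}`. -/
def Omega1 : Set ℂ := {z : ℂ | |z.im| < Real.pi / 2 + Real.cosh z.re}

/-- Dilated hairpin domain `Ω_a = aΩ₁`. -/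
def OmegaA (a : ℝ) : Set ℂ := {z : ℂ | z / (a : ℂ) ∈ Omega1}

/-- The Hauswirth–Hélein–Pacard double hairpin solution `H = H₁`:
`H(z) = Re (cosh w)` where `w` is the unique point of the strip `S` with `w + sinh w = z`,
and `H(z) = 0` if there is no such point. -/
def hairpinH (z : ℂ) : ℝ :=
  if h : ∃ w : ℂ, w ∈ Sstrip ∧ w + Complex.sinh w = z then (Complex.cosh h.choose).re else 0

/-- The double hairpin solution `H_a(z) = a H(z/a)`. -/
def hairpin (a : ℝ) (z : ℂ) : ℝ := a * hairpinH (z / (a : ℂ))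

/-- Euclidean dot product of two complex numbers viewed as vectors in ℝ². -/
def dot2 (a b : ℂ) : ℝ := a.re * b.re + a.im * b.im

/-- Divergence of a vector field `ψ : ℂ → ℂ` on ℝ². -/
def div2 (ψ : ℂ → ℂ) (z : ℂ) : ℝ := (fderiv ℝ ψ z 1).re + (fderiv ℝ ψ z Complex.I).im

/-- A variational (weak) solution of the one-phase free boundary problem in `Ω`:
`u ∈ H¹_loc(Ω) ∩ C(Ω)`, `u ≥ 0`, `u ∈ C²({u>0})`, and the domain-variation
Euler–Lagrange identity holds for all compactly supported smooth vector fields. -/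
def VariationalSolution (Ω : Set ℂ) (u : ℂ → ℝ) : Prop :=
  ContinuousOn u Ω ∧ (∀ z ∈ Ω, 0 ≤ u z) ∧
  (∀ K : Set ℂ, K ⊆ Ω → IsCompact K →
    MeasureTheory.IntegrableOn (fun z => (u z) ^ 2 + ‖grad2 u z‖ ^ 2) K) ∧
  ContDiffOn ℝ 2 u (posSet Ω u) ∧
  ∀ ψ : ℂ → ℂ, ContDiff ℝ (⊤ : ℕ∞) ψ → HasCompactSupport ψ → tsupport ψ ⊆ Ω →
    ∫ z in Ω, ((‖grad2 u z‖ ^ 2 + Set.indicator {w | 0 < u w} (fun _ => (1 : ℝ)) z) * div2 ψ z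
      - 2 * dot2 (grad2 u z) (fderiv ℝ ψ z (grad2 u z))) = 0

/-- Average of `w` over the circle of radius `r` around `z`. -/
def circleAvg (w : ℂ → ℝ) (z : ℂ) (r : ℝ) : ℝ :=
  (1 / (2 * Real.pi)) * ∫ θ in (0 : ℝ)..(2 * Real.pi), w (z + r * Complex.exp (θ * Complex.I))

/-- Superharmonicity on `s` via the super-mean-value property. -/
def SuperharmonicOn2 (w : ℂ → ℝ) (s : Set ℂ) : Prop :=
  ∀ z ∈ s, ∀ r : ℝ, 0 < r → Metric.closedBall z r ⊆ s → circleAvg w z r ≤ w z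

/-- Subharmonicity on `s` via the sub-mean-value property. -/
def SubharmonicOn2 (w : ℂ → ℝ) (s : Set ℂ) : Prop :=
  ∀ z ∈ s, ∀ r : ℝ, 0 < r → Metric.closedBall z r ⊆ s → w z ≤ circleAvg w z r

/-- Non-tangential approach region in `B` at `x₀` with aperture `C`. -/
def NontangentialIn (B : Set ℂ) (x₀ : ℂ) (C : ℝ) : Set ℂ :=
  {x ∈ B | ‖x - x₀‖ ≤ C * Metric.infDist x Bᶜ}

/-- `w(x) = α ⟨x − x₀, ν⟩⁺ + o(|x − x₀|)` as `x → x₀` within the region `R`. -/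
def HasSlopeAt (w : ℂ → ℝ) (x₀ ν : ℂ) (α : ℝ) (R : Set ℂ) : Prop :=
  Filter.Tendsto (fun x => (w x - α * max (dot2 (x - x₀) ν) 0) / ‖x - x₀‖)
    (nhdsWithin x₀ R) (nhds 0)

/-- Viscosity supersolution of the one-phase free boundary problem in `Ω`. -/
structure ViscositySupersolution (Ω : Set ℂ) (w : ℂ → ℝ) : Prop where
  contOn : ContinuousOn w Ω
  nonneg : ∀ z ∈ Ω, 0 ≤ w z
  superharm : SuperharmonicOn2 w (posSet Ω w)
  slope : ∀ x₀ ∈ FB Ω w, ∀ (y : ℂ) (ρ : ℝ), 0 < ρ → Metric.ball y ρ ⊆ posSet Ω w →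
    dist x₀ y = ρ → ∃ α : ℝ, α ≤ 1 ∧ ∀ C : ℝ, 1 < C →
      HasSlopeAt w x₀ ((y - x₀) / (ρ : ℂ)) α (NontangentialIn (Metric.ball y ρ) x₀ C)

/-- Viscosity subsolution of the one-phase free boundary problem in `Ω`. -/
structure ViscositySubsolution (Ω : Set ℂ) (w : ℂ → ℝ) : Prop where
  contOn : ContinuousOn w Ω
  nonneg : ∀ z ∈ Ω, 0 ≤ w z
  subharm : SubharmonicOn2 w (posSet Ω w)
  slope : ∀ x₀ ∈ FB Ω w, ∀ (y : ℂ) (ρ : ℝ), 0 < ρ →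
    Metric.ball y ρ ⊆ {z ∈ Ω | w z = 0} → dist x₀ y = ρ →
    ∃ α : ℝ, 1 ≤ α ∧ ∀ C : ℝ, 1 < C →
      HasSlopeAt w x₀ ((x₀ - y) / (ρ : ℂ)) α
        (NontangentialIn (closure (Metric.ball y ρ))ᶜ x₀ C)

/-- Viscosity solution: both a supersolution and a subsolution. -/
def ViscositySolution (Ω : Set ℂ) (w : ℂ → ℝ) : Prop :=
  ViscositySupersolution Ω w ∧ ViscositySubsolution Ω w

/-- Non-degeneracy with constant `c`: linear growth away from the free boundary. -/
def Nondegenerate (Ω : Set ℂ) (w : ℂ → ℝ) (c : ℝ) : Prop :=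
  ∀ x ∈ FB Ω w, ∀ r : ℝ, 0 < r → Metric.ball x r ⊆ Ω → c * r ≤ sSup (w '' Metric.ball x r)

/-- The open annulus `{δ < |z| < R}`. -/
def ann (δ R : ℝ) : Set ℂ := {z : ℂ | δ < ‖z‖ ∧ ‖z‖ < R}

/-- Condition (A): the free boundary of `u` in the annulus `{δ < |z| < R}` consists of
exactly two connected components, each non-compact with closure meeting both boundary
circles. -/
def ConditionA (δ R : ℝ) (u : ℂ → ℝ) : Prop :=
  ∃ F₁ F₂ : Set ℂ,
    F₁.Nonempty ∧ F₂.Nonempty ∧ Disjoint F₁ F₂ ∧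
    F₁ ∪ F₂ = FB (ann δ R) u ∧
    (∀ z ∈ F₁, connectedComponentIn (FB (ann δ R) u) z = F₁) ∧
    (∀ z ∈ F₂, connectedComponentIn (FB (ann δ R) u) z = F₂) ∧
    ¬ IsCompact F₁ ∧ ¬ IsCompact F₂ ∧
    (closure F₁ ∩ Metric.sphere 0 δ).Nonempty ∧
    (closure F₁ ∩ Metric.sphere 0 R).Nonempty ∧
    (closure F₂ ∩ Metric.sphere 0 δ).Nonempty ∧
    (closure F₂ ∩ Metric.sphere 0 R).Nonempty

/-- `k` is the curvature of the set `S` at the point `p`, computed via an arc-length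
parametrization. -/
def IsCurvatureAt (S : Set ℂ) (p : ℂ) (k : ℝ) : Prop :=
  ∃ γ : ℝ → ℂ, ContDiff ℝ 2 γ ∧ γ 0 = p ∧ (∀ s : ℝ, ‖deriv γ s‖ = 1) ∧
    (∃ ε > 0, ∀ s ∈ Set.Ioo (-ε) ε, γ s ∈ S) ∧ ‖deriv (deriv γ) 0‖ = k

/-- A set has exactly two connected components. -/
def HasExactlyTwoComponents (S : Set ℂ) : Prop :=
  ∃ z₁ ∈ S, ∃ z₂ ∈ S, connectedComponentIn S z₁ ≠ connectedComponentIn S z₂ ∧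
    ∀ z ∈ S, connectedComponentIn S z = connectedComponentIn S z₁ ∨
      connectedComponentIn S z = connectedComponentIn S z₂

end


open Complex Metric Set Filter MeasureTheory
open scoped Topology Classical NNReal

lemma int_aux {U : Set ℂ} {h η : ℂ → ℝ} (hh : ContinuousOn h U)
    (hη : Continuous η) (hc : HasCompactSupport η) (hs : tsupport η ⊆ U) :
    Integrable (fun z => h z * η z) := by
  have h1 : IntegrableOn (fun z => h z * η z) (tsupport η) :=
    ((hh.mono hs).mul hη.continuousOn).integrableOn_compact hc
  rw [← integrableOn_iff_integrable_of_support_subset (s := tsupport η)]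
  · exact h1
  · intro z hz
    apply subset_tsupport
    simp only [Function.mem_support] at hz ⊢
    exact right_ne_zero_of_mul hz

lemma ibp_aux {U : Set ℂ} (hU : IsOpen U) {g η : ℂ → ℝ} (hg : ContDiffOn ℝ 1 g U)
    (hη : ContDiff ℝ 1 η) (hc : HasCompactSupport η) (hs : tsupport η ⊆ U) (e : ℂ) :
    Integrable (fun z => g z * fderiv ℝ η z e) ∧ Integrable (fun z => fderiv ℝ g z e * η z) ∧
    ∫ z, g z * fderiv ℝ η z e = - ∫ z, fderiv ℝ g z e * η z := by
  have hs' : tsupport (fun z => fderiv ℝ η z e) ⊆ tsupport η := tsupport_fderiv_apply_subset ℝ e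
  have hc' : HasCompactSupport (fun z => fderiv ℝ η z e) := hc.mono' (subset_tsupport _ |>.trans hs')
  have h1 : Integrable (fun z => g z * fderiv ℝ η z e) :=
    int_aux hg.continuousOn ((hη.continuous_fderiv one_ne_zero).clm_apply continuous_const) hc' (hs'.trans hs)
  have h2 : Integrable (fun z => fderiv ℝ g z e * η z) := by
    refine int_aux ?_ hη.continuous hc hs
    exact (hg.continuousOn_fderiv_of_isOpen hU le_rfl).clm_apply continuousOn_const
  refine ⟨h1, h2, ?_⟩
  apply integral_mul_fderiv_eq_neg_fderiv_mul_of_integrable h2 h1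
    (int_aux hg.continuousOn hη.continuous hc hs)
  · intro x hx
    exact (hg.contDiffAt (hU.mem_nhds (hs hx))).differentiableAt one_ne_zero
  · intro x _
    exact hη.differentiable one_ne_zero x

lemma posSet_open {Ω : Set ℂ} (hΩ : IsOpen Ω) {u : ℂ → ℝ} (hu : ContinuousOn u Ω) :
    IsOpen (posSet Ω u) := by
  have := hu.isOpen_inter_preimage hΩ (isOpen_Ioi (a := (0:ℝ)))
  convert this using 1
  ext z; simp [posSet]

/-- integrand of the variational identity with field `η e`. -/
lemma integrand_eta (g : ℂ) (χ : ℝ) (η : ℂ → ℝ) (hη : Differentiable ℝ η) (e z : ℂ) :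
    (‖g‖ ^ 2 + χ) * div2 (fun z => (η z : ℂ) * e) z
      - 2 * dot2 g (fderiv ℝ (fun z => (η z : ℂ) * e) z g) =
    (g.re ^ 2 + g.im ^ 2 + χ) * (fderiv ℝ η z 1 * e.re + fderiv ℝ η z I * e.im)
      - 2 * (g.re * e.re + g.im * e.im) * (g.re * fderiv ℝ η z 1 + g.im * fderiv ℝ η z I) := by
  have h1 : HasFDerivAt (fun z => (η z : ℂ) * e)
      ((ofRealCLM.comp (fderiv ℝ η z)).smulRight e) z := by
    have := (ofRealCLM.hasFDerivAt.comp z (hη z).hasFDerivAt).smul_const e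
    simpa [Function.comp_def] using this
  have h2 : fderiv ℝ η z g = g.re * fderiv ℝ η z 1 + g.im * fderiv ℝ η z I := by
    conv_lhs => rw [show g = g.re • (1:ℂ) + g.im • I by simp [Complex.re_add_im]]
    rw [map_add, map_smul, map_smul]; simp
  have h3 : ‖g‖ ^ 2 = g.re ^ 2 + g.im ^ 2 := by
    rw [← Complex.normSq_eq_norm_sq, Complex.normSq_apply]; ring
  simp only [div2, h1.fderiv, dot2]
  simp [h2, h3]
  ring

lemma grad2_re (u : ℂ → ℝ) (z : ℂ) : (grad2 u z).re = fderiv ℝ u z 1 := by simp [grad2]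
lemma grad2_im (u : ℂ → ℝ) (z : ℂ) : (grad2 u z).im = fderiv ℝ u z I := by simp [grad2]

lemma zero_of_test {U : Set ℂ} (hU : IsOpen U) {h : ℂ → ℝ} (hh : ContinuousOn h U)
    (H : ∀ η : ℂ → ℝ, ContDiff ℝ (⊤ : ℕ∞) η → HasCompactSupport η → tsupport η ⊆ U →
      ∫ z, η z * h z = 0) : ∀ z ∈ U, h z = 0 := by
  have h1 := hU.ae_eq_zero_of_integral_contDiff_smul_eq_zero (μ := volume)
    (hh.locallyIntegrableOn hU.measurableSet) (fun g a b c => by simpa using H g a b c)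
  have h2 : h =ᵐ[volume.restrict U] (fun _ => 0) :=
    (ae_restrict_iff' hU.measurableSet).2 h1
  exact Measure.eqOn_open_of_ae_eq h2 hU hh continuousOn_const

lemma harm_of_var {Ω : Set ℂ} (hΩ : IsOpen Ω) {u : ℂ → ℝ} (hvar : VariationalSolution Ω u) :
    ∀ z ∈ posSet Ω u, InnerProductSpace.HarmonicAt u z := by
  obtain ⟨hc, hnn, -, hC2, hid⟩ := hvar
  set U := posSet Ω u with hUdef
  have hU : IsOpen U := posSet_open hΩ hc
  have hUΩ : U ⊆ Ω := fun z hz => hz.1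
  set p : ℂ → ℝ := fun z => fderiv ℝ u z 1 with hp
  set q : ℂ → ℝ := fun z => fderiv ℝ u z I with hq
  have hdu : ContDiffOn ℝ 1 (fderiv ℝ u) U := hC2.fderiv_of_isOpen hU (by norm_num)
  have hpC : ContDiffOn ℝ 1 p U := hdu.clm_apply contDiffOn_const
  have hqC : ContDiffOn ℝ 1 q U := hdu.clm_apply contDiffOn_const
  have hsym : ∀ z ∈ U, fderiv ℝ p z I = fderiv ℝ q z 1 := by
    intro z hz
    have h2 : ContDiffAt ℝ 2 u z := hC2.contDiffAt (hU.mem_nhds hz)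
    have hd : DifferentiableAt ℝ (fderiv ℝ u) z :=
      (hdu.contDiffAt (hU.mem_nhds hz)).differentiableAt one_ne_zero
    have := h2.isSymmSndFDerivAt (by simp) 1 I
    simp only [hp, hq]
    rw [fderiv_clm_apply hd (by fun_prop), fderiv_clm_apply hd (by fun_prop)]
    simpa using this.symm
  set lap : ℂ → ℝ := fun z => fderiv ℝ p z 1 + fderiv ℝ q z I with hlap
  have hlapC : ContinuousOn lap U :=
    ((hpC.continuousOn_fderiv_of_isOpen hU le_rfl).clm_apply continuousOn_const).add
      ((hqC.continuousOn_fderiv_of_isOpen hU le_rfl).clm_apply continuousOn_const)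
  have key : ∀ e : ℂ, ∀ z ∈ U, -2 * (p z * e.re + q z * e.im) * lap z = 0 := by
    intro e
    apply zero_of_test hU
    · exact ((continuousOn_const).mul ((hpC.continuousOn.mul continuousOn_const).add
        (hqC.continuousOn.mul continuousOn_const))).mul hlapC
    intro η hη hηc hηs
    have hη1 : ContDiff ℝ 1 η := hη.of_le (by exact_mod_cast le_top)
    have hηd : Differentiable ℝ η := hη1.differentiable one_ne_zero
    set X : ℂ → ℝ := fun z => e.re * (p z ^ 2 + q z ^ 2 + 1) - 2 * (p z * e.re + q z * e.im) * p z with hX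
    set Y : ℂ → ℝ := fun z => e.im * (p z ^ 2 + q z ^ 2 + 1) - 2 * (p z * e.re + q z * e.im) * q z with hY
    have hXC : ContDiffOn ℝ 1 X U := by fun_prop
    have hYC : ContDiffOn ℝ 1 Y U := by fun_prop
    obtain ⟨iX1, iX2, iX⟩ := ibp_aux hU hXC hη1 hηc hηs 1
    obtain ⟨iY1, iY2, iY⟩ := ibp_aux hU hYC hη1 hηc hηs I
    have hz0 : ∀ z, z ∉ tsupport η → fderiv ℝ η z = 0 := fun z hz => by
      by_contra h
      exact hz (support_fderiv_subset ℝ h)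
    have h1 := hid (fun z => (η z : ℂ) * e) (by
        have : ContDiff ℝ (⊤ : ℕ∞) (fun z => (η z : ℂ)) := ofRealCLM.contDiff.comp hη
        exact this.mul contDiff_const)
      (by
        have : HasCompactSupport (fun z => (η z : ℂ)) := hηc.comp_left (g := fun x : ℝ => (x:ℂ)) (by simp)
        exact this.mul_right)
      (by
        refine (closure_mono ?_).trans (hηs.trans hUΩ)
        intro z hz
        simp only [Function.mem_support] at hz ⊢
        intro h; apply hz; simp [h])
    have h2 : ∫ z, (X z * fderiv ℝ η z 1 + Y z * fderiv ℝ η z I) = 0 := by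
      rw [← h1, ← integral_indicator hΩ.measurableSet]
      congr 1
      ext z
      by_cases hz : z ∈ tsupport η
      · have hzU := hηs hz
        rw [indicator_of_mem (hUΩ hzU), integrand_eta _ _ _ hηd, grad2_re, grad2_im,
          indicator_of_mem (show z ∈ {w | 0 < u w} from hzU.2)]
        simp only [hX, hY, hp, hq]
        ring
      · have h0 := hz0 z hz
        by_cases hzΩ : z ∈ Ω
        · rw [indicator_of_mem hzΩ, integrand_eta _ _ _ hηd, h0]
          simp
        · rw [indicator_of_notMem hzΩ, h0]; simp
    rw [integral_add iX1 iY1, iX, iY] at h2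
    have h3 : ∫ z, (fderiv ℝ X z 1 * η z + fderiv ℝ Y z I * η z) = 0 := by
      rw [integral_add iX2 iY2]; linarith
    rw [← h3]
    congr 1
    ext z
    by_cases hz : z ∈ U
    · have dp : DifferentiableAt ℝ p z := (hpC.contDiffAt (hU.mem_nhds hz)).differentiableAt one_ne_zero
      have dq : DifferentiableAt ℝ q z := (hqC.contDiffAt (hU.mem_nhds hz)).differentiableAt one_ne_zero
      have hp' := dp.hasFDerivAt
      have hq' := dq.hasFDerivAt
      have eX : fderiv ℝ X z 1 = e.re * (2 * p z * fderiv ℝ p z 1 + 2 * q z * fderiv ℝ q z 1)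
         - 2 * (fderiv ℝ p z 1 * e.re + fderiv ℝ q z 1 * e.im) * p z
         - 2 * (p z * e.re + q z * e.im) * fderiv ℝ p z 1 := by
        have := (((((hp'.pow 2).add (hq'.pow 2)).add_const 1).const_mul e.re).sub
          (((((hp'.mul_const e.re).add (hq'.mul_const e.im)).const_mul 2)).mul hp')).fderiv
        have h4 : fderiv ℝ X z = _ := this
        rw [h4]; simp; ring
      have eY : fderiv ℝ Y z I = e.im * (2 * p z * fderiv ℝ p z I + 2 * q z * fderiv ℝ q z I)
         - 2 * (fderiv ℝ p z I * e.re + fderiv ℝ q z I * e.im) * q z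
         - 2 * (p z * e.re + q z * e.im) * fderiv ℝ q z I := by
        have := (((((hp'.pow 2).add (hq'.pow 2)).add_const 1).const_mul e.im).sub
          (((((hp'.mul_const e.re).add (hq'.mul_const e.im)).const_mul 2)).mul hq')).fderiv
        have h4 : fderiv ℝ Y z = _ := this
        rw [h4]; simp; ring
      rw [eX, eY, hsym z hz]
      simp only [hlap]; ring
    · have : η z = 0 := by
        by_contra h
        exact hz (hηs (subset_tsupport _ h))
      simp [this]
  have hlap0 : ∀ z ∈ U, lap z = 0 := by
    by_contra! hcon
    obtain ⟨z, hz, hne⟩ := hcon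
    have hev : ∀ᶠ w in 𝓝 z, w ∈ U ∧ lap w ≠ 0 :=
      (hU.mem_nhds hz) |> fun h => (Filter.eventually_of_mem h fun _ h => h).and
        ((hlapC.continuousAt (hU.mem_nhds hz)).eventually_ne hne)
    have hp0 : p =ᶠ[𝓝 z] fun _ => 0 := by
      filter_upwards [hev] with w hw
      have := key 1 w hw.1
      simpa [hw.2] using this
    have hq0 : q =ᶠ[𝓝 z] fun _ => 0 := by
      filter_upwards [hev] with w hw
      have := key I w hw.1
      simpa [hw.2] using this
    apply hne
    simp [hlap, hp0.fderiv_eq, hq0.fderiv_eq]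
  intro z hz
  refine ⟨hC2.contDiffAt (hU.mem_nhds hz), ?_⟩
  filter_upwards [hU.mem_nhds hz] with w hw
  have hd : DifferentiableAt ℝ (fderiv ℝ u) w :=
      (hdu.contDiffAt (hU.mem_nhds hw)).differentiableAt one_ne_zero
  have h0 := hlap0 w hw
  simp only [hlap, hp, hq] at h0
  rw [fderiv_clm_apply hd (by fun_prop), fderiv_clm_apply hd (by fun_prop)] at h0
  simp [InnerProductSpace.laplacian_eq_iteratedFDeriv_complexPlane, iteratedFDeriv_two_apply]
  simpa using h0

open Complex Metric Set Filter MeasureTheory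
open scoped Topology Classical NNReal

/-- bounded and measurable on `K` -/
structure BM (K : Set ℂ) (h : ℂ → ℝ) : Prop where
  meas : AEStronglyMeasurable h (volume.restrict K)
  bdd : ∃ C, ∀ z ∈ K, |h z| ≤ C

lemma BM.add {K : Set ℂ} {f g : ℂ → ℝ} (hf : BM K f) (hg : BM K g) : BM K (fun z => f z + g z) := by
  obtain ⟨C, hC⟩ := hf.bdd
  obtain ⟨D, hD⟩ := hg.bdd
  exact ⟨hf.meas.add hg.meas, C + D, fun z hz => (abs_add_le _ _).trans (add_le_add (hC z hz) (hD z hz))⟩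

lemma BM.mul {K : Set ℂ} {f g : ℂ → ℝ} (hf : BM K f) (hg : BM K g) : BM K (fun z => f z * g z) := by
  obtain ⟨C, hC⟩ := hf.bdd
  obtain ⟨D, hD⟩ := hg.bdd
  refine ⟨hf.meas.mul hg.meas, C * D, fun z hz => ?_⟩
  rw [abs_mul]
  exact mul_le_mul (hC z hz) (hD z hz) (abs_nonneg _) ((abs_nonneg _).trans (hC z hz))

lemma BM.const {K : Set ℂ} (c : ℝ) : BM K (fun _ => c) :=
  ⟨aestronglyMeasurable_const, |c|, fun _ _ => le_rfl⟩

lemma BM.neg {K : Set ℂ} {f : ℂ → ℝ} (hf : BM K f) : BM K (fun z => - f z) := by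
  simpa using (BM.const (-1)).mul hf

lemma BM.sub {K : Set ℂ} {f g : ℂ → ℝ} (hf : BM K f) (hg : BM K g) : BM K (fun z => f z - g z) := by
  simpa [sub_eq_add_neg] using hf.add hg.neg

lemma BM.sq {K : Set ℂ} {f : ℂ → ℝ} (hf : BM K f) : BM K (fun z => f z ^ 2) := by
  simpa [pow_two] using hf.mul hf

lemma BM.of_cont {K : Set ℂ} (hK : IsCompact K) {f : ℂ → ℝ} (hf : ContinuousOn f K) : BM K f := by
  obtain ⟨C, hC⟩ := hK.exists_bound_of_continuousOn hf
  exact ⟨hf.aestronglyMeasurable hK.measurableSet, C, hC⟩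

lemma BM.int {K : Set ℂ} (hK : IsCompact K) {f : ℂ → ℝ} (hf : BM K f) : IntegrableOn f K := by
  obtain ⟨C, hC⟩ := hf.bdd
  have : IsFiniteMeasure (volume.restrict K) := ⟨by simpa using hK.measure_lt_top⟩
  refine Integrable.of_bound hf.meas C ?_
  filter_upwards [ae_restrict_mem hK.measurableSet] with z hz
  exact hC z hz

/-- basic data -/
structure Data (Ω : Set ℂ) (u : ℂ → ℝ) (L : ℝ) : Prop where
  op : IsOpen Ω
  var : VariationalSolution Ω u
  L0 : 0 ≤ L
  lip : ∀ z ∈ Ω, ∀ w ∈ Ω, |u z - u w| ≤ L * ‖z - w‖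

namespace Data
variable {Ω : Set ℂ} {u : ℂ → ℝ} {L : ℝ}

lemma cont (h : Data Ω u L) : ContinuousOn u Ω := h.var.1
lemma nn (h : Data Ω u L) : ∀ z ∈ Ω, 0 ≤ u z := h.var.2.1

lemma Uop (h : Data Ω u L) : IsOpen (posSet Ω u) := posSet_open h.op h.cont

lemma C2 (h : Data Ω u L) : ContDiffOn ℝ 2 u (posSet Ω u) := h.var.2.2.2.1

lemma diff (h : Data Ω u L) {z : ℂ} (hz : z ∈ posSet Ω u) : DifferentiableAt ℝ u z :=
  (h.C2.contDiffAt (h.Uop.mem_nhds hz)).differentiableAt two_ne_zero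

lemma zero (h : Data Ω u L) {z : ℂ} (hz : z ∈ Ω) (hz' : z ∉ posSet Ω u) : u z = 0 := by
  have := h.nn z hz
  by_contra hne
  exact hz' ⟨hz, lt_of_le_of_ne this (Ne.symm hne)⟩

lemma fd_zero (h : Data Ω u L) {z : ℂ} (hz : z ∈ Ω) (hz' : z ∉ posSet Ω u) : fderiv ℝ u z = 0 := by
  apply IsLocalMin.fderiv_eq_zero
  filter_upwards [h.op.mem_nhds hz] with w hw
  rw [h.zero hz hz']; exact h.nn w hw

lemma fd_le (h : Data Ω u L) {z : ℂ} (hz : z ∈ Ω) : ‖fderiv ℝ u z‖ ≤ L := by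
  apply norm_fderiv_le_of_lip' ℝ h.L0
  filter_upwards [h.op.mem_nhds hz] with w hw
  exact h.lip w hw z hz

lemma fdapp_le (h : Data Ω u L) {z : ℂ} (hz : z ∈ Ω) (e : ℂ) : |fderiv ℝ u z e| ≤ L * ‖e‖ :=
  (ContinuousLinearMap.le_opNorm _ _).trans (mul_le_mul_of_nonneg_right (h.fd_le hz) (norm_nonneg _))

lemma bm_u (h : Data Ω u L) {K : Set ℂ} (hK : IsCompact K) (hs : K ⊆ Ω) : BM K u :=
  BM.of_cont hK (h.cont.mono hs)

lemma bm_fd (h : Data Ω u L) {K : Set ℂ} (hs : K ⊆ Ω) (e : ℂ) :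
    BM K (fun z => fderiv ℝ u z e) :=
  ⟨(measurable_fderiv_apply_const ℝ u e).aestronglyMeasurable, L * ‖e‖,
    fun z hz => h.fdapp_le (hs hz) e⟩

lemma bm_chi (h : Data Ω u L) (K : Set ℂ) :
    BM K ((posSet Ω u).indicator (fun _ => (1:ℝ))) := by
  refine ⟨(measurable_const.indicator h.Uop.measurableSet).aestronglyMeasurable, 1, fun z _ => ?_⟩
  by_cases hz : z ∈ posSet Ω u <;> simp [hz]

lemma sq_fd (h : Data Ω u L) {z : ℂ} (hz : z ∈ Ω) :
    HasFDerivAt (fun w => u w ^ 2) ((2 * u z) • fderiv ℝ u z) z := by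
  by_cases hz' : z ∈ posSet Ω u
  · simpa using (h.diff hz').hasFDerivAt.pow 2
  · rw [h.fd_zero hz hz', smul_zero]
    have hu := h.zero hz hz'
    rw [hasFDerivAt_iff_isLittleO_nhds_zero]
    have : (fun k : ℂ => u (z + k) ^ 2 - u z ^ 2 - (0 : ℂ →L[ℝ] ℝ) k) =O[𝓝 0] fun k => ‖k‖ ^ 2 := by
      apply Asymptotics.IsBigO.of_bound (L ^ 2)
      have hn : ∀ᶠ k : ℂ in 𝓝 0, z + k ∈ Ω := by
        have : Tendsto (fun k : ℂ => z + k) (𝓝 0) (𝓝 z) := by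
          have h3 : Continuous fun k : ℂ => z + k := by fun_prop
          have h4 := h3.tendsto 0
          rwa [add_zero] at h4
        exact this (h.op.mem_nhds hz)
      filter_upwards [hn] with k hk
      have h1 := h.lip _ hk z hz
      rw [hu, sub_zero, add_sub_cancel_left] at h1
      simp only [hu, Real.norm_eq_abs, _root_.zero_apply, ne_eq, OfNat.ofNat_ne_zero,
        not_false_eq_true, zero_pow, sub_zero, abs_pow, abs_norm]
      calc |u (z + k)| ^ 2 ≤ (L * ‖k‖) ^ 2 := pow_le_pow_left₀ (abs_nonneg _) h1 2
        _ = _ := by ring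
    refine this.trans_isLittleO ?_
    have h2 : (fun k : ℂ => ‖k‖ ^ 2) =o[𝓝 0] fun k : ℂ => ‖k‖ ^ 1 :=
      Asymptotics.isLittleO_norm_pow_norm_pow (by norm_num)
    simp only [pow_one] at h2
    exact h2.of_norm_right

lemma fd_tsupp {η : ℂ → ℝ} {z : ℂ} (hz : z ∉ tsupport η) : fderiv ℝ η z = 0 := by
  by_contra h
  exact hz (support_fderiv_subset ℝ h)

lemma int_of_zero {K : Set ℂ} {f : ℂ → ℝ} (hf : IntegrableOn f K) (h0 : ∀ z, z ∉ K → f z = 0) :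
    Integrable f := by
  rw [← integrableOn_iff_integrable_of_support_subset (s := K)]
  · exact hf
  · intro z hz
    by_contra hz'
    exact hz (h0 z hz')

/-- integration by parts for `u ^ 2` -/
lemma ibp_sq (h : Data Ω u L) {η : ℂ → ℝ} (hη : ContDiff ℝ 1 η) (hc : HasCompactSupport η)
    (hs : tsupport η ⊆ Ω) (e : ℂ) :
    ∫ z in tsupport η, (u z ^ 2 * fderiv ℝ η z e + 2 * u z * fderiv ℝ u z e * η z) = 0 := by
  set K := tsupport η
  have hK : IsCompact K := hc
  have bη : BM K η := BM.of_cont hK hη.continuous.continuousOn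
  have bη' : BM K (fun z => fderiv ℝ η z e) :=
    BM.of_cont hK ((hη.continuous_fderiv one_ne_zero).clm_apply continuous_const).continuousOn
  have bu := h.bm_u hK hs
  have bf := h.bm_fd hs e
  have i1 : IntegrableOn (fun z => u z ^ 2 * fderiv ℝ η z e) K := (bu.sq.mul bη').int hK
  have i2' : IntegrableOn (fun z => 2 * u z * fderiv ℝ u z e * η z) K :=
    ((((BM.const 2).mul bu).mul bf).mul bη).int hK
  have i3 : IntegrableOn (fun z => u z ^ 2 * η z) K := (bu.sq.mul bη).int hK
  have hη0 : ∀ z, z ∉ K → η z = 0 := fun z hz => image_eq_zero_of_notMem_tsupport hz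
  have j1 : Integrable (fun z => u z ^ 2 * fderiv ℝ η z e) :=
    int_of_zero i1 (fun z hz => by simp [fd_tsupp hz])
  have j3 : Integrable (fun z => u z ^ 2 * η z) := int_of_zero i3 (fun z hz => by simp [hη0 z hz])
  have e2 : (fun z => fderiv ℝ (fun w => u w ^ 2) z e * η z) =
      (fun z => 2 * u z * fderiv ℝ u z e * η z) := by
    ext z
    by_cases hz : z ∈ K
    · rw [(h.sq_fd (hs hz)).fderiv]; simp
    · simp [hη0 z hz]
  have j2 : Integrable (fun z => 2 * u z * fderiv ℝ u z e * η z) :=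
    int_of_zero i2' (fun z hz => by simp [hη0 z hz])
  have := integral_mul_fderiv_eq_neg_fderiv_mul_of_integrable (f := fun w => u w ^ 2) (g := η) (v := e)
    (μ := volume) (by rw [e2]; exact j2) j1 j3 (fun x hx => (h.sq_fd (hs hx)).differentiableAt)
    (fun x _ => hη.differentiable one_ne_zero x)
  rw [e2] at this
  rw [setIntegral_eq_integral_of_forall_compl_eq_zero (fun z hz => by simp [fd_tsupp hz, hη0 z hz]),
    integral_add j1 j2, this]
  ring

end Data

open Complex Metric Set Filter MeasureTheory
open scoped Topology Classical NNReal

lemma cutG : ∃ G : ℝ → ℝ, ContDiff ℝ 1 G ∧ (∀ s ≤ 1, G s = 0) ∧ (∀ s, 2 ≤ s → G s = s) ∧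
    (∃ C, ∀ s, |deriv G s| ≤ C) ∧ (∀ s, 0 ≤ s → |G s| ≤ s) := by
  refine ⟨fun s => s * Real.smoothTransition (s - 1), ?_, ?_, ?_, ?_, ?_⟩
  · exact contDiff_id.mul (Real.smoothTransition.contDiff.comp (contDiff_id.sub contDiff_const))
  · intro s hs; simp [Real.smoothTransition.zero_of_nonpos (show s - 1 ≤ 0 by linarith)]
  · intro s hs; simp [Real.smoothTransition.one_of_one_le (show 1 ≤ s - 1 by linarith)]
  · set G : ℝ → ℝ := fun s => s * Real.smoothTransition (s - 1) with hG
    have hGC : ContDiff ℝ 1 G :=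
      contDiff_id.mul (Real.smoothTransition.contDiff.comp (contDiff_id.sub contDiff_const))
    have hc : Continuous (deriv G) := hGC.continuous_deriv le_rfl
    obtain ⟨C, hC⟩ := (isCompact_Icc (a := (1:ℝ)) (b := 2)).exists_bound_of_continuousOn hc.continuousOn
    refine ⟨max C 1, fun s => ?_⟩
    rcases lt_or_ge s 1 with h1 | h1
    · have : G =ᶠ[𝓝 s] fun _ => 0 := by
        filter_upwards [Iio_mem_nhds h1] with t ht
        simp [hG, Real.smoothTransition.zero_of_nonpos (show t - 1 ≤ 0 by linarith [mem_Iio.1 ht])]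
      rw [this.deriv_eq]; simp
    rcases lt_or_ge 2 s with h2 | h2
    · have : G =ᶠ[𝓝 s] fun t => t := by
        filter_upwards [Ioi_mem_nhds h2] with t ht
        simp [hG, Real.smoothTransition.one_of_one_le (show 1 ≤ t - 1 by linarith [mem_Ioi.1 ht])]
      rw [this.deriv_eq]; simp
    · exact (hC s ⟨h1, h2⟩).trans (le_max_left _ _)
  · intro s hs
    rw [abs_of_nonneg (mul_nonneg hs (Real.smoothTransition.nonneg _))]
    exact mul_le_of_le_one_right hs (Real.smoothTransition.le_one _)

namespace Data
variable {Ω : Set ℂ} {u : ℂ → ℝ} {L : ℝ}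

lemma harm (h : Data Ω u L) : ∀ z ∈ posSet Ω u, InnerProductSpace.HarmonicAt u z :=
  harm_of_var h.op h.var

lemma lap (h : Data Ω u L) {z : ℂ} (hz : z ∈ posSet Ω u) :
    fderiv ℝ (fun w => fderiv ℝ u w 1) z 1 + fderiv ℝ (fun w => fderiv ℝ u w I) z I = 0 := by
  have hd : DifferentiableAt ℝ (fderiv ℝ u) z :=
      ((h.C2.fderiv_of_isOpen (m := 1) h.Uop (by norm_num)).contDiffAt
        (h.Uop.mem_nhds hz)).differentiableAt one_ne_zero
  have h2 := (h.harm z hz).2.eq_of_nhds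
  rw [fderiv_clm_apply hd (by fun_prop), fderiv_clm_apply hd (by fun_prop)]
  simp [InnerProductSpace.laplacian_eq_iteratedFDeriv_complexPlane, iteratedFDeriv_two_apply] at h2
  simpa using h2

lemma cacc_eps (h : Data Ω u L) {ζ : ℂ → ℝ} (hζ : ContDiff ℝ 1 ζ) (hc : HasCompactSupport ζ)
    (hs : tsupport ζ ⊆ Ω) {G : ℝ → ℝ} (hG : ContDiff ℝ 1 G) (hG0 : ∀ s ≤ 1, G s = 0)
    {ε : ℝ} (hε : 0 < ε) :
    ∫ z in tsupport ζ, (deriv G (u z / ε) * (fderiv ℝ u z 1 ^ 2 + fderiv ℝ u z I ^ 2) * ζ z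
      + ε * G (u z / ε) * (fderiv ℝ u z 1 * fderiv ℝ ζ z 1 + fderiv ℝ u z I * fderiv ℝ ζ z I)) = 0 := by
  set U := posSet Ω u with hUdef
  have hU : IsOpen U := h.Uop
  set η : ℂ → ℝ := fun z => ε * G (u z / ε) * ζ z with hη
  have hG1 : ∀ s < 1, deriv G s = 0 := by
    intro s hs
    have : G =ᶠ[𝓝 s] fun _ => 0 := by
      filter_upwards [Iio_mem_nhds hs] with t ht using hG0 t (le_of_lt ht)
    rw [this.deriv_eq]; simp
  -- vanishing
  have hvan : ∀ z, z ∉ U ∩ tsupport ζ → η =ᶠ[𝓝 z] fun _ => 0 := by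
    intro z hz
    by_cases hzs : z ∈ tsupport ζ
    · have hzΩ := hs hzs
      have hzU : z ∉ U := fun h' => hz ⟨h', hzs⟩
      have hu0 := h.zero hzΩ hzU
      have : ∀ᶠ w in 𝓝 z, u w < ε :=
        (h.cont.continuousAt (h.op.mem_nhds hzΩ)).eventually_lt continuousAt_const (by rw [hu0]; exact hε)
      filter_upwards [this] with w hw
      simp [hη, hG0 (u w / ε) ((div_le_one hε).2 hw.le)]
    · have := notMem_tsupport_iff_eventuallyEq.1 hzs
      filter_upwards [this] with w hw
      simp [hη, hw]
  have hts : tsupport η ⊆ U ∩ tsupport ζ := by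
    intro z hz
    by_contra hcon
    exact notMem_tsupport_iff_eventuallyEq.2 (hvan z hcon) hz
  have hηC : ContDiff ℝ 1 η := by
    rw [contDiff_iff_contDiffAt]
    intro z
    by_cases hz : z ∈ U ∩ tsupport ζ
    · have hu1 : ContDiffAt ℝ 1 u z := (h.C2.contDiffAt (hU.mem_nhds hz.1)).of_le (by norm_num)
      exact (contDiffAt_const.mul (hG.contDiffAt.comp z (hu1.div_const ε))).mul hζ.contDiffAt
    · exact contDiffAt_const.congr_of_eventuallyEq (hvan z hz)
  have hηc : HasCompactSupport η :=
    hc.mono' ((subset_tsupport _).trans (hts.trans inter_subset_right))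
  have hdu : ContDiffOn ℝ 1 (fderiv ℝ u) U := h.C2.fderiv_of_isOpen hU (by norm_num)
  obtain ⟨a1, a2, a3⟩ := ibp_aux hU (g := fun z => fderiv ℝ u z 1)
    (hdu.clm_apply contDiffOn_const) hηC hηc (hts.trans inter_subset_left) 1
  obtain ⟨b1, b2, b3⟩ := ibp_aux hU (g := fun z => fderiv ℝ u z I)
    (hdu.clm_apply contDiffOn_const) hηC hηc (hts.trans inter_subset_left) I
  have hsum : ∫ z, (fderiv ℝ u z 1 * fderiv ℝ η z 1 + fderiv ℝ u z I * fderiv ℝ η z I) = 0 := by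
    rw [integral_add a1 b1, a3, b3]
    have : ∫ z, (fderiv ℝ (fun z => fderiv ℝ u z 1) z 1 * η z +
        fderiv ℝ (fun z => fderiv ℝ u z I) z I * η z) = 0 := by
      rw [← integral_zero ℂ ℝ]
      congr 1; ext z
      by_cases hz : z ∈ U
      · rw [← add_mul, h.lap hz, zero_mul]
      · have : η z = 0 := image_eq_zero_of_notMem_tsupport (fun h' => hz (hts h').1)
        simp [this]
    rw [integral_add a2 b2] at this
    linarith
  rw [setIntegral_eq_integral_of_forall_compl_eq_zero, ← hsum]
  · congr 1; ext z
    by_cases hz : z ∈ U ∩ tsupport ζ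
    · have hGd : HasDerivAt G (deriv G (u z / ε)) (u z / ε) :=
        (hG.differentiable one_ne_zero _).hasDerivAt
      have hud := (h.diff hz.1).hasFDerivAt
      have hud' : HasFDerivAt (fun w => u w / ε) (ε⁻¹ • fderiv ℝ u z) z := by
        have := hud.mul_const ε⁻¹
        simpa [div_eq_mul_inv] using this
      have h1 := ((hGd.comp_hasFDerivAt z hud').const_mul ε).mul
        (hζ.differentiable one_ne_zero z).hasFDerivAt
      have h2 : fderiv ℝ η z = _ := h1.fderiv
      rw [h2]
      simp
      field_simp
      ring
    · rw [(hvan z hz).fderiv_eq]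
      by_cases hzs : z ∈ tsupport ζ
      · rw [h.fd_zero (hs hzs) (fun h' => hz ⟨h', hzs⟩)]; simp
      · rw [fd_tsupp hzs, image_eq_zero_of_notMem_tsupport hzs]; simp
  · intro z hz
    rw [fd_tsupp hz, image_eq_zero_of_notMem_tsupport hz]; simp

lemma cacc (h : Data Ω u L) {ζ : ℂ → ℝ} (hζ : ContDiff ℝ 1 ζ) (hc : HasCompactSupport ζ)
    (hs : tsupport ζ ⊆ Ω) :
    ∫ z in tsupport ζ, ((fderiv ℝ u z 1 ^ 2 + fderiv ℝ u z I ^ 2) * ζ z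
      + u z * (fderiv ℝ u z 1 * fderiv ℝ ζ z 1 + fderiv ℝ u z I * fderiv ℝ ζ z I)) = 0 := by
  obtain ⟨G, hG, hG0, hG2, ⟨C, hC⟩, hGle⟩ := cutG
  set K := tsupport ζ with hKd
  have hK : IsCompact K := hc
  have bp := h.bm_fd hs 1
  have bq := h.bm_fd hs I
  have bu := h.bm_u hK hs
  have bζ : BM K ζ := BM.of_cont hK hζ.continuous.continuousOn
  have bζ' : ∀ e, BM K (fun z => fderiv ℝ ζ z e) := fun e =>
    BM.of_cont hK ((hζ.continuous_fderiv one_ne_zero).clm_apply continuous_const).continuousOn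
  have bA : BM K (fun z => (fderiv ℝ u z 1 ^ 2 + fderiv ℝ u z I ^ 2) * ζ z) := (bp.sq.add bq.sq).mul bζ
  have bB : BM K (fun z => fderiv ℝ u z 1 * fderiv ℝ ζ z 1 + fderiv ℝ u z I * fderiv ℝ ζ z I) :=
    (bp.mul (bζ' 1)).add (bq.mul (bζ' I))
  set A := (fun z => (fderiv ℝ u z 1 ^ 2 + fderiv ℝ u z I ^ 2) * ζ z) with hA
  set B := (fun z => fderiv ℝ u z 1 * fderiv ℝ ζ z 1 + fderiv ℝ u z I * fderiv ℝ ζ z I) with hB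
  let ε : ℕ → ℝ := fun n => 1 / ((n:ℝ) + 1)
  have hεp : ∀ n, 0 < ε n := fun n => Nat.one_div_pos_of_nat
  have hεl : Tendsto ε atTop (𝓝 0) := tendsto_one_div_add_atTop_nhds_zero_nat
  have hlim : Tendsto (fun n => ∫ z in K, (deriv G (u z / ε n) * A z + ε n * G (u z / ε n) * B z))
      atTop (𝓝 (∫ z in K, (A z + u z * B z))) := by
    apply tendsto_integral_of_dominated_convergence (fun z => C * |A z| + |u z| * |B z|)
    · intro n
      have m1 : AEStronglyMeasurable (fun z => deriv G (u z / ε n)) (volume.restrict K) :=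
        ((hG.continuous_deriv le_rfl).comp_continuousOn
          ((h.cont.mono hs).div_const _)).aestronglyMeasurable hK.measurableSet
      have m2 : AEStronglyMeasurable (fun z => ε n * G (u z / ε n)) (volume.restrict K) :=
        (continuousOn_const.mul (hG.continuous.comp_continuousOn
          ((h.cont.mono hs).div_const _))).aestronglyMeasurable hK.measurableSet
      exact (m1.mul bA.meas).add (m2.mul bB.meas)
    · have i1 := (bA.int hK).norm.const_mul C
      have i2 := ((bu.mul bB).int hK).norm
      have := i1.add i2
      refine this.congr ?_
      filter_upwards with z
      simp [abs_mul]
    · intro n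
      filter_upwards [ae_restrict_mem hK.measurableSet] with z hz
      have hu0 := h.nn z (hs hz)
      refine (norm_add_le _ _).trans (add_le_add ?_ ?_)
      · rw [norm_mul]
        exact mul_le_mul_of_nonneg_right (hC _) (norm_nonneg _)
      · rw [norm_mul]
        refine mul_le_mul_of_nonneg_right ?_ (norm_nonneg _)
        rw [norm_mul, Real.norm_eq_abs, abs_of_pos (hεp n), abs_of_nonneg hu0]
        have := mul_le_mul_of_nonneg_left (hGle (u z / ε n) (div_nonneg hu0 (hεp n).le)) (hεp n).le
        rwa [mul_div_cancel₀ _ (hεp n).ne'] at this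
    · filter_upwards [ae_restrict_mem hK.measurableSet] with z hz
      by_cases hzU : z ∈ posSet Ω u
      · have hpos : 0 < u z := hzU.2
        have : ∀ᶠ n in atTop, 2 < u z / ε n := by
          have : ∀ᶠ n in atTop, ε n < u z / 2 := hεl.eventually_lt_const (by positivity)
          filter_upwards [this] with n hn
          rw [lt_div_iff₀ (hεp n)]; linarith
        apply tendsto_const_nhds.congr'
        filter_upwards [this] with n hn
        have : G =ᶠ[𝓝 (u z / ε n)] fun t => t := by
          filter_upwards [Ioi_mem_nhds hn] with t ht using hG2 t (le_of_lt ht)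
        rw [this.deriv_eq, hG2 _ hn.le, mul_div_cancel₀ _ (hεp n).ne']; simp
      · have hA0 : A z = 0 := by simp [hA, h.fd_zero (hs hz) hzU]
        have hB0 : B z = 0 := by simp [hB, h.fd_zero (hs hz) hzU]
        simp [hA0, hB0]
  have h0 : ∀ n, ∫ z in K, (deriv G (u z / ε n) * A z + ε n * G (u z / ε n) * B z) = 0 := by
    intro n
    have := h.cacc_eps hζ hc hs hG hG0 (hεp n)
    simpa [hA, hB, mul_assoc] using this
  simp only [h0] at hlim
  exact (tendsto_nhds_unique hlim tendsto_const_nhds)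

end Data

open Complex Metric Set Filter MeasureTheory
open scoped Topology Classical NNReal

/-- squared norm -/
def Nn (z : ℂ) : ℝ := z.re ^ 2 + z.im ^ 2

lemma Nn_eq (z : ℂ) : Nn z = ‖z‖ ^ 2 := by
  rw [← Complex.normSq_eq_norm_sq, Complex.normSq_apply]; simp [Nn]; ring

lemma Nn_nonneg (z : ℂ) : 0 ≤ Nn z := by unfold Nn; positivity

lemma Nn_hasFDerivAt (z : ℂ) : HasFDerivAt Nn ((2 * z.re) • reCLM + (2 * z.im) • imCLM) z := by
  have h1 := (reCLM.hasFDerivAt (x := z)).pow 2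
  have h2 := (imCLM.hasFDerivAt (x := z)).pow 2
  refine HasFDerivAt.congr_fderiv (f := Nn) (h1.add h2) ?_
  ext <;> simp

lemma Nn_contDiff : ContDiff ℝ (⊤ : ℕ∞) Nn := by
  have h1 : ContDiff ℝ (⊤ : ℕ∞) (fun z : ℂ => reCLM z) := reCLM.contDiff
  have h2 : ContDiff ℝ (⊤ : ℕ∞) (fun z : ℂ => imCLM z) := imCLM.contDiff
  exact (h1.pow 2).add (h2.pow 2)

section rad
variable {ε : ℝ} (hε : 0 < ε) {H : ℝ → ℝ} (hH : ContDiffOn ℝ (⊤ : ℕ∞) H (Ioi (-ε)))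

lemma Nn_mem (hε : 0 < ε) (z : ℂ) : Nn z ∈ Ioi (-ε) := by
  have := Nn_nonneg z
  simp only [mem_Ioi]; linarith

lemma rad_contDiff (hε : 0 < ε) (hH : ContDiffOn ℝ (⊤ : ℕ∞) H (Ioi (-ε))) :
    ContDiff ℝ (⊤ : ℕ∞) (fun z => H (Nn z)) := by
  rw [contDiff_iff_contDiffAt]
  intro z
  exact (hH.contDiffAt (isOpen_Ioi.mem_nhds (Nn_mem hε z))).comp z Nn_contDiff.contDiffAt

lemma rad_fderiv (hε : 0 < ε) (hH : ContDiffOn ℝ (⊤ : ℕ∞) H (Ioi (-ε))) (z : ℂ) :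
    HasFDerivAt (fun z => H (Nn z))
      (deriv H (Nn z) • ((2 * z.re) • reCLM + (2 * z.im) • imCLM)) z := by
  have h1 : HasDerivAt H (deriv H (Nn z)) (Nn z) :=
    ((hH.contDiffAt (isOpen_Ioi.mem_nhds (Nn_mem hε z))).differentiableAt (by simp)).hasDerivAt
  exact h1.comp_hasFDerivAt z (Nn_hasFDerivAt z)

lemma deriv_cd (hH : ContDiffOn ℝ (⊤ : ℕ∞) H (Ioi (-ε))) :
    ContDiffOn ℝ (⊤ : ℕ∞) (deriv H) (Ioi (-ε)) :=
  hH.deriv_of_isOpen isOpen_Ioi (by simp)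

lemma deriv_van {T : ℝ} (hT : ∀ t, T < t → H t = 0) : ∀ t, T < t → deriv H t = 0 := by
  intro t ht
  have : H =ᶠ[𝓝 t] fun _ => 0 := by
    filter_upwards [Ioi_mem_nhds ht] with s hs using hT s hs
  rw [this.deriv_eq]; simp
end rad

lemma supp_rad {R T : ℝ} (hTR : T ≤ R ^ 2) (hR : 0 ≤ R) {α : Type*} [Zero α] {f : ℂ → α}
    (hf : ∀ z, T < Nn z → f z = 0) : tsupport f ⊆ closedBall 0 R := by
  apply closure_minimal _ isClosed_closedBall
  intro z hz
  by_contra hcon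
  simp only [mem_closedBall, dist_zero_right, not_le] at hcon
  apply hz
  apply hf
  rw [Nn_eq]
  nlinarith

namespace Data
variable {Ω : Set ℂ} {u : ℂ → ℝ} {L : ℝ}

lemma int_eq_of_supp {K : Set ℂ} {f η : ℂ → ℝ} (hs : tsupport η ⊆ K)
    (h0 : ∀ z, z ∉ tsupport η → f z = 0) :
    ∫ z in K, f z = ∫ z in tsupport η, f z := by
  rw [setIntegral_eq_integral_of_forall_compl_eq_zero h0,
    setIntegral_eq_integral_of_forall_compl_eq_zero (fun z hz => h0 z (fun h => hz (hs h)))]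

lemma ibp_sq' (h : Data Ω u L) {R : ℝ} (hKΩ : closedBall (0:ℂ) R ⊆ Ω) {η : ℂ → ℝ} (hη : ContDiff ℝ 1 η)
    (hs : tsupport η ⊆ closedBall (0:ℂ) R) (e : ℂ) :
    ∫ z in closedBall (0:ℂ) R, (u z ^ 2 * fderiv ℝ η z e + 2 * u z * fderiv ℝ u z e * η z) = 0 := by
  rw [int_eq_of_supp hs (fun z hz => by
    rw [fd_tsupp hz, image_eq_zero_of_notMem_tsupport hz]; simp)]
  exact h.ibp_sq hη ((isCompact_closedBall 0 R).of_isClosed_subset (isClosed_tsupport _) hs)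
    (hs.trans hKΩ) e

lemma cacc' (h : Data Ω u L) {R : ℝ} (hKΩ : closedBall (0:ℂ) R ⊆ Ω) {ζ : ℂ → ℝ} (hη : ContDiff ℝ 1 ζ)
    (hs : tsupport ζ ⊆ closedBall (0:ℂ) R) :
    ∫ z in closedBall (0:ℂ) R, ((fderiv ℝ u z 1 ^ 2 + fderiv ℝ u z I ^ 2) * ζ z
      + u z * (fderiv ℝ u z 1 * fderiv ℝ ζ z 1 + fderiv ℝ u z I * fderiv ℝ ζ z I)) = 0 := by
  rw [int_eq_of_supp hs (fun z hz => by
    rw [fd_tsupp hz, image_eq_zero_of_notMem_tsupport hz]; simp)]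
  exact h.cacc hη ((isCompact_closedBall 0 R).of_isClosed_subset (isClosed_tsupport _) hs)
    (hs.trans hKΩ)

/-- radial derivative -/
noncomputable def Du (u : ℂ → ℝ) (z : ℂ) : ℝ := z.re * fderiv ℝ u z 1 + z.im * fderiv ℝ u z I

lemma i1 (h : Data Ω u L) {R : ℝ} (hR : 0 ≤ R) (hKΩ : closedBall (0:ℂ) R ⊆ Ω)
    {ε : ℝ} (hε : 0 < ε) {F : ℝ → ℝ} (hF : ContDiffOn ℝ (⊤ : ℕ∞) F (Ioi (-ε)))
    {T : ℝ} (hTR : T ≤ R ^ 2) (hT : ∀ t, T < t → F t = 0) :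
    ∫ z in closedBall (0:ℂ) R, ((posSet Ω u).indicator (fun _ => (1:ℝ)) z *
        (2 * F (Nn z) + 2 * Nn z * deriv F (Nn z))
      + 2 * Nn z * deriv F (Nn z) * (fderiv ℝ u z 1 ^ 2 + fderiv ℝ u z I ^ 2)
      - 4 * deriv F (Nn z) * Du u z ^ 2) = 0 := by
  have hT1 := deriv_van hT
  have hid := h.var.2.2.2.2 (fun z => F (Nn z) • z)
    ((rad_contDiff hε hF).smul contDiff_id)
    (HasCompactSupport.of_support_subset_isCompact (isCompact_closedBall 0 R)
      ((subset_tsupport _).trans (supp_rad hTR hR (fun z hz => by simp [hT _ hz]))))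
    ((supp_rad hTR hR (fun z hz => by simp [hT _ hz])).trans hKΩ)
  rw [← hid, setIntegral_eq_integral_of_forall_compl_eq_zero (s := closedBall (0:ℂ) R),
    ← integral_indicator h.op.measurableSet]
  · congr 1
    ext z
    by_cases hz : z ∈ Ω
    · rw [indicator_of_mem hz]
      have hd : HasFDerivAt (fun z => F (Nn z) • z) _ z := (rad_fderiv hε hF z).smul (hasFDerivAt_id z)
      have hχ : (posSet Ω u).indicator (fun _ => (1:ℝ)) z = indicator {w | 0 < u w} (fun _ => (1:ℝ)) z := by
        simp [indicator, posSet, hz]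
      have h3 : ‖grad2 u z‖ ^ 2 = fderiv ℝ u z 1 ^ 2 + fderiv ℝ u z I ^ 2 := by
        rw [← Complex.normSq_eq_norm_sq, Complex.normSq_apply, grad2_re, grad2_im]; ring
      rw [hχ, h3]
      simp only [div2, hd.fderiv, dot2, grad2_re, grad2_im]
      simp [grad2_re, grad2_im, Du, Nn]
      ring
    · have hz' : z ∉ closedBall (0:ℂ) R := fun h' => hz (hKΩ h')
      have : T < Nn z := by
        simp only [mem_closedBall, dist_zero_right, not_le] at hz'
        rw [Nn_eq]; nlinarith
      rw [indicator_of_notMem hz, hT _ this, hT1 _ this]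
      simp
  · intro z hz'
    have : T < Nn z := by
      simp only [mem_closedBall, dist_zero_right, not_le] at hz'
      rw [Nn_eq]; nlinarith
    rw [hT _ this, hT1 _ this]; simp

lemma i2 (h : Data Ω u L) {R : ℝ} (hR : 0 ≤ R) (hKΩ : closedBall (0:ℂ) R ⊆ Ω)
    {ε : ℝ} (hε : 0 < ε) {F : ℝ → ℝ} (hF : ContDiffOn ℝ (⊤ : ℕ∞) F (Ioi (-ε)))
    {T : ℝ} (hTR : T ≤ R ^ 2) (hT : ∀ t, T < t → F t = 0) :
    ∫ z in closedBall (0:ℂ) R,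
      (2 * Nn z * deriv F (Nn z) * (fderiv ℝ u z 1 ^ 2 + fderiv ℝ u z I ^ 2)
      + 4 * (deriv F (Nn z) + Nn z * deriv (deriv F) (Nn z)) * (u z * Du u z)) = 0 := by
  have hT1 := deriv_van hT
  have hF1 := deriv_cd hF
  have hd : ∀ z, HasFDerivAt (fun z => 2 * Nn z * deriv F (Nn z)) _ z := fun z =>
    ((Nn_hasFDerivAt z).const_mul 2).mul (rad_fderiv hε hF1 z)
  have := h.cacc' hKΩ (ζ := fun z => 2 * Nn z * deriv F (Nn z))
    (((contDiff_const.mul Nn_contDiff).mul (rad_contDiff hε hF1)).of_le (by exact_mod_cast le_top))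
    (supp_rad hTR hR (fun z hz => by simp [hT1 _ hz]))
  rw [← this]
  congr 1
  ext z
  rw [(hd z).fderiv]
  simp [Du]
  ring

lemma i3 (h : Data Ω u L) {R : ℝ} (hR : 0 ≤ R) (hKΩ : closedBall (0:ℂ) R ⊆ Ω)
    {ε : ℝ} (hε : 0 < ε) {F : ℝ → ℝ} (hF : ContDiffOn ℝ (⊤ : ℕ∞) F (Ioi (-ε)))
    {T : ℝ} (hTR : T ≤ R ^ 2) (hT : ∀ t, T < t → F t = 0) :
    ∫ z in closedBall (0:ℂ) R,
      (u z ^ 2 * (F (Nn z) + Nn z * deriv F (Nn z)) + F (Nn z) * (u z * Du u z)) = 0 := by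
  have hx : ∀ z, HasFDerivAt (fun z => F (Nn z) * reCLM z) _ z := fun z =>
    (rad_fderiv hε hF z).mul (reCLM.hasFDerivAt)
  have hy : ∀ z, HasFDerivAt (fun z => F (Nn z) * imCLM z) _ z := fun z =>
    (rad_fderiv hε hF z).mul (imCLM.hasFDerivAt)
  have cx : ContDiff ℝ 1 (fun z => F (Nn z) * reCLM z) :=
    ((rad_contDiff hε hF).mul reCLM.contDiff).of_le (by exact_mod_cast le_top)
  have cy : ContDiff ℝ 1 (fun z => F (Nn z) * imCLM z) :=
    ((rad_contDiff hε hF).mul imCLM.contDiff).of_le (by exact_mod_cast le_top)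
  have hX := h.ibp_sq' hKΩ cx (supp_rad hTR hR (fun z hz => by simp [hT _ hz])) 1
  have hY := h.ibp_sq' hKΩ cy (supp_rad hTR hR (fun z hz => by simp [hT _ hz])) I
  have hK := isCompact_closedBall (0:ℂ) R
  have iX : ∀ {η : ℂ → ℝ} (e : ℂ), ContDiff ℝ 1 η → IntegrableOn (fun z =>
      u z ^ 2 * fderiv ℝ η z e + 2 * u z * fderiv ℝ u z e * η z) (closedBall 0 R) := by
    intro η e hη
    have bu := h.bm_u hK hKΩ
    exact ((bu.sq.mul (BM.of_cont hK
      ((hη.continuous_fderiv one_ne_zero).clm_apply continuous_const).continuousOn)).add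
      ((((BM.const 2).mul bu).mul (h.bm_fd hKΩ e)).mul (BM.of_cont hK hη.continuous.continuousOn))).int hK
  have hsum := integral_add (iX 1 cx) (iX I cy)
  rw [hX, hY] at hsum
  have h2 : ∫ z in closedBall (0:ℂ) R,
      2 * (u z ^ 2 * (F (Nn z) + Nn z * deriv F (Nn z)) + F (Nn z) * (u z * Du u z)) = 0 := by
    rw [add_zero] at hsum
    rw [← hsum]
    congr 1
    ext z
    rw [(hx z).fderiv, (hy z).fderiv]
    simp [Du, Nn]
    ring
  rw [integral_const_mul] at h2
  linarith

lemma bm_rad {ε : ℝ} (hε : 0 < ε) {F : ℝ → ℝ} (hF : ContDiffOn ℝ (⊤ : ℕ∞) F (Ioi (-ε)))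
    {K : Set ℂ} (hK : IsCompact K) : BM K (fun z => F (Nn z)) :=
  BM.of_cont hK (rad_contDiff hε hF).continuous.continuousOn

lemma bm_Du (h : Data Ω u L) {K : Set ℂ} (hK : IsCompact K) (hs : K ⊆ Ω) : BM K (Du u) :=
  ((BM.of_cont hK reCLM.continuous.continuousOn).mul (h.bm_fd hs 1)).add
    ((BM.of_cont hK imCLM.continuous.continuousOn).mul (h.bm_fd hs I))

lemma main_id (h : Data Ω u L) {R : ℝ} (hR : 0 ≤ R) (hKΩ : closedBall (0:ℂ) R ⊆ Ω)
    {ε : ℝ} (hε : 0 < ε) {F : ℝ → ℝ} (hF : ContDiffOn ℝ (⊤ : ℕ∞) F (Ioi (-ε)))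
    {T : ℝ} (hTR : T ≤ R ^ 2) (hT : ∀ t, T < t → F t = 0) :
    IntegrableOn (fun z => - 4 * deriv F (Nn z) * (Du u z - u z) ^ 2 +
      (posSet Ω u).indicator (fun _ => (1:ℝ)) z * (2 * F (Nn z) + 2 * Nn z * deriv F (Nn z))
      + u z ^ 2 * (16 * deriv F (Nn z) + 20 * Nn z * deriv (deriv F) (Nn z)
        + 4 * Nn z ^ 2 * deriv (deriv (deriv F)) (Nn z))) (closedBall 0 R) ∧
    ∫ z in closedBall (0:ℂ) R, (- 4 * deriv F (Nn z) * (Du u z - u z) ^ 2 +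
      (posSet Ω u).indicator (fun _ => (1:ℝ)) z * (2 * F (Nn z) + 2 * Nn z * deriv F (Nn z))
      + u z ^ 2 * (16 * deriv F (Nn z) + 20 * Nn z * deriv (deriv F) (Nn z)
        + 4 * Nn z ^ 2 * deriv (deriv (deriv F)) (Nn z))) = 0 := by
  have hK := isCompact_closedBall (0:ℂ) R
  have hF1 := deriv_cd hF
  have hF2 := deriv_cd hF1
  have hF3 := deriv_cd hF2
  have hT1 := deriv_van hT
  have hT2 := deriv_van hT1
  have bu := h.bm_u hK hKΩ
  have bD := h.bm_Du hK hKΩ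
  have bp := h.bm_fd hKΩ 1
  have bq := h.bm_fd hKΩ I
  have bχ := h.bm_chi (closedBall (0:ℂ) R)
  have b0 := bm_rad hε hF hK
  have b1 := bm_rad hε hF1 hK
  have b2 := bm_rad hε hF2 hK
  have b3 := bm_rad hε hF3 hK
  have bN : BM (closedBall (0:ℂ) R) Nn := BM.of_cont hK Nn_contDiff.continuous.continuousOn
  have c : ∀ x : ℝ, BM (closedBall (0:ℂ) R) (fun _ => x) := BM.const
  set W : ℝ → ℝ := fun t => 12 * deriv F t + 4 * t * deriv (deriv F) t with hW
  have hWc : ContDiffOn ℝ (⊤ : ℕ∞) W (Ioi (-ε)) :=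
    (contDiffOn_const.mul hF1).add ((contDiffOn_const.mul contDiffOn_id).mul hF2)
  have hWd : ∀ z, deriv W (Nn z) = 16 * deriv (deriv F) (Nn z) + 4 * Nn z * deriv (deriv (deriv F)) (Nn z) := by
    intro z
    have d : ∀ {H : ℝ → ℝ}, ContDiffOn ℝ (⊤ : ℕ∞) H (Ioi (-ε)) → HasDerivAt H (deriv H (Nn z)) (Nn z) :=
      fun hH => ((hH.contDiffAt (isOpen_Ioi.mem_nhds (Nn_mem hε z))).differentiableAt (by simp)).hasDerivAt
    have := ((d hF1).const_mul 12).add ((((hasDerivAt_id (Nn z))).const_mul 4).mul (d hF2))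
    have h2 : deriv W (Nn z) = _ := this.deriv
    rw [h2]
    simp; ring
  have I1 := h.i1 hR hKΩ hε hF hTR hT
  have I2 := h.i2 hR hKΩ hε hF hTR hT
  have I3 := h.i3 hR hKΩ hε hWc hTR (fun t ht => by simp [hW, hT1 t ht, hT2 t ht])
  have j1 : IntegrableOn (fun z => (posSet Ω u).indicator (fun _ => (1:ℝ)) z *
        (2 * F (Nn z) + 2 * Nn z * deriv F (Nn z))
      + 2 * Nn z * deriv F (Nn z) * (fderiv ℝ u z 1 ^ 2 + fderiv ℝ u z I ^ 2)
      - 4 * deriv F (Nn z) * Du u z ^ 2) (closedBall 0 R) :=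
    (((bχ.mul (((c 2).mul b0).add (((c 2).mul bN).mul b1))).add
      ((((c 2).mul bN).mul b1).mul (bp.sq.add bq.sq))).sub (((c 4).mul b1).mul bD.sq)).int hK
  have j2 : IntegrableOn (fun z => 2 * Nn z * deriv F (Nn z) * (fderiv ℝ u z 1 ^ 2 + fderiv ℝ u z I ^ 2)
      + 4 * (deriv F (Nn z) + Nn z * deriv (deriv F) (Nn z)) * (u z * Du u z)) (closedBall 0 R) :=
    (((((c 2).mul bN).mul b1).mul (bp.sq.add bq.sq)).add
      (((c 4).mul (b1.add (bN.mul b2))).mul (bu.mul bD))).int hK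
  have j3 : IntegrableOn (fun z => u z ^ 2 * (W (Nn z) + Nn z * deriv W (Nn z)) + W (Nn z) * (u z * Du u z))
      (closedBall 0 R) :=
    ((bu.sq.mul ((bm_rad hε hWc hK).add (bN.mul (bm_rad hε (deriv_cd hWc) hK)))).add
      ((bm_rad hε hWc hK).mul (bu.mul bD))).int hK
  have heq : ∀ z, (- 4 * deriv F (Nn z) * (Du u z - u z) ^ 2 +
      (posSet Ω u).indicator (fun _ => (1:ℝ)) z * (2 * F (Nn z) + 2 * Nn z * deriv F (Nn z))
      + u z ^ 2 * (16 * deriv F (Nn z) + 20 * Nn z * deriv (deriv F) (Nn z)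
        + 4 * Nn z ^ 2 * deriv (deriv (deriv F)) (Nn z))) =
      (((posSet Ω u).indicator (fun _ => (1:ℝ)) z *
        (2 * F (Nn z) + 2 * Nn z * deriv F (Nn z))
      + 2 * Nn z * deriv F (Nn z) * (fderiv ℝ u z 1 ^ 2 + fderiv ℝ u z I ^ 2)
      - 4 * deriv F (Nn z) * Du u z ^ 2) -
      (2 * Nn z * deriv F (Nn z) * (fderiv ℝ u z 1 ^ 2 + fderiv ℝ u z I ^ 2)
      + 4 * (deriv F (Nn z) + Nn z * deriv (deriv F) (Nn z)) * (u z * Du u z))) +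
      (u z ^ 2 * (W (Nn z) + Nn z * deriv W (Nn z)) + W (Nn z) * (u z * Du u z)) := by
    intro z
    rw [hWd]; simp only [hW]; ring
  simp only [heq]
  refine ⟨(j1.sub j2).add j3, ?_⟩
  have e1 := integral_add (j1.sub j2) j3
  have e2 := integral_sub j1 j2
  simp only [Pi.sub_apply] at e1 e2
  rw [e1, e2, I1, I2, I3]; simp

end Data

open Complex Metric Set Filter MeasureTheory
open scoped Topology Classical NNReal

lemma bdd_beyond {b : ℝ} {H : ℝ → ℝ} (hb : 0 < b) (hc : ContinuousOn H (Ioi 0))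
    (hz : ∀ s, 2 * b < s → H s = 0) : ∃ M, 0 ≤ M ∧ ∀ s, b ≤ s → |H s| ≤ M := by
  obtain ⟨C, hC⟩ := (isCompact_Icc (a := b) (b := 2*b)).exists_bound_of_continuousOn
    (hc.mono (fun x hx => lt_of_lt_of_le hb hx.1))
  have hC0 : 0 ≤ C := (norm_nonneg _).trans (hC b ⟨le_rfl, by linarith⟩)
  refine ⟨C, hC0, fun s hs => ?_⟩
  rcases le_or_gt s (2*b) with h | h
  · exact hC s ⟨hs, h⟩
  · rw [hz s h]; simpa using hC0

lemma exG {b : ℝ} (hb : 0 < b) : ∃ G : ℝ → ℝ, ContDiffOn ℝ (⊤ : ℕ∞) G (Ioi 0) ∧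
    (∀ s, 2 * b < s → G s = 0) ∧
    (∀ s ∈ Ioo 0 b, G s = s⁻¹ ∧ deriv G s = -(s^2)⁻¹ ∧ deriv (deriv G) s = 2 * (s^3)⁻¹ ∧
      deriv (deriv (deriv G)) s = -6 * (s^4)⁻¹) ∧
    ∃ M, 0 ≤ M ∧ ∀ s, b ≤ s → |G s| ≤ M ∧ |deriv G s| ≤ M ∧ |deriv (deriv G) s| ≤ M ∧
      |deriv (deriv (deriv G)) s| ≤ M := by
  set G : ℝ → ℝ := fun s => Real.smoothTransition (2 - s / b) * s⁻¹ with hG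
  have hGc : ContDiffOn ℝ (⊤ : ℕ∞) G (Ioi 0) := by
    apply ContDiffOn.mul
    · exact (Real.smoothTransition.contDiff.comp
        (contDiff_const.sub (contDiff_id.div_const b))).contDiffOn
    · exact contDiffOn_id.inv (fun x hx => ne_of_gt hx)
  have h1c : ContDiffOn ℝ (⊤ : ℕ∞) (deriv G) (Ioi 0) := hGc.deriv_of_isOpen isOpen_Ioi (by simp)
  have h2c : ContDiffOn ℝ (⊤ : ℕ∞) (deriv (deriv G)) (Ioi 0) := h1c.deriv_of_isOpen isOpen_Ioi (by simp)
  have h3c : ContDiffOn ℝ (⊤ : ℕ∞) (deriv (deriv (deriv G))) (Ioi 0) :=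
    h2c.deriv_of_isOpen isOpen_Ioi (by simp)
  have hv : ∀ s, 2 * b < s → G s = 0 := by
    intro s hs
    have : 2 - s / b ≤ 0 := by
      rw [sub_nonpos, le_div_iff₀ hb]; exact hs.le
    simp [hG, Real.smoothTransition.zero_of_nonpos this]
  have hv1 := deriv_van hv
  have hv2 := deriv_van hv1
  have hv3 := deriv_van hv2
  have e0 : ∀ s ∈ Ioo 0 b, G s = s⁻¹ := by
    intro s hs
    have : 1 ≤ 2 - s / b := by
      have : s / b ≤ 1 := by rw [div_le_one hb]; exact hs.2.le
      linarith
    simp [hG, Real.smoothTransition.one_of_one_le this]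
  have key : ∀ {f g g' : ℝ → ℝ}, (∀ s ∈ Ioo 0 b, f s = g s) →
      (∀ s ∈ Ioo 0 b, HasDerivAt g (g' s) s) → ∀ s ∈ Ioo 0 b, deriv f s = g' s := by
    intro f g g' hfg hg s hs
    have : f =ᶠ[𝓝 s] g := by
      filter_upwards [isOpen_Ioo.mem_nhds hs] with t ht using hfg t ht
    rw [this.deriv_eq]; exact (hg s hs).deriv
  have e1 : ∀ s ∈ Ioo 0 b, deriv G s = -(s^2)⁻¹ :=
    key e0 (fun s hs => hasDerivAt_inv hs.1.ne')
  have e2 : ∀ s ∈ Ioo 0 b, deriv (deriv G) s = 2 * (s^3)⁻¹ := by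
    refine key e1 (fun s hs => ?_)
    have := ((hasDerivAt_pow 2 s).fun_inv (pow_ne_zero 2 hs.1.ne')).neg
    refine HasDerivAt.congr_deriv this ?_
    have := hs.1.ne'
    field_simp
    norm_num
    ring
  have e3 : ∀ s ∈ Ioo 0 b, deriv (deriv (deriv G)) s = -6 * (s^4)⁻¹ := by
    refine key e2 (fun s hs => ?_)
    have := ((hasDerivAt_pow 3 s).fun_inv (pow_ne_zero 3 hs.1.ne')).const_mul 2
    refine HasDerivAt.congr_deriv this ?_
    have := hs.1.ne'
    field_simp
    norm_num
    ring
  obtain ⟨M0, p0, q0⟩ := bdd_beyond hb hGc.continuousOn hv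
  obtain ⟨M1, p1, q1⟩ := bdd_beyond hb h1c.continuousOn hv1
  obtain ⟨M2, p2, q2⟩ := bdd_beyond hb h2c.continuousOn hv2
  obtain ⟨M3, p3, q3⟩ := bdd_beyond hb h3c.continuousOn hv3
  refine ⟨G, hGc, hv, fun s hs => ⟨e0 s hs, e1 s hs, e2 s hs, e3 s hs⟩, M0+M1+M2+M3, by positivity,
    fun s hs => ⟨(q0 s hs).trans (by linarith), (q1 s hs).trans (by linarith),
      (q2 s hs).trans (by linarith), (q3 s hs).trans (by linarith)⟩⟩

lemma int_eps : ∃ I : ℝ, ∀ ε : ℝ, 0 < ε → Integrable (fun z : ℂ => ε / (Nn z + ε) ^ 2) ∧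
    ∫ z : ℂ, ε / (Nn z + ε) ^ 2 = I := by
  have h4 : Integrable (fun z : ℂ => (1 + ‖z‖^2) ^ (-(4:ℝ) / 2)) :=
    integrable_rpow_neg_one_add_norm_sq (by simp [Complex.finrank_real_complex]; norm_num)
  have key : ∀ ε : ℝ, 0 < ε → ∀ z : ℂ, (fun z : ℂ => ε / (Nn z + ε) ^ 2) (√ε • z) =
      ε⁻¹ * (1 + ‖z‖^2) ^ (-(4:ℝ) / 2) := by
    intro ε hε z
    have h1 : Nn (√ε • z) = ε * ‖z‖^2 := by
      rw [Nn_eq, norm_smul, mul_pow, Real.norm_eq_abs, sq_abs, Real.sq_sqrt hε.le]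
    have h2 : (-(4:ℝ) / 2) = -((2:ℕ):ℝ) := by norm_num
    simp only
    rw [h1, h2, Real.rpow_neg (by positivity), Real.rpow_natCast]
    have : (1 + ‖z‖^2) ≠ 0 := by positivity
    have h3 : (ε * ‖z‖ ^ 2 + ε) = ε * (1 + ‖z‖^2) := by ring
    rw [h3]
    field_simp
  refine ⟨∫ z : ℂ, (1 + ‖z‖^2) ^ (-(4:ℝ) / 2), fun ε hε => ⟨?_, ?_⟩⟩
  · rw [← integrable_comp_smul_iff volume _ (Real.sqrt_pos.2 hε).ne']
    exact (h4.const_mul ε⁻¹).congr (Eventually.of_forall fun z => (key ε hε z).symm)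
  · have := Measure.integral_comp_smul (volume : Measure ℂ) (fun z : ℂ => ε / (Nn z + ε) ^ 2) (√ε)
    rw [integral_congr_ae (Eventually.of_forall (key ε hε)), integral_const_mul,
      Complex.finrank_real_complex, Real.sq_sqrt hε.le, abs_of_pos (by positivity), smul_eq_mul] at this
    have hne : ε⁻¹ ≠ 0 := by positivity
    exact (mul_left_cancel₀ hne this).symm

namespace Data
variable {Ω : Set ℂ} {u : ℂ → ℝ} {L : ℝ}

lemma bound_small (s ε t U L Q : ℝ) (hε : 0 < ε) (ht : 0 ≤ t) (hs : s = t + ε) (hU : U ≤ L^2 * t)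
    (hU0 : 0 ≤ U) (χ : ℝ) (hχ : 0 ≤ χ) :
    4 * Q / s^2 - 24 * L^2 * (ε / s^2) ≤ - 4 * (-(s^2)⁻¹) * Q + χ * (2 * s⁻¹ + 2 * t * (-(s^2)⁻¹))
      + U * (16 * (-(s^2)⁻¹) + 20 * t * (2 * (s^3)⁻¹) + 4 * t^2 * (-6 * (s^4)⁻¹)) := by
  have hs0 : 0 < s := by linarith
  have e1 : 2 * s⁻¹ + 2 * t * (-(s^2)⁻¹) = 2 * ε / s^2 := by
    field_simp; rw [hs]; ring
  have e2 : 16 * (-(s^2)⁻¹) + 20 * t * (2 * (s^3)⁻¹) + 4 * t^2 * (-6 * (s^4)⁻¹)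
      = 8 * ε / s^3 - 24 * ε^2/s^4 := by
    have : t = s - ε := by linarith
    field_simp; rw [this]; ring
  rw [e1, e2]
  have e3 : - 4 * (-(s^2)⁻¹) * Q = 4 * Q / s^2 := by field_simp
  rw [e3]
  have h1 : 0 ≤ χ * (2 * ε / s^2) := by positivity
  have h2 : 0 ≤ U * (8 * ε / s^3) := by positivity
  have h3 : U * (24 * ε^2/s^4) ≤ 24 * L^2 * (ε / s^2) := by
    calc U * (24 * ε^2/s^4) ≤ (L^2 * s) * (24 * ε^2/s^4) := by
          apply mul_le_mul_of_nonneg_right _ (by positivity)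
          nlinarith [sq_nonneg L]
      _ = (24 * L^2 * (ε / s^2)) * (ε / s) := by field_simp
      _ ≤ (24 * L^2 * (ε / s^2)) * 1 := by
          apply mul_le_mul_of_nonneg_left _ (by positivity)
          rw [div_le_one hs0]; linarith
      _ = _ := by ring
  linarith [mul_sub U (8 * ε / s^3) (24 * ε^2/s^4)]

lemma bound_large {g0 g1 g2 g3 M t T U U0 Q Q0 χ : ℝ} (h0 : |g0| ≤ M) (h1 : |g1| ≤ M) (h2 : |g2| ≤ M)
    (h3 : |g3| ≤ M) (ht : 0 ≤ t) (htT : t ≤ T) (hU : 0 ≤ U) (hUU : U ≤ U0) (hQ : 0 ≤ Q) (hQQ : Q ≤ Q0)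
    (hχ : 0 ≤ χ) (hχ1 : χ ≤ 1) :
    -(4 * M * Q0 + (2 * M + 2 * T * M) + U0 * (16 * M + 20 * T * M + 4 * T^2 * M)) ≤
      - 4 * g1 * Q + χ * (2 * g0 + 2 * t * g1) + U * (16 * g1 + 20 * t * g2 + 4 * t^2 * g3) := by
  have hM : 0 ≤ M := (abs_nonneg _).trans h0
  have hT : 0 ≤ T := ht.trans htT
  have a1 : |4 * g1 * Q| ≤ 4 * M * Q0 := by
    rw [abs_mul, abs_mul, abs_of_nonneg hQ]; norm_num; gcongr
  have a2 : |χ * (2 * g0 + 2 * t * g1)| ≤ 1 * (2 * M + 2 * T * M) := by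
    rw [abs_mul, abs_of_nonneg hχ]
    apply mul_le_mul hχ1 _ (abs_nonneg _) zero_le_one
    refine (abs_add_le _ _).trans ?_
    rw [abs_mul, abs_mul, abs_mul, abs_of_nonneg ht]; norm_num; gcongr
  have a3 : |U * (16 * g1 + 20 * t * g2 + 4 * t^2 * g3)| ≤ U0 * (16 * M + 20 * T * M + 4 * T^2 * M) := by
    rw [abs_mul, abs_of_nonneg hU]
    apply mul_le_mul hUU _ (abs_nonneg _) (hU.trans hUU)
    refine (abs_add_le _ _).trans (add_le_add ((abs_add_le _ _).trans ?_) ?_)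
    · rw [abs_mul, abs_mul, abs_mul, abs_of_nonneg ht]; norm_num; gcongr
    · rw [abs_mul, abs_mul, abs_of_nonneg (sq_nonneg t)]; norm_num; gcongr
  have b1 := abs_le.1 a1
  have b2 := abs_le.1 a2
  have b3 := abs_le.1 a3
  linarith [b1.1, b1.2, b2.1, b3.1]

lemma weiss_int (h : Data Ω u L) (hu0 : u 0 = 0) {R : ℝ} (hR : 0 < R) (hKΩ : closedBall (0:ℂ) R ⊆ Ω) :
    IntegrableOn (fun z => (Du u z - u z) ^ 2 / Nn z ^ 2) {z | Nn z < R ^ 2 / 4} := by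
  have hK := isCompact_closedBall (0:ℂ) R
  set b := R ^ 2 / 2 with hb
  have hb0 : 0 < b := by positivity
  obtain ⟨G, hGc, hGv, hGs, M, hM, hGM⟩ := exG hb0
  obtain ⟨I0, hI0⟩ := int_eps
  have bQ : BM (closedBall 0 R) (fun z => (Du u z - u z) ^ 2) := ((h.bm_Du hK hKΩ).sub (h.bm_u hK hKΩ)).sq
  obtain ⟨Q0, hQ0⟩ := bQ.bdd
  have hu2 : ∀ z ∈ closedBall (0:ℂ) R, u z ^ 2 ≤ L ^ 2 * Nn z := by
    intro z hz
    have := h.lip z (hKΩ hz) 0 (hKΩ (by simp [hR.le]))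
    rw [hu0, sub_zero, sub_zero] at this
    rw [Nn_eq, ← mul_pow, ← sq_abs]
    gcongr
  have hNR : ∀ z ∈ closedBall (0:ℂ) R, Nn z ≤ R ^ 2 := by
    intro z hz
    rw [Nn_eq]; simp at hz; gcongr
  set M2 := 4 * M * Q0 + (2 * M + 2 * R^2 * M) + (L^2 * R^2) * (16 * M + 20 * R^2 * M + 4 * (R^2)^2 * M) with hM2
  have hQ00 : 0 ≤ Q0 := (abs_nonneg _).trans (hQ0 0 (by simp [hR.le]))
  have hM20 : 0 ≤ M2 := by positivity
  -- main estimate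
  have main : ∀ ε, 0 < ε → ε ≤ R^2/4 →
      ∃ A : ℂ → ℝ, IntegrableOn A (closedBall 0 R) ∧ ∫ z in closedBall (0:ℂ) R, A z ≤
        24 * L^2 * I0 + M2 * volume.real (closedBall (0:ℂ) R) ∧ (∀ z ∈ closedBall (0:ℂ) R, 0 ≤ A z) ∧
        ∀ z ∈ closedBall (0:ℂ) R, ε ≤ Nn z → Nn z < R^2/4 → (Du u z - u z) ^ 2 / Nn z ^ 2 ≤ A z := by
    intro ε hε hεR
    have hF : ContDiffOn ℝ (⊤ : ℕ∞) (fun t => G (t + ε)) (Ioi (-ε)) :=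
      hGc.comp (contDiff_id.add contDiff_const).contDiffOn (fun t ht => by
        simp only [mem_Ioi, id] at *; linarith)
    have d1 : deriv (fun t => G (t + ε)) = fun t => deriv G (t + ε) := by
      ext t; exact deriv_comp_add_const G ε t
    have d2 : deriv (fun t => deriv G (t + ε)) = fun t => deriv (deriv G) (t + ε) := by
      ext t; exact deriv_comp_add_const (deriv G) ε t
    have d3 : deriv (fun t => deriv (deriv G) (t + ε)) = fun t => deriv (deriv (deriv G)) (t + ε) := by
      ext t; exact deriv_comp_add_const (deriv (deriv G)) ε t
    obtain ⟨hi, he⟩ := h.main_id hR.le hKΩ hε hF (T := R^2) le_rfl (fun t ht => hGv _ (by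
      rw [hb]; linarith))
    simp only [d1, d2, d3] at hi he
    set A0 := (fun z => - 4 * deriv G (Nn z + ε) * (Du u z - u z) ^ 2 +
      (posSet Ω u).indicator (fun _ => (1:ℝ)) z * (2 * G (Nn z + ε) + 2 * Nn z * deriv G (Nn z + ε))
      + u z ^ 2 * (16 * deriv G (Nn z + ε) + 20 * Nn z * deriv (deriv G) (Nn z + ε)
        + 4 * Nn z ^ 2 * deriv (deriv (deriv G)) (Nn z + ε))) with hA0
    have hχ0 : ∀ z, 0 ≤ (posSet Ω u).indicator (fun _ => (1:ℝ)) z := fun z =>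
      indicator_nonneg (fun _ _ => zero_le_one) z
    have hχ1 : ∀ z, (posSet Ω u).indicator (fun _ => (1:ℝ)) z ≤ 1 := fun z => by
      by_cases hz : z ∈ posSet Ω u <;> simp [hz]
    have hE : IntegrableOn (fun z => 24 * L^2 * (ε / (Nn z + ε)^2)) (closedBall (0:ℂ) R) :=
      ((hI0 ε hε).1.const_mul _).integrableOn
    have hcst : IntegrableOn (fun _ => M2) (closedBall (0:ℂ) R) := (BM.const M2).int hK
    have c1 : ∀ z ∈ closedBall (0:ℂ) R, Nn z + ε < b →
        4 * (Du u z - u z) ^ 2 / (Nn z + ε)^2 - 24 * L^2 * (ε / (Nn z + ε)^2) ≤ A0 z := by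
      intro z hz hs
      have hN := Nn_nonneg z
      obtain ⟨g0, g1, g2, g3⟩ := hGs (Nn z + ε) ⟨by linarith, hs⟩
      simp only [hA0, g0, g1, g2, g3]
      exact bound_small _ ε (Nn z) (u z ^ 2) L _ hε hN rfl (hu2 z hz) (sq_nonneg _) _ (hχ0 z)
    have c2 : ∀ z ∈ closedBall (0:ℂ) R, b ≤ Nn z + ε → -M2 ≤ A0 z := by
      intro z hz hs
      obtain ⟨g0, g1, g2, g3⟩ := hGM _ hs
      exact bound_large g0 g1 g2 g3 (Nn_nonneg z) (hNR z hz) (sq_nonneg _)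
        ((hu2 z hz).trans (by gcongr; exact hNR z hz)) (sq_nonneg _) ((le_abs_self _).trans (hQ0 z hz))
        (hχ0 z) (hχ1 z)
    refine ⟨fun z => A0 z + 24 * L^2 * (ε / (Nn z + ε)^2) + M2, (hi.add hE).add hcst, ?_, ?_, ?_⟩
    · have hiE : IntegrableOn (fun z => A0 z + 24 * L^2 * (ε / (Nn z + ε)^2)) (closedBall (0:ℂ) R) :=
        hi.add hE
      rw [integral_add hiE hcst, integral_add hi hE, he, integral_const_mul]
      have : ∫ z in closedBall (0:ℂ) R, (ε / (Nn z + ε)^2) ≤ I0 := by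
        rw [← (hI0 ε hε).2]
        exact setIntegral_le_integral (hI0 ε hε).1 (Eventually.of_forall fun z => by
          simp only [Pi.zero_apply]; positivity)
      have h5 : ∫ z in closedBall (0:ℂ) R, M2 = M2 * volume.real (closedBall (0:ℂ) R) := by
        simp [mul_comm]
      rw [h5]
      have : 24 * L^2 * ∫ z in closedBall (0:ℂ) R, (ε / (Nn z + ε)^2) ≤ 24 * L^2 * I0 := by gcongr
      linarith
    · intro z hz
      rcases lt_or_ge (Nn z + ε) b with hs | hs
      · have := c1 z hz hs
        have : 0 ≤ 4 * (Du u z - u z) ^ 2 / (Nn z + ε)^2 := by positivity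
        linarith
      · have := c2 z hz hs
        have : 0 ≤ 24 * L^2 * (ε / (Nn z + ε)^2) := by positivity
        linarith
    · intro z hz hz1 hz2
      have := c1 z hz (by rw [hb]; linarith)
      have h2 : (Du u z - u z) ^ 2 / Nn z ^ 2 ≤ 4 * (Du u z - u z) ^ 2 / (Nn z + ε)^2 := by
        have hN : 0 < Nn z := by linarith
        have : 4 * (Du u z - u z) ^ 2 / (Nn z + ε)^2 = (Du u z - u z) ^ 2 / ((Nn z + ε)/2)^2 := by
          field_simp; ring
        rw [this]
        gcongr
        linarith
      linarith
  -- cover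
  set S := {z : ℂ | Nn z < R ^ 2 / 4} with hS
  have hNc : Continuous Nn := Nn_contDiff.continuous
  have hSm : MeasurableSet S := (isOpen_lt hNc continuous_const).measurableSet
  have hSK : S ⊆ closedBall 0 R := by
    intro z hz
    simp only [hS, mem_ofPred_eq, Nn_eq] at hz
    simp only [mem_closedBall, dist_zero_right]
    nlinarith [norm_nonneg z]
  set φ : ℕ → Set ℂ := fun n => {z | R^2/4/(n+1) ≤ Nn z} with hφ
  have hφm : ∀ n, MeasurableSet (φ n) := fun n => (isClosed_le continuous_const hNc).measurableSet
  have hcov : AECover (volume.restrict S) atTop φ := by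
    refine ⟨?_, hφm⟩
    apply ae_restrict_of_ae
    have : ∀ᵐ z : ℂ, z ≠ 0 := by
      simp [ae_iff]
    filter_upwards [this] with z hz
    have hN : 0 < Nn z := by rw [Nn_eq]; positivity
    have ht : Tendsto (fun n : ℕ => R^2/4/((n:ℝ)+1)) atTop (𝓝 0) :=
      tendsto_const_nhds.div_atTop (tendsto_natCast_atTop_atTop.atTop_add tendsto_const_nhds)
    filter_upwards [ht.eventually (gt_mem_nhds hN)] with n hn using hn.le
  have hmeas : AEStronglyMeasurable (fun z => (Du u z - u z) ^ 2 / Nn z ^ 2) (volume.restrict S) := by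
    have h1 := bQ.meas.mono_measure (Measure.restrict_mono hSK le_rfl)
    exact (h1.aemeasurable.div (hNc.pow 2).measurable.aemeasurable).aestronglyMeasurable
  have hest : ∀ n, IntegrableOn (fun z => (Du u z - u z) ^ 2 / Nn z ^ 2) (φ n) (volume.restrict S) ∧
      ∫ z in φ n, ‖(Du u z - u z) ^ 2 / Nn z ^ 2‖ ∂(volume.restrict S) ≤
        24 * L^2 * I0 + M2 * volume.real (closedBall (0:ℂ) R) := by
    intro n
    obtain ⟨A, hA, hA1, hA2, hA3⟩ := main (R^2/4/(n+1)) (by positivity)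
      (div_le_self (by positivity) (by linarith [Nat.cast_nonneg (α := ℝ) n]))
    have hr : (volume.restrict S).restrict (φ n) = volume.restrict (φ n ∩ S) :=
      Measure.restrict_restrict (hφm n)
    have hm : MeasurableSet (φ n ∩ S) := (hφm n).inter hSm
    have hsub : φ n ∩ S ⊆ closedBall 0 R := inter_subset_right.trans hSK
    have hb : ∀ᵐ z ∂(volume.restrict (φ n ∩ S)), ‖(Du u z - u z) ^ 2 / Nn z ^ 2‖ ≤ A z := by
      filter_upwards [ae_restrict_mem hm] with z hz
      rw [Real.norm_of_nonneg (by positivity)]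
      exact hA3 z (hsub hz) hz.1 hz.2
    have hi : Integrable (fun z => (Du u z - u z) ^ 2 / Nn z ^ 2) (volume.restrict (φ n ∩ S)) :=
      Integrable.mono' (hA.mono_set hsub) (hmeas.mono_measure (by
        exact Measure.restrict_mono inter_subset_right le_rfl)) hb
    refine ⟨by rw [IntegrableOn, hr]; exact hi, ?_⟩
    rw [hr]
    calc _ ≤ ∫ z in φ n ∩ S, A z := integral_mono_ae hi.norm (hA.mono_set hsub) hb
      _ ≤ ∫ z in closedBall 0 R, A z := setIntegral_mono_set hA (by
          filter_upwards [ae_restrict_mem hK.measurableSet] with z hz using hA2 z hz)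
          (Eventually.of_forall hsub)
      _ ≤ _ := hA1
  exact hcov.integrable_of_integral_norm_bounded _ (fun n => (hest n).1)
    (Eventually.of_forall fun n => (hest n).2)

end Data

open Complex Metric Set Filter MeasureTheory
open scoped Topology Classical NNReal

/-- conjugate gradient -/
noncomputable def cg (w : ℂ → ℝ) (z : ℂ) : ℂ :=
  ((fderiv ℝ w z 1 : ℝ) : ℂ) - ((fderiv ℝ w z I : ℝ) : ℂ) * I

lemma cg_re (w : ℂ → ℝ) (z : ℂ) : (cg w z).re = fderiv ℝ w z 1 := by simp [cg]
lemma cg_im (w : ℂ → ℝ) (z : ℂ) : (cg w z).im = - fderiv ℝ w z I := by simp [cg]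

/-- real-linear functional `e ↦ Re (c e)` -/
noncomputable def TT : ℂ →L[ℝ] (ℂ →L[ℝ] ℝ) :=
  (ContinuousLinearMap.compL ℝ ℂ ℂ ℝ reCLM).comp (ContinuousLinearMap.mul ℝ ℂ)

lemma TT_apply (c e : ℂ) : TT c e = (c * e).re := by simp [TT]

lemma cg_of_hasFDerivAt {w : ℂ → ℝ} {z c : ℂ} (h : HasFDerivAt w (TT c) z) : cg w z = c := by
  apply Complex.ext
  · rw [cg_re, h.fderiv, TT_apply]; simp
  · rw [cg_im, h.fderiv, TT_apply]; simp

/-- `w` is the real part of a holomorphic function on the ball -/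
def LH (w : ℂ → ℝ) (z : ℂ) (ρ : ℝ) : Prop :=
  ∃ F : ℂ → ℂ, DifferentiableOn ℂ F (ball z ρ) ∧ ∀ x ∈ ball z ρ, w x = (F x).re

lemma re_hasFDerivAt {F : ℂ → ℂ} {F' x : ℂ} (h : HasDerivAt F F' x) :
    HasFDerivAt (fun y => (F y).re) (TT F') x := by
  have h1 : HasFDerivAt F _ x := h.hasFDerivAt.restrictScalars ℝ
  have h2 := reCLM.hasFDerivAt.comp x h1
  refine HasFDerivAt.congr_fderiv (f := fun y => (F y).re) h2 ?_
  ext e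
  · simp [TT_apply, mul_comm]
  
lemma LH.hasFDerivAt {w : ℂ → ℝ} {z : ℂ} {ρ : ℝ} {F : ℂ → ℂ} (hF : DifferentiableOn ℂ F (ball z ρ))
    (hw : ∀ x ∈ ball z ρ, w x = (F x).re) {x : ℂ} (hx : x ∈ ball z ρ) :
    HasFDerivAt w (TT (deriv F x)) x := by
  have hd := (hF.differentiableAt (isOpen_ball.mem_nhds hx)).hasDerivAt
  refine (re_hasFDerivAt hd).congr_of_eventuallyEq ?_
  filter_upwards [isOpen_ball.mem_nhds hx] with y hy using hw y hy

lemma LH.cg_eq {w : ℂ → ℝ} {z : ℂ} {ρ : ℝ} (h : LH w z ρ) {x : ℂ} (hx : x ∈ ball z ρ) :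
    HasFDerivAt w (TT (cg w x)) x := by
  obtain ⟨F, hF, hw⟩ := h
  have := LH.hasFDerivAt hF hw hx
  rwa [cg_of_hasFDerivAt this]

lemma LH.cg_holo {w : ℂ → ℝ} {z : ℂ} {ρ : ℝ} (h : LH w z ρ) : DifferentiableOn ℂ (cg w) (ball z ρ) := by
  obtain ⟨F, hF, hw⟩ := h
  refine (hF.deriv isOpen_ball).congr (fun x hx => ?_)
  exact cg_of_hasFDerivAt (LH.hasFDerivAt hF hw hx)

lemma LH.sub {w1 w2 : ℂ → ℝ} {z : ℂ} {ρ : ℝ} (h1 : LH w1 z ρ) (h2 : LH w2 z ρ) :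
    LH (fun x => w1 x - w2 x) z ρ := by
  obtain ⟨F, hF, hw⟩ := h1
  obtain ⟨G, hG, hw'⟩ := h2
  exact ⟨fun x => F x - G x, hF.sub hG, fun x hx => by simp [hw x hx, hw' x hx]⟩

lemma LH.mono {w : ℂ → ℝ} {z z' : ℂ} {ρ ρ' : ℝ} (h : LH w z ρ) (hs : ball z' ρ' ⊆ ball z ρ) :
    LH w z' ρ' := by
  obtain ⟨F, hF, hw⟩ := h
  exact ⟨F, hF.mono hs, fun x hx => hw x (hs hx)⟩

lemma LH.grad_le {w : ℂ → ℝ} {z : ℂ} {ρ M : ℝ} (h : LH w z ρ) (hρ : 0 < ρ) (hM : 0 < M)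
    (hb : ∀ x ∈ ball z ρ, |w x| ≤ M) : ‖cg w z‖ ≤ 2 * Real.exp 2 * M / ρ := by
  obtain ⟨F, hF, hw⟩ := h
  have hz : z ∈ ball z ρ := mem_ball_self hρ
  rw [cg_of_hasFDerivAt (LH.hasFDerivAt hF hw hz)]
  set E : ℂ → ℂ := fun x => Complex.exp (F x / M) with hE
  have hEd : DifferentiableOn ℂ E (ball z ρ) := (hF.div_const _).cexp
  have hn : ∀ x ∈ ball z ρ, ‖E x‖ = Real.exp (w x / M) := by
    intro x hx
    simp only [hE, Complex.norm_exp, hw x hx]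
    congr 1
    rw [Complex.div_ofReal_re]
  have hsub : closedBall z (ρ/2) ⊆ ball z ρ := closedBall_subset_ball (by linarith)
  have h1 : ‖deriv E z‖ ≤ Real.exp 1 / (ρ/2) := by
    apply Complex.norm_deriv_le_of_forall_mem_sphere_norm_le (by positivity)
    · exact DifferentiableOn.diffContOnCl (hEd.mono (closure_ball_subset_closedBall.trans hsub))
    · intro x hx
      have hx' := hsub (sphere_subset_closedBall hx)
      rw [hn x hx']
      apply Real.exp_le_exp.2
      rw [div_le_one hM]
      exact (le_abs_self _).trans (hb x hx')
  have hd : HasDerivAt E (Complex.exp (F z / M) * (deriv F z / M)) z :=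
    ((hF.differentiableAt (isOpen_ball.mem_nhds hz)).hasDerivAt.div_const _).cexp
  have h3 : ‖Complex.exp (F z / M)‖ = Real.exp (w z / M) := hn z hz
  rw [hd.deriv, norm_mul, h3, norm_div, Complex.norm_real, Real.norm_of_nonneg hM.le] at h1
  have h2 : Real.exp (-1) ≤ Real.exp (w z / M) := by
    apply Real.exp_le_exp.2
    rw [le_div_iff₀ hM]
    linarith [neg_le_of_abs_le (hb z hz)]
  have h4 : Real.exp (-1) * (‖deriv F z‖ / M) ≤ Real.exp 1 / (ρ/2) :=
    (mul_le_mul_of_nonneg_right h2 (by positivity)).trans h1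
  have h5 : ‖deriv F z‖ / M ≤ Real.exp 1 * (Real.exp 1 / (ρ/2)) := by
    calc ‖deriv F z‖ / M = Real.exp 1 * (Real.exp (-1) * (‖deriv F z‖ / M)) := by
          rw [← mul_assoc, ← Real.exp_add]; simp
      _ ≤ _ := by gcongr
  rw [div_le_iff₀ hM] at h5
  refine h5.trans (le_of_eq ?_)
  have : Real.exp 2 = Real.exp 1 * Real.exp 1 := by rw [← Real.exp_add]; norm_num
  rw [this]
  field_simp

/-- blow-up data -/
structure Blow (Ω : Set ℂ) (u : ℂ → ℝ) (L c : ℝ) (r : ℕ → ℝ) (v : ℂ → ℝ) : Prop where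
  dat : Data Ω u L
  c0 : 0 < c
  nd : Nondegenerate Ω u c
  h0 : (0:ℂ) ∈ FB Ω u
  rpos : ∀ j, 0 < r j
  rto : Tendsto r atTop (𝓝 0)
  conv : TendstoLocallyUniformly (fun j z => (r j)⁻¹ * u (((r j : ℝ) : ℂ) * z)) v atTop

/-- rescaling -/
noncomputable def UU (r : ℕ → ℝ) (u : ℂ → ℝ) (j : ℕ) (z : ℂ) : ℝ := (r j)⁻¹ * u (((r j : ℝ) : ℂ) * z)

namespace Data
variable {Ω : Set ℂ} {u : ℂ → ℝ} {L : ℝ}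
lemma LHu (h : Data Ω u L) {z : ℂ} {ρ : ℝ} (hs : ball z ρ ⊆ posSet Ω u) : LH u z ρ := by
  obtain ⟨F, hF, hw⟩ := InnerProductSpace.HarmonicOnNhd.exists_analyticOnNhd_ball_re_eq
    (f := u) (z := z) (R := ρ) (fun x hx => h.harm x (hs hx))
  exact ⟨F, hF.differentiableOn, fun x hx => (hw hx).symm⟩
end Data

lemma cg_scale (u : ℂ → ℝ) {a : ℝ} (ha : 0 < a) (z : ℂ) :
    cg (fun z => a⁻¹ * u ((a:ℂ) * z)) z = cg u (a * z) := by
  have : fderiv ℝ (fun z => a⁻¹ * u ((a:ℂ) * z)) z = fderiv ℝ u (a * z) := by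
    have h1 : (fun z : ℂ => a⁻¹ * u ((a:ℂ) * z)) = a⁻¹ • (fun z : ℂ => u (a • z)) := by
      ext z; simp
    rw [h1, fderiv_const_smul_field, Pi.smul_apply, fderiv_comp_smul, smul_smul, inv_mul_cancel₀ ha.ne', one_smul]
    simp
  rw [cg, cg, this]

namespace Blow
variable {Ω : Set ℂ} {u : ℂ → ℝ} {L c : ℝ} {r : ℕ → ℝ} {v : ℂ → ℝ}

lemma cgU (h : Blow Ω u L c r v) (j : ℕ) (z : ℂ) : cg (UU r u j) z = cg u (r j * z) :=
  cg_scale u (h.rpos j) z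

lemma u0 (h : Blow Ω u L c r v) : u 0 = 0 := by
  apply h.dat.zero h.h0.1
  intro hm
  have := h.h0.2
  rw [h.dat.Uop.frontier_eq] at this
  exact this.2 hm

lemma evΩ (h : Blow Ω u L c r v) (R : ℝ) : ∀ᶠ j in atTop, ∀ z ∈ closedBall (0:ℂ) R, (r j : ℂ) * z ∈ Ω := by
  obtain ⟨δ, hδ, hs⟩ := Metric.isOpen_iff.1 h.dat.op 0 h.h0.1
  have h1 : Tendsto (fun j => r j * (|R| + 1)) atTop (𝓝 0) := by simpa using h.rto.mul_const (|R|+1)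
  filter_upwards [h1.eventually (gt_mem_nhds hδ)] with j hj z hz
  apply hs
  simp only [mem_ball, dist_zero_right, mem_closedBall, norm_mul, Complex.norm_real] at *
  rw [Real.norm_of_nonneg (h.rpos j).le]
  refine lt_of_le_of_lt ?_ hj
  have := (h.rpos j).le
  gcongr
  linarith [le_abs_self R]

lemma unif (h : Blow Ω u L c r v) {K : Set ℂ} (hK : IsCompact K) : TendstoUniformlyOn (UU r u) v atTop K :=
  (tendstoLocallyUniformly_iff_forall_isCompact.1 h.conv) K hK

lemma ptw (h : Blow Ω u L c r v) (z : ℂ) : Tendsto (fun j => UU r u j z) atTop (𝓝 (v z)) :=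
  (h.unif isCompact_singleton).tendsto_at (mem_singleton z)

lemma Unn (h : Blow Ω u L c r v) {j : ℕ} {z : ℂ} (hz : (r j : ℂ) * z ∈ Ω) : 0 ≤ UU r u j z := by
  have := h.dat.nn _ hz
  have := h.rpos j
  unfold UU; positivity

lemma Upos (h : Blow Ω u L c r v) {j : ℕ} {z : ℂ} (hz : (r j : ℂ) * z ∈ Ω) :
    0 < UU r u j z ↔ (r j : ℂ) * z ∈ posSet Ω u := by
  have := h.rpos j
  unfold UU
  rw [mul_pos_iff_of_pos_left (by positivity)]
  simp [posSet, hz]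

lemma Ulip (h : Blow Ω u L c r v) {j : ℕ} {z w : ℂ} (hz : (r j : ℂ) * z ∈ Ω) (hw : (r j : ℂ) * w ∈ Ω) :
    |UU r u j z - UU r u j w| ≤ L * ‖z - w‖ := by
  have h1 := h.dat.lip _ hz _ hw
  have hr := h.rpos j
  unfold UU
  rw [← mul_sub, abs_mul, abs_of_pos (by positivity), inv_mul_le_iff₀ hr]
  refine h1.trans (le_of_eq ?_)
  rw [← mul_sub, norm_mul, Complex.norm_real, Real.norm_of_nonneg hr.le]; ring

lemma vnn (h : Blow Ω u L c r v) (z : ℂ) : 0 ≤ v z := by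
  refine ge_of_tendsto (h.ptw z) ?_
  filter_upwards [h.evΩ ‖z‖] with j hj
  exact h.Unn (hj z (by simp))

lemma vlip (h : Blow Ω u L c r v) (z w : ℂ) : |v z - v w| ≤ L * ‖z - w‖ := by
  refine le_of_tendsto ((h.ptw z).sub (h.ptw w)).abs ?_
  filter_upwards [h.evΩ (‖z‖ + ‖w‖)] with j hj
  exact h.Ulip (hj z (by simp)) (hj w (by simp))

lemma vcont (h : Blow Ω u L c r v) : Continuous v := by
  have : LipschitzWith ⟨L, h.dat.L0⟩ v := LipschitzWith.of_dist_le_mul (fun z w => by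
    rw [Real.dist_eq, dist_eq_norm]; exact h.vlip z w)
  exact this.continuous

lemma v0 (h : Blow Ω u L c r v) : v 0 = 0 := by
  refine tendsto_nhds_unique (h.ptw 0) ?_
  simp [UU, h.u0]

lemma LHU (h : Blow Ω u L c r v) {j : ℕ} {z : ℂ} {ρ : ℝ} (hs : ∀ x ∈ ball z ρ, (r j : ℂ) * x ∈ posSet Ω u) :
    LH (UU r u j) z ρ := by
  have hr := h.rpos j
  have hrn : ‖(r j : ℂ)‖ = r j := by rw [Complex.norm_real, Real.norm_of_nonneg hr.le]
  have hrc : (r j : ℂ) ≠ 0 := by exact_mod_cast hr.ne'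
  have hsub : ball ((r j : ℂ) * z) (r j * ρ) ⊆ posSet Ω u := by
    intro y hy
    have : y = (r j : ℂ) * ((r j : ℂ)⁻¹ * y) := by field_simp
    rw [this]
    apply hs
    rw [mem_ball, dist_eq_norm] at *
    have h2 : (r j : ℂ)⁻¹ * y - z = (r j : ℂ)⁻¹ * (y - (r j : ℂ) * z) := by field_simp
    rw [h2, norm_mul, norm_inv, hrn, inv_mul_lt_iff₀ hr]
    exact hy
  obtain ⟨F, hF, hw⟩ := h.dat.LHu hsub
  have hmaps : ∀ x ∈ ball z ρ, (r j : ℂ) * x ∈ ball ((r j : ℂ) * z) (r j * ρ) := by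
    intro x hx
    rw [mem_ball, dist_eq_norm] at *
    rw [← mul_sub, norm_mul, hrn]
    exact mul_lt_mul_of_pos_left hx hr
  refine ⟨fun x => (r j : ℂ)⁻¹ * F ((r j : ℂ) * x), ?_, ?_⟩
  · exact (hF.comp (differentiableOn_id.const_mul _) hmaps).const_mul _
  · intro x hx
    rw [← Complex.ofReal_inv, Complex.re_ofReal_mul, ← hw _ (hmaps x hx)]
    rfl

lemma evpos (h : Blow Ω u L c r v) {K : Set ℂ} (hK : IsCompact K) (hv : ∀ z ∈ K, 0 < v z) :
    ∀ᶠ j in atTop, ∀ z ∈ K, (r j : ℂ) * z ∈ posSet Ω u := by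
  rcases K.eq_empty_or_nonempty with rfl | hne
  · simp
  obtain ⟨z0, hz0, hmin⟩ := hK.exists_isMinOn hne h.vcont.continuousOn
  obtain ⟨R, hR⟩ := hK.isBounded.subset_closedBall 0
  have hm := hv z0 hz0
  filter_upwards [h.evΩ R, Metric.tendstoUniformlyOn_iff.1 (h.unif hK) (v z0) hm] with j h1 h2 z hz
  rw [← h.Upos (h1 z (hR hz))]
  have h3 := h2 z hz
  have h4 : v z0 ≤ v z := hmin hz
  rw [Real.dist_eq] at h3
  linarith [(abs_lt.1 h3).2]

lemma gradconv (h : Blow Ω u L c r v) {z0 : ℂ} (hz0 : 0 < v z0) : ∃ ρ, 0 < ρ ∧ (∀ x ∈ ball z0 ρ, 0 < v x) ∧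
    TendstoUniformlyOn (fun j z => cg u (r j * z)) (cg v) atTop (ball z0 ρ) ∧
    DifferentiableOn ℂ (cg v) (ball z0 ρ) ∧ ∀ x ∈ ball z0 ρ, HasFDerivAt v (TT (cg v x)) x := by
  obtain ⟨δ, hδ, hs⟩ := Metric.isOpen_iff.1 (isOpen_lt continuous_const h.vcont) z0 hz0
  set ρ := δ / 4 with hρd
  have hρ : 0 < ρ := by positivity
  have hK := isCompact_closedBall z0 (2*ρ)
  have hKv : ∀ z ∈ closedBall z0 (2*ρ), 0 < v z := fun z hz => by
    apply hs; simp only [mem_closedBall, mem_ball] at *; linarith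
  obtain ⟨J, hJ⟩ := eventually_atTop.1 (h.evpos hK hKv)
  have hsubball : ∀ x ∈ ball z0 ρ, ball x ρ ⊆ closedBall z0 (2*ρ) := by
    intro x hx y hy
    simp only [mem_ball, mem_closedBall] at *
    linarith [dist_triangle y x z0]
  have hLH : ∀ j ≥ J, LH (UU r u j) z0 (2*ρ) := fun j hj =>
    h.LHU (fun x hx => hJ j hj x (ball_subset_closedBall hx))
  have hLHx : ∀ j ≥ J, ∀ x ∈ ball z0 ρ, LH (UU r u j) x ρ := fun j hj x hx =>
    h.LHU (fun y hy => hJ j hj y (hsubball x hx hy))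
  have hUC : UniformCauchySeqOn (fun j z => cg u (r j * z)) atTop (ball z0 ρ) := by
    rw [Metric.uniformCauchySeqOn_iff]
    intro ε hε
    set C := 2 * Real.exp 2 / ρ with hC
    have hC0 : 0 < C := by positivity
    obtain ⟨N, hN⟩ := Metric.uniformCauchySeqOn_iff.1 (h.unif hK).uniformCauchySeqOn (ε / (2 * C)) (by positivity)
    refine ⟨max N J, fun m hm n hn x hx => ?_⟩
    have h1 := hLHx m (le_trans (le_max_right _ _) hm) x hx
    have h2 := hLHx n (le_trans (le_max_right _ _) hn) x hx
    have h3 := (h1.sub h2).grad_le hρ (M := ε / (2 * C)) (by positivity) (fun y hy => by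
      have := hN m (le_trans (le_max_left _ _) hm) n (le_trans (le_max_left _ _) hn) y (hsubball x hx hy)
      rw [Real.dist_eq] at this
      exact this.le)
    have h4 : cg (fun x => UU r u m x - UU r u n x) x = cg (UU r u m) x - cg (UU r u n) x := by
      apply cg_of_hasFDerivAt
      rw [map_sub]
      exact (h1.cg_eq (mem_ball_self hρ)).sub (h2.cg_eq (mem_ball_self hρ))
    rw [h4, h.cgU, h.cgU] at h3
    rw [dist_eq_norm]
    refine lt_of_le_of_lt h3 ?_
    have : 2 * Real.exp 2 * (ε / (2 * C)) / ρ = ε / 2 := by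
      rw [hC]; field_simp
    rw [this]; linarith
  have hlim : ∀ x ∈ ball z0 ρ, ∃ y, Tendsto (fun j => cg u (r j * x)) atTop (𝓝 y) := fun x hx =>
    cauchySeq_tendsto_of_complete (hUC.cauchySeq hx)
  choose! g hg using hlim
  have hTU : TendstoUniformlyOn (fun j z => cg u (r j * z)) g atTop (ball z0 ρ) :=
    hUC.tendstoUniformlyOn_of_tendsto hg
  have hgd : DifferentiableOn ℂ g (ball z0 ρ) := by
    refine hTU.tendstoLocallyUniformlyOn.differentiableOn ?_ isOpen_ball
    filter_upwards [eventually_ge_atTop J] with j hj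
    have := ((hLH j hj).mono (ball_subset_ball (by linarith : ρ ≤ 2*ρ))).cg_holo
    exact this.congr (fun x _ => (h.cgU j x).symm)
  have hfd : ∀ x ∈ ball z0 ρ, HasFDerivAt v (TT (g x)) x := by
    intro x hx
    refine hasFDerivAt_of_tendstoUniformlyOn (l := atTop) (f := fun n => UU r u (n + J))
      (f' := fun n x => TT (cg u (r (n+J) * x))) (g' := fun x => TT (g x)) isOpen_ball ?_ ?_ ?_ hx
    · have := TT.uniformContinuous.comp_tendstoUniformlyOn hTU
      exact fun w hw => (tendsto_add_atTop_nat J).eventually (this w hw)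
    · intro n y hy
      rw [← h.cgU]
      exact (hLHx (n+J) (by omega) y hy).cg_eq (mem_ball_self hρ)
    · intro y _
      exact (h.ptw y).comp (tendsto_add_atTop_nat J)
  have hcg : ∀ x ∈ ball z0 ρ, cg v x = g x := fun x hx => cg_of_hasFDerivAt (hfd x hx)
  refine ⟨ρ, hρ, fun x hx => hKv x ?_, hTU.congr_right (fun x hx => (hcg x hx).symm),
    hgd.congr hcg, fun x hx => by rw [hcg x hx]; exact hfd x hx⟩
  simp only [mem_ball, mem_closedBall] at *; linarith

end Blow

open Complex Metric Set Filter MeasureTheory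
open scoped Topology Classical NNReal

lemma Du_eq (u : ℂ → ℝ) (z : ℂ) : Data.Du u z = (z * cg u z).re := by
  simp [Data.Du, cg_re, cg_im]

namespace Blow
variable {Ω : Set ℂ} {u : ℂ → ℝ} {L c : ℝ} {r : ℕ → ℝ} {v : ℂ → ℝ}

lemma hom (h : Blow Ω u L c r v) {z0 : ℂ} (hz0 : 0 < v z0) : (z0 * cg v z0).re = v z0 := by
  obtain ⟨R, hR, hs⟩ := Metric.isOpen_iff.1 h.dat.op 0 h.h0.1
  have hsc : closedBall (0:ℂ) (R/2) ⊆ Ω := (closedBall_subset_ball (by linarith)).trans hs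
  have hint := h.dat.weiss_int h.u0 (R := R/2) (by positivity) hsc
  set S := {z : ℂ | Nn z < (R/2)^2/4} with hS
  obtain ⟨ρ, hρ, hpos, hconv, hdiff, -⟩ := h.gradconv hz0
  by_contra hne
  set w : ℂ → ℝ := fun x => (x * cg v x).re - v x with hw
  have hwc : ContinuousAt w z0 := by
    have h1 : ContinuousAt (cg v) z0 := (hdiff.differentiableAt (ball_mem_nhds z0 hρ)).continuousAt
    exact (Complex.continuous_re.continuousAt.comp (continuousAt_id.mul h1)).sub h.vcont.continuousAt
  have hw0 : 0 < |w z0| := abs_pos.2 (sub_ne_zero.2 hne)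
  set η := |w z0| / 4 with hη
  have hη0 : 0 < η := by positivity
  obtain ⟨ρ1, hρ1, hb1⟩ := Metric.continuousAt_iff.1 hwc η hη0
  set ρ' := min ρ ρ1 with hρ'd
  have hρ' : 0 < ρ' := lt_min hρ hρ1
  have hwb : ∀ x ∈ ball z0 ρ', 2 * η ≤ |w x| := by
    intro x hx
    have h1 := hb1 (x := x) (lt_of_lt_of_le hx (min_le_right _ _))
    rw [Real.dist_eq] at h1
    have h2 : |w z0| ≤ |w x| + |w x - w z0| := by
      calc |w z0| = |w x - (w x - w z0)| := by congr 1; ring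
        _ ≤ _ := abs_sub _ _
    linarith
  set B := ‖z0‖ + ρ' with hB
  have hB0 : 0 < B := by positivity
  have hxB : ∀ x ∈ ball z0 ρ', ‖x‖ ≤ B := by
    intro x hx
    rw [mem_ball, dist_eq_norm] at hx
    have : ‖x‖ ≤ ‖z0‖ + ‖x - z0‖ := by
      calc ‖x‖ = ‖z0 + (x - z0)‖ := by congr 1; ring
        _ ≤ _ := norm_add_le _ _
    linarith
  have hev : ∀ᶠ j in atTop, ∀ x ∈ ball z0 ρ', η ≤ |(x * cg u (r j * x)).re - UU r u j x| := by
    filter_upwards [Metric.tendstoUniformlyOn_iff.1 hconv (η/(2*B)) (by positivity),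
      Metric.tendstoUniformlyOn_iff.1 (h.unif (isCompact_closedBall z0 ρ')) (η/2) (by positivity)] with j h1 h2 x hx
    have h3 := h1 x (ball_subset_ball (min_le_left _ _) hx)
    have h4 := h2 x (ball_subset_closedBall hx)
    rw [dist_eq_norm] at h3 h4
    have h5 : |(x * (cg v x - cg u (r j * x))).re| ≤ η / 2 := by
      refine (Complex.abs_re_le_norm _).trans ?_
      rw [norm_mul]
      calc _ ≤ B * (η/(2*B)) := by gcongr; exact hxB x hx
        _ = η/2 := by field_simp
    have h6 : w x = ((x * cg u (r j * x)).re - UU r u j x) + (x * (cg v x - cg u (r j * x))).re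
      - (v x - UU r u j x) := by
      simp only [hw, mul_sub, Complex.sub_re]; ring
    have h7 := hwb x hx
    have h8 : |w x| ≤ |(x * cg u (r j * x)).re - UU r u j x| + |(x * (cg v x - cg u (r j * x))).re|
      + |v x - UU r u j x| := by
      rw [h6]
      exact (abs_sub _ _).trans (by gcongr; exact abs_add_le _ _)
    rw [Real.norm_eq_abs] at h4
    linarith
  set D : ℕ → Set ℂ := fun j => ball ((r j : ℂ) * z0) (r j * ρ') with hD
  have hvolD : ∀ j, volume (D j) = ENNReal.ofReal (r j * ρ') ^ 2 * NNReal.pi := fun j => Complex.volume_ball _ _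
  have htend : Tendsto (fun j => ∫ z in D j, (Data.Du u z - u z) ^ 2 / Nn z ^ 2 ∂(volume.restrict S)) atTop (𝓝 0) := by
    apply Integrable.tendsto_setIntegral_nhds_zero hint
    have h1 : Tendsto (fun j => volume (D j)) atTop (𝓝 0) := by
      simp only [hvolD]
      have h2 : Tendsto (fun j => ENNReal.ofReal (r j * ρ')) atTop (𝓝 0) := by
        have := ENNReal.tendsto_ofReal (h.rto.mul_const ρ')
        simpa using this
      have h3 := ENNReal.Tendsto.mul_const (b := (NNReal.pi : ENNReal)) (ENNReal.Tendsto.pow (n := 2) h2) (Or.inr ENNReal.coe_ne_top)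
      simpa using h3
    exact tendsto_of_tendsto_of_tendsto_of_le_of_le tendsto_const_nhds h1 (fun _ => zero_le) (fun j => Measure.restrict_apply_le _ _)
  have hDS : ∀ᶠ j in atTop, D j ⊆ S := by
    have h1 : Tendsto (fun j => r j * B) atTop (𝓝 0) := by simpa using h.rto.mul_const B
    filter_upwards [h1.eventually (gt_mem_nhds (show 0 < R/4 by positivity))] with j hj y hy
    have hr := h.rpos j
    rw [hD, mem_ball, dist_eq_norm] at hy
    have : ‖y‖ ≤ r j * B := by
      calc ‖y‖ = ‖(r j : ℂ) * z0 + (y - (r j : ℂ) * z0)‖ := by congr 1; ring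
        _ ≤ ‖(r j : ℂ) * z0‖ + ‖y - (r j : ℂ) * z0‖ := norm_add_le _ _
        _ ≤ r j * ‖z0‖ + r j * ρ' := by
            gcongr; rw [norm_mul, Complex.norm_real, Real.norm_of_nonneg hr.le]
        _ = _ := by rw [hB]; ring
    simp only [hS, mem_ofPred_eq, Nn_eq]
    nlinarith [norm_nonneg y]
  have hlow : ∀ᶠ j in atTop, η^2 / B^4 * Real.pi * ρ'^2 ≤
      ∫ z in D j, (Data.Du u z - u z) ^ 2 / Nn z ^ 2 ∂(volume.restrict S) := by
    filter_upwards [hev, hDS] with j hj hjS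
    have hr := h.rpos j
    have hrc : (r j : ℂ) ≠ 0 := by exact_mod_cast hr.ne'
    rw [Measure.restrict_restrict measurableSet_ball, inter_eq_left.2 hjS]
    have hpt : ∀ y ∈ D j, η^2 / B^4 * (r j ^ 2)⁻¹ ≤ (Data.Du u y - u y) ^ 2 / Nn y ^ 2 := by
      intro y hy
      set x := (r j : ℂ)⁻¹ * y with hx
      have hyx : y = (r j : ℂ) * x := by rw [hx]; field_simp
      have hxm : x ∈ ball z0 ρ' := by
        rw [hD, mem_ball, dist_eq_norm, hyx, ← mul_sub, norm_mul, Complex.norm_real,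
          Real.norm_of_nonneg hr.le] at hy
        rw [mem_ball, dist_eq_norm]
        exact lt_of_mul_lt_mul_left hy hr.le
      have hx0 : x ≠ 0 := by
        intro h0
        have := hpos x (ball_subset_ball (min_le_left _ _) hxm)
        rw [h0, h.v0] at this
        exact lt_irrefl _ this
      have h1 := hj x hxm
      have h2 : Data.Du u y - u y = r j * ((x * cg u (r j * x)).re - UU r u j x) := by
        rw [Du_eq, hyx, mul_assoc, Complex.re_ofReal_mul, UU]
        field_simp
      have h3 : Nn y = r j ^ 2 * ‖x‖^2 := by
        rw [Nn_eq, hyx, norm_mul, Complex.norm_real, Real.norm_of_nonneg hr.le]; ring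
      rw [h2, h3]
      have hxn : 0 < ‖x‖ := norm_pos_iff.2 hx0
      have h4 : (r j * ((x * cg u (r j * x)).re - UU r u j x)) ^ 2 / (r j ^ 2 * ‖x‖^2)^2
        = ((x * cg u (r j * x)).re - UU r u j x) ^ 2 / ‖x‖^4 * (r j ^ 2)⁻¹ := by
        field_simp
      rw [h4, ← sq_abs ((x * cg u (r j * x)).re - UU r u j x)]
      gcongr
      exact hxB x hxm
    have h5 := setIntegral_ge_of_const_le_real measurableSet_ball measure_ball_lt_top.ne
      hpt (hint.mono_set hjS)
    refine le_trans (le_of_eq ?_) h5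
    rw [Measure.real, hvolD, ENNReal.toReal_mul, ENNReal.toReal_pow, ENNReal.toReal_ofReal (by positivity)]
    simp only [ENNReal.coe_toReal, NNReal.coe_real_pi]
    field_simp
  have := ge_of_tendsto htend hlow
  have h9 : 0 < η^2 / B^4 * Real.pi * ρ'^2 := by positivity
  linarith

lemma cgloc (h : Blow Ω u L c r v) {z0 : ℂ} (hz0 : 0 < v z0) : ∃ ρ, 0 < ρ ∧
    ∀ x ∈ ball z0 ρ, 0 < v x ∧ cg v x = cg v z0 := by
  obtain ⟨ρ, hρ, hpos, -, hdiff, hfd⟩ := h.gradconv hz0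
  refine ⟨ρ, hρ, fun x hx => ⟨hpos x hx, ?_⟩⟩
  refine isOpen_ball.is_const_of_deriv_eq_zero (convex_ball z0 ρ).isPreconnected hdiff ?_ hx (mem_ball_self hρ)
  intro y hy
  have hd := (hdiff.differentiableAt (isOpen_ball.mem_nhds hy)).hasDerivAt
  have h1 : HasDerivAt (fun z => z * cg v z) _ y := (hasDerivAt_id y).mul hd
  have h2 := re_hasFDerivAt h1
  have h3 : HasFDerivAt v _ y := h2.congr_of_eventuallyEq (by
    filter_upwards [isOpen_ball.mem_nhds hy] with x hx using (h.hom (hpos x hx)).symm)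
  have h4 := cg_of_hasFDerivAt h3
  have h5 : y * deriv (cg v) y = 0 := by
    have : cg v y = cg v y + y * deriv (cg v) y := by
      conv_lhs => rw [h4]
      simp
    linear_combination -this
  rcases mul_eq_zero.1 h5 with h6 | h6
  · exfalso
    have := hpos y hy
    rw [h6, h.v0] at this
    exact lt_irrefl _ this
  · exact h6

lemma halfplane (h : Blow Ω u L c r v) {z0 : ℂ} (hz0 : 0 < v z0) :
    ∀ z, 0 < (cg v z0 * z).re → v z = (cg v z0 * z).re := by
  set a := cg v z0 with ha
  have hlin : Continuous (fun z : ℂ => (a * z).re) :=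
    Complex.continuous_re.comp (continuous_const.mul continuous_id)
  set H := {z : ℂ | 0 < (a * z).re} with hH
  set A := {z : ℂ | 0 < v z ∧ cg v z = a} with hA
  have hval : ∀ z ∈ A, v z = (a * z).re := by
    intro z hz
    rw [← h.hom hz.1, hz.2, mul_comm]
  have hAo : IsOpen A := by
    rw [Metric.isOpen_iff]
    intro z hz
    obtain ⟨ρ, hρ, hb⟩ := h.cgloc hz.1
    exact ⟨ρ, hρ, fun x hx => ⟨(hb x hx).1, (hb x hx).2.trans hz.2⟩⟩
  have hHc : IsPreconnected H := by
    apply Convex.isPreconnected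
    intro x hx y hy s t hs ht hst
    simp only [hH, mem_ofPred_eq] at *
    have : (a * (s • x + t • y)).re = s * (a * x).re + t * (a * y).re := by
      simp; ring
    rw [this]
    rcases hs.eq_or_lt with h0 | h0
    · rw [← h0] at hst ⊢
      have : t = 1 := by linarith
      rw [this]; linarith
    · have := mul_nonneg ht hy.le
      have := mul_pos h0 hx
      linarith
  have hz0A : z0 ∈ A := ⟨hz0, rfl⟩
  have hsub : H ⊆ A := by
    apply hHc.subset_of_closure_inter_subset hAo
    · exact ⟨z0, by simp only [hH, mem_ofPred_eq]; rw [← hval z0 hz0A]; exact hz0, hz0A⟩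
    · rintro z ⟨hzc, hzH⟩
      have h1 : v z = (a * z).re := by
        have hcl : IsClosed {z : ℂ | v z = (a * z).re} := isClosed_eq h.vcont hlin
        exact closure_minimal hval hcl hzc
      have hvz : 0 < v z := by rw [h1]; exact hzH
      obtain ⟨ρ, hρ, hb⟩ := h.cgloc hvz
      obtain ⟨y, hy, hyA⟩ := mem_closure_iff.1 hzc (ball z ρ) isOpen_ball (mem_ball_self hρ)
      exact ⟨hvz, by rw [← (hb y hy).2, hyA.2]⟩
  exact fun z hz => hval z (hsub hz)

lemma halfplane' (h : Blow Ω u L c r v) {z0 : ℂ} (hz0 : 0 < v z0) :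
    ∀ z, 0 ≤ (cg v z0 * z).re → v z = (cg v z0 * z).re := by
  intro z hz
  rcases hz.eq_or_lt with h0 | h0
  · have hlin : Continuous (fun z : ℂ => (cg v z0 * z).re) :=
      Complex.continuous_re.comp (continuous_const.mul continuous_id)
    have hcl : IsClosed {z : ℂ | v z = (cg v z0 * z).re} := isClosed_eq h.vcont hlin
    have hpos : 0 < (cg v z0 * z0).re := by rw [mul_comm, h.hom hz0]; exact hz0
    have ht : Tendsto (fun t : ℝ => z + t * z0) (𝓝[>] 0) (𝓝 z) := by
      have : Continuous (fun t : ℝ => z + t * z0) := by fun_prop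
      have := this.tendsto 0
      simp only [Complex.ofReal_zero, zero_mul, add_zero] at this
      exact this.mono_left nhdsWithin_le_nhds
    refine hcl.mem_of_tendsto ht ?_
    filter_upwards [self_mem_nhdsWithin] with t ht
    apply h.halfplane hz0
    have : (cg v z0 * (z + t * z0)).re = (cg v z0 * z).re + t * (cg v z0 * z0).re := by
      rw [mul_add, Complex.add_re, mul_left_comm, Complex.re_ofReal_mul]
    rw [this, ← h0, zero_add]
    exact mul_pos ht hpos
  · exact h.halfplane hz0 z h0

lemma nontriv (h : Blow Ω u L c r v) : ∃ z, 0 < v z := by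
  have hK := isCompact_closedBall (0:ℂ) 1
  obtain ⟨j, hj1, hj2⟩ := ((h.evΩ 1).and (Metric.tendstoUniformlyOn_iff.1 (h.unif hK) (c/4) (by have := h.c0; positivity))).exists
  have hr := h.rpos j
  have hc := h.c0
  have hrc : (r j : ℂ) ≠ 0 := by exact_mod_cast hr.ne'
  have hsc : ∀ y ∈ ball (0:ℂ) (r j), (r j : ℂ)⁻¹ * y ∈ closedBall (0:ℂ) 1 := by
    intro y hy
    simp only [mem_ball, dist_zero_right, mem_closedBall, norm_mul, norm_inv, Complex.norm_real] at *
    rw [Real.norm_of_nonneg hr.le, inv_mul_le_iff₀ hr]; linarith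
  have hyy : ∀ y : ℂ, (r j : ℂ) * ((r j : ℂ)⁻¹ * y) = y := fun y => by field_simp
  have hsub : ball (0:ℂ) (r j) ⊆ Ω := fun y hy => by
    have := hj1 _ (hsc y hy)
    rwa [hyy] at this
  have h1 := h.nd 0 h.h0 (r j) hr hsub
  have h2 : c / 2 * r j < sSup (u '' ball 0 (r j)) := lt_of_lt_of_le (by nlinarith) h1
  obtain ⟨_, ⟨y, hy, rfl⟩, hlt⟩ := exists_lt_of_lt_csSup ((nonempty_ball.2 hr).image u) h2
  refine ⟨(r j : ℂ)⁻¹ * y, ?_⟩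
  have h3 := hj2 _ (hsc y hy)
  rw [Real.dist_eq, UU, hyy] at h3
  have h4 : c / 2 < (r j)⁻¹ * u y := by
    rw [lt_inv_mul_iff₀ hr]; linarith
  linarith [(abs_lt.1 h3).1]

lemma classify (h : Blow Ω u L c r v) : ∃ (e : ℂ) (A B : ℝ), ‖e‖ = 1 ∧ 0 < A ∧ 0 ≤ B ∧
    ∀ z, v z = A * max (e * z).re 0 + B * max (-(e * z).re) 0 := by
  obtain ⟨z0, hz0⟩ := h.nontriv
  set a := cg v z0 with ha
  have hH := h.halfplane' hz0
  have haz : 0 < (a * z0).re := by rw [mul_comm, h.hom hz0]; exact hz0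
  have ha0 : a ≠ 0 := by
    intro h0; rw [h0] at haz; simp at haz
  have hn : 0 < ‖a‖ := norm_pos_iff.2 ha0
  have hnc : (‖a‖ : ℂ) ≠ 0 := by exact_mod_cast hn.ne'
  have hae : ∀ z, (a * z).re = ‖a‖ * ((a / ‖a‖) * z).re := by
    intro z
    rw [← Complex.re_ofReal_mul, ← mul_assoc, mul_div_cancel₀ _ hnc]
  have hue : ‖a / (‖a‖:ℂ)‖ = 1 := by
    rw [norm_div, Complex.norm_real, norm_norm, div_self hn.ne']
  by_cases hneg : ∀ z, (a * z).re < 0 → v z = 0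
  · refine ⟨a / ‖a‖, ‖a‖, 0, hue, hn, le_rfl, fun z => ?_⟩
    rw [zero_mul, add_zero]
    rcases le_or_gt 0 (a * z).re with h1 | h1
    · rw [hH z h1, hae z]
      rw [hae z] at h1
      rw [max_eq_left ((mul_nonneg_iff_of_pos_left hn).1 h1)]
    · rw [hneg z h1]
      rw [hae z] at h1
      rw [max_eq_right (by nlinarith), mul_zero]
  · push Not at hneg
    obtain ⟨z1, hz1, hvz1⟩ := hneg
    have hv1 : 0 < v z1 := lt_of_le_of_ne (h.vnn z1) (Ne.symm hvz1)
    set b := cg v z1 with hb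
    have hH1 := h.halfplane' hv1
    have hbz : 0 < (b * z1).re := by rw [mul_comm, h.hom hv1]; exact hv1
    have hk : ∀ z, (a * z).re = 0 → (b * z).re ≤ 0 := by
      intro z hz
      by_contra hcon
      push Not at hcon
      have e1 := hH z hz.ge
      have e2 := hH1 z hcon.le
      rw [← hb] at e2
      rw [hz] at e1
      linarith
    have hw : b.re * a.im - b.im * a.re = 0 := by
      have e1 := hk (a.im + a.re * I) (by simp; ring)
      have e2 := hk (-(a.im + a.re * I)) (by simp; ring)
      simp at e1 e2
      linarith
    set m := (b.re * a.re + b.im * a.im) / (a.re^2 + a.im^2) with hm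
    have hN : 0 < a.re^2 + a.im^2 := by
      have := Nn_eq a
      unfold Nn at this; rw [this]; positivity
    have hbm : ∀ z, (b * z).re = m * (a * z).re := by
      intro z
      rw [hm, div_mul_eq_mul_div, eq_div_iff hN.ne']
      simp only [Complex.mul_re]
      linear_combination (z.re * a.im + z.im * a.re) * hw
    have hmneg : m < 0 := by
      have := hbm z1
      rw [this] at hbz
      by_contra hcon
      push Not at hcon
      nlinarith
    refine ⟨a / ‖a‖, ‖a‖, -m * ‖a‖, hue, hn, by nlinarith, fun z => ?_⟩
    rcases le_or_gt 0 (a * z).re with h1 | h1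
    · rw [hH z h1, hae z]
      rw [hae z] at h1
      have h2 := (mul_nonneg_iff_of_pos_left hn).1 h1
      rw [max_eq_left h2, max_eq_right (by linarith)]; ring
    · have h3 : 0 ≤ (b * z).re := by rw [hbm]; nlinarith
      have h4 := hH1 z h3
      rw [← hb, hbm z, hae z] at h4
      rw [h4]
      rw [hae z] at h1
      have h2 : ((a / ‖a‖) * z).re < 0 := by nlinarith
      rw [max_eq_right h2.le, max_eq_left (by linarith)]; ring

end Blow

open Complex Metric Set Filter MeasureTheory
open scoped Topology Classical NNReal

/-- integrand of the translation identity -/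
noncomputable def tI (d : ℂ) (p q χ : ℝ) (z : ℂ) (f : ℝ) : ℝ :=
  (p ^ 2 + q ^ 2 + χ) * (2 * f * (z.re * d.re + z.im * d.im))
    - 2 * (p * d.re + q * d.im) * (2 * f * (p * z.re + q * z.im))

namespace Data
variable {Ω : Set ℂ} {u : ℂ → ℝ} {L : ℝ}

lemma trans_id (h : Data Ω u L) (d : ℂ) {R : ℝ} (hR : 0 ≤ R) (hKΩ : closedBall (0:ℂ) R ⊆ Ω)
    {F : ℝ → ℝ} (hF : ContDiff ℝ (⊤ : ℕ∞) F)
    {T : ℝ} (hTR : T ≤ R ^ 2) (hT : ∀ t, T < t → F t = 0) :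
    ∫ z : ℂ, tI d (fderiv ℝ u z 1) (fderiv ℝ u z I) ((posSet Ω u).indicator (fun _ => (1:ℝ)) z) z
      (deriv F (Nn z)) = 0 := by
  have hT1 := deriv_van hT
  have hFo : ContDiffOn ℝ (⊤ : ℕ∞) F (Ioi (-1)) := hF.contDiffOn
  have hηc := rad_contDiff one_pos hFo
  have hsup : tsupport (fun z => ((F (Nn z) : ℝ) : ℂ) * d) ⊆ closedBall 0 R :=
    supp_rad hTR hR (fun z hz => by simp [hT _ hz])
  have hid := h.var.2.2.2.2 (fun z => ((F (Nn z) : ℝ) : ℂ) * d)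
    ((Complex.ofRealCLM.contDiff.comp hηc).mul contDiff_const)
    (HasCompactSupport.of_support_subset_isCompact (isCompact_closedBall 0 R)
      ((subset_tsupport _).trans hsup)) (hsup.trans hKΩ)
  rw [← hid, ← integral_indicator h.op.measurableSet]
  congr 1
  ext z
  by_cases hz : z ∈ Ω
  · rw [indicator_of_mem hz, integrand_eta _ _ _ (hηc.differentiable (by simp))]
    have hχ : (posSet Ω u).indicator (fun _ => (1:ℝ)) z = indicator {w | 0 < u w} (fun _ => (1:ℝ)) z := by
      simp [indicator, posSet, hz]
    rw [hχ, (rad_fderiv one_pos hFo z).fderiv, grad2_re, grad2_im]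
    simp [tI]
    ring
  · have hz' : z ∉ closedBall (0:ℂ) R := fun h' => hz (hKΩ h')
    have : T < Nn z := by
      simp only [mem_closedBall, dist_zero_right, not_le] at hz'
      rw [Nn_eq]; nlinarith
    rw [indicator_of_notMem hz, hT1 _ this]
    simp [tI]

lemma trans_scaled (h : Data Ω u L) (d : ℂ) {a : ℝ} (ha : 0 < a) (hKΩ : ∀ z ∈ closedBall (0:ℂ) 1, (a:ℂ) * z ∈ Ω)
    {F : ℝ → ℝ} (hF : ContDiff ℝ (⊤ : ℕ∞) F) (hT : ∀ t, 1 < t → F t = 0) :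
    ∫ z : ℂ, tI d (fderiv ℝ u (a * z) 1) (fderiv ℝ u (a * z) I)
      ((posSet Ω u).indicator (fun _ => (1:ℝ)) (a * z)) z (deriv F (Nn z)) = 0 := by
  have hac : (a : ℂ) ≠ 0 := by exact_mod_cast ha.ne'
  have hsub : closedBall (0:ℂ) a ⊆ Ω := by
    intro y hy
    have hyy : (a : ℂ) * ((a : ℂ)⁻¹ * y) = y := by field_simp
    rw [← hyy]
    apply hKΩ
    simp only [dist_zero_right, mem_closedBall, norm_mul, norm_inv, Complex.norm_real] at *
    rw [Real.norm_of_nonneg ha.le, inv_mul_le_iff₀ ha]; linarith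
  have h1 := h.trans_id d ha.le hsub (F := fun t => F ((a^2)⁻¹ * t))
    (hF.comp (contDiff_const.mul contDiff_id)) (T := a^2) le_rfl (fun t ht => by
      apply hT
      rw [lt_inv_mul_iff₀ (by positivity)]; linarith)
  have h2 := Measure.integral_comp_smul (volume : Measure ℂ) (fun z => tI d (fderiv ℝ u z 1) (fderiv ℝ u z I) ((posSet Ω u).indicator (fun _ => (1:ℝ)) z) z
      (deriv (fun t => F ((a^2)⁻¹ * t)) (Nn z))) a
  rw [h1, smul_zero] at h2
  have h3 : ∀ z : ℂ, tI d (fderiv ℝ u (a * z) 1) (fderiv ℝ u (a * z) I)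
      ((posSet Ω u).indicator (fun _ => (1:ℝ)) (a * z)) z (deriv F (Nn z)) =
      a * tI d (fderiv ℝ u (a • z) 1) (fderiv ℝ u (a • z) I)
      ((posSet Ω u).indicator (fun _ => (1:ℝ)) (a • z)) (a • z)
        (deriv (fun t => F ((a^2)⁻¹ * t)) (Nn (a • z))) := by
    intro z
    have e1 : deriv (fun t => F ((a^2)⁻¹ * t)) (Nn (a • z)) = (a^2)⁻¹ * deriv F (Nn z) := by
      rw [deriv_comp_mul_left]
      have : (a^2)⁻¹ * Nn (a • z) = Nn z := by
        simp [Nn]; field_simp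
      rw [this]; rfl
    rw [e1]
    simp only [tI, Complex.real_smul, Complex.re_ofReal_mul, Complex.im_ofReal_mul]
    field_simp
  simp_rw [h3]
  rw [integral_const_mul, h2, mul_zero]
end Data

/-- the profile -/
noncomputable def FF (t : ℝ) : ℝ := expNegInvGlue (1 - t)
lemma FF_cd : ContDiff ℝ (⊤ : ℕ∞) FF := expNegInvGlue.contDiff.comp (contDiff_const.sub contDiff_id)
lemma FF_van : ∀ t, 1 < t → FF t = 0 := fun t ht => expNegInvGlue.zero_of_nonpos (by linarith)
lemma FF_anti : Antitone FF := fun a b hab => expNegInvGlue.monotone (by linarith)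
lemma FF_d_le (t : ℝ) : deriv FF t ≤ 0 := FF_anti.deriv_nonpos
lemma FF_dc : Continuous (deriv FF) := FF_cd.continuous_deriv (by simp)
lemma FF_dvan : ∀ t, 1 < t → deriv FF t = 0 := deriv_van FF_van
lemma FF_dneg : ∃ t, 0 < t ∧ deriv FF t < 0 := by
  obtain ⟨t, ht, he⟩ := exists_deriv_eq_slope FF (zero_lt_one) FF_cd.continuous.continuousOn
    (FF_cd.differentiable (by simp)).differentiableOn
  refine ⟨t, ht.1, ?_⟩
  rw [he]
  have h1 : FF 1 = 0 := expNegInvGlue.zero_of_nonpos (by simp)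
  have h0 : 0 < FF 0 := expNegInvGlue.pos_of_pos (by simp)
  rw [h1]; linarith

lemma line_null {e : ℂ} (he : ‖e‖ = 1) : ∀ᵐ z : ℂ, (e * z).re ≠ 0 := by
  have h1 : volume ((LinearMap.ker (TT e).toLinearMap : Submodule ℝ ℂ) : Set ℂ) = 0 := by
    apply Measure.addHaar_submodule
    intro htop
    have : (starRingEnd ℂ) e ∈ LinearMap.ker (TT e).toLinearMap := by rw [htop]; trivial
    rw [LinearMap.mem_ker] at this
    have h2 : TT e ((starRingEnd ℂ) e) = 0 := this
    rw [TT_apply, Complex.mul_conj, Complex.normSq_eq_norm_sq, he] at h2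
    simp at h2
  rw [ae_iff]
  convert h1 using 2
  ext z
  simp only [not_not, SetLike.mem_coe, LinearMap.mem_ker]
  show _ ↔ TT e z = 0
  rw [TT_apply]; rfl

lemma supp_cb {f : ℂ → ℝ} (hf : ∀ z, 1 < Nn z → f z = 0) : HasCompactSupport f :=
  HasCompactSupport.of_support_subset_isCompact (isCompact_closedBall 0 1)
      ((subset_tsupport _).trans (supp_rad (T := 1) (by norm_num) zero_le_one hf))

lemma fX_int {e : ℂ} (he : ‖e‖ = 1) : ∫ z : ℂ, deriv FF (Nn z) * |(e * z).re| < 0 := by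
  have hN : Continuous Nn := Nn_contDiff.continuous
  have hc : Continuous (fun z : ℂ => - (deriv FF (Nn z) * |(e * z).re|)) := by
    have := FF_dc.comp hN
    have h2 : Continuous fun z : ℂ => |(e * z).re| := (Complex.continuous_re.comp (continuous_const.mul continuous_id)).abs
    exact (this.mul h2).neg
  obtain ⟨t, ht, hlt⟩ := FF_dneg
  have := hc.integral_pos_of_hasCompactSupport_nonneg_nonzero (μ := volume)
    (supp_cb (fun z hz => by simp [FF_dvan _ hz]))
    (fun z => by
      have := FF_d_le (Nn z)
      have := abs_nonneg (e * z).re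
      show (0:ℝ) ≤ _
      nlinarith) (x := (Real.sqrt t : ℂ) * (starRingEnd ℂ) e) (by
      have h1 : Nn ((Real.sqrt t : ℂ) * (starRingEnd ℂ) e) = t := by
        rw [Nn_eq, norm_mul, Complex.norm_real]; simp [he, Real.sq_sqrt ht.le]
      have h2 : (e * ((Real.sqrt t : ℂ) * (starRingEnd ℂ) e)).re = Real.sqrt t := by
        rw [mul_left_comm, Complex.mul_conj, Complex.normSq_eq_norm_sq, he]; simp
      rw [h1, h2]
      have := Real.sqrt_pos.2 ht
      have h3 : |Real.sqrt t| ≠ 0 := by positivity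
      exact neg_ne_zero.2 (mul_ne_zero hlt.ne h3))
  rw [integral_neg] at this
  linarith

namespace Blow
variable {Ω : Set ℂ} {u : ℂ → ℝ} {L c : ℝ} {r : ℕ → ℝ} {v : ℂ → ℝ}

lemma slope (h : Blow Ω u L c r v) {e : ℂ} (he : ‖e‖ = 1) {A B κ : ℝ}
    (hχ1 : ∀ z : ℂ, 0 < (e * z).re → Tendsto (fun j => (posSet Ω u).indicator (fun _ => (1:ℝ)) (r j * z)) atTop (𝓝 1))
    (hg1 : ∀ z : ℂ, 0 < (e * z).re → Tendsto (fun j => cg u (r j * z)) atTop (𝓝 (A * e)))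
    (hχ2 : ∀ z : ℂ, (e * z).re < 0 → Tendsto (fun j => (posSet Ω u).indicator (fun _ => (1:ℝ)) (r j * z)) atTop (𝓝 κ))
    (hg2 : ∀ z : ℂ, (e * z).re < 0 → Tendsto (fun j => cg u (r j * z)) atTop (𝓝 (-B * e))) :
    1 - A ^ 2 = κ - B ^ 2 := by
  set d := (starRingEnd ℂ) e with hd
  have hN : Continuous Nn := Nn_contDiff.continuous
  have hfN : Continuous fun z => deriv FF (Nn z) := FF_dc.comp hN
  have hee : e.re ^ 2 + e.im ^ 2 = 1 := by
    have := Nn_eq e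
    rw [he] at this; simpa [Nn] using this
  set G : ℂ → ℝ := fun z => (1 - A ^ 2 + (κ - B ^ 2)) * (deriv FF (Nn z) * (e * z).re)
    + (1 - A ^ 2 - (κ - B ^ 2)) * (deriv FF (Nn z) * |(e * z).re|) with hG
  have hX : Continuous fun z : ℂ => (e * z).re := Complex.continuous_re.comp (continuous_const.mul continuous_id)
  have hXa : Continuous fun z : ℂ => |(e * z).re| := hX.abs
  have key : Tendsto (fun j => ∫ z : ℂ, tI d (fderiv ℝ u (r j * z) 1) (fderiv ℝ u (r j * z) I)
      ((posSet Ω u).indicator (fun _ => (1:ℝ)) (r j * z)) z (deriv FF (Nn z))) atTop (𝓝 (∫ z, G z)) := by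
    obtain ⟨M, hM⟩ := (isCompact_closedBall (0:ℂ) 1).exists_bound_of_continuousOn hfN.continuousOn
    have hcp : IsCompact (Icc (-L) L ×ˢ Icc (-L) L ×ˢ Icc (0:ℝ) 1 ×ˢ closedBall (0:ℂ) 1 ×ˢ Icc (-M) M) :=
      isCompact_Icc.prod (isCompact_Icc.prod (isCompact_Icc.prod ((isCompact_closedBall _ _).prod isCompact_Icc)))
    obtain ⟨K, hK⟩ := hcp.exists_bound_of_continuousOn
      (f := fun x : ℝ × ℝ × ℝ × ℂ × ℝ => tI d x.1 x.2.1 x.2.2.1 x.2.2.2.1 x.2.2.2.2) (by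
        apply Continuous.continuousOn
        unfold tI
        fun_prop)
    apply tendsto_integral_filter_of_dominated_convergence ((closedBall (0:ℂ) 1).indicator (fun _ => K))
    · filter_upwards with j
      apply Measurable.aestronglyMeasurable
      have m0 : Measurable fun z : ℂ => (r j : ℂ) * z := by fun_prop
      have m1 := (measurable_fderiv_apply_const ℝ u 1).comp m0
      have m2 := (measurable_fderiv_apply_const ℝ u I).comp m0
      have m3' : Measurable ((posSet Ω u).indicator (fun _ => (1:ℝ))) :=
        measurable_const.indicator h.dat.Uop.measurableSet
      have m3 := m3'.comp m0
      have m4 := hfN.measurable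
      simp only [Function.comp_def] at m1 m2 m3
      unfold tI
      have m5 := Complex.measurable_re
      have m6 := Complex.measurable_im
      exact ((((m1.pow_const 2).add (m2.pow_const 2)).add m3).mul ((measurable_const.mul m4).mul ((m5.mul measurable_const).add (m6.mul measurable_const)))).sub
        ((measurable_const.mul ((m1.mul measurable_const).add (m2.mul measurable_const))).mul
          ((measurable_const.mul m4).mul ((m1.mul m5).add (m2.mul m6))))
    · filter_upwards [h.evΩ 1] with j hj
      filter_upwards with z
      by_cases hz : z ∈ closedBall (0:ℂ) 1
      · rw [indicator_of_mem hz]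
        have b1 := h.dat.fdapp_le (hj z hz) 1
        have b2 := h.dat.fdapp_le (hj z hz) I
        simp only [norm_one, Complex.norm_I, mul_one] at b1 b2
        have b3 : (posSet Ω u).indicator (fun _ => (1:ℝ)) (r j * z) ∈ Icc (0:ℝ) 1 := by
          by_cases hp : (r j : ℂ) * z ∈ posSet Ω u
          · rw [indicator_of_mem hp]; simp
          · rw [indicator_of_notMem hp]; simp
        exact hK (fderiv ℝ u (r j * z) 1, fderiv ℝ u (r j * z) I,
          (posSet Ω u).indicator (fun _ => (1:ℝ)) (r j * z), z, deriv FF (Nn z))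
          ⟨abs_le.1 b1, abs_le.1 b2, b3, hz, abs_le.1 (hM z hz)⟩
      · rw [indicator_of_notMem hz]
        have : 1 < Nn z := by
          simp only [mem_closedBall, dist_zero_right, not_le] at hz
          rw [Nn_eq]; nlinarith
        rw [FF_dvan _ this]; simp [tI]
    · exact (integrable_indicator_iff isClosed_closedBall.measurableSet).2
        (by simp [(isCompact_closedBall (0:ℂ) 1).measure_lt_top.ne])
    · filter_upwards [line_null he] with z hz
      have lim : ∀ (a k : ℝ), Tendsto (fun j => (posSet Ω u).indicator (fun _ => (1:ℝ)) (r j * z)) atTop (𝓝 k) →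
          Tendsto (fun j => cg u (r j * z)) atTop (𝓝 (a * e)) →
          Tendsto (fun j => tI d (fderiv ℝ u (r j * z) 1) (fderiv ℝ u (r j * z) I)
      ((posSet Ω u).indicator (fun _ => (1:ℝ)) (r j * z)) z (deriv FF (Nn z))) atTop
        (𝓝 ((k - a ^ 2) * (2 * deriv FF (Nn z) * (e * z).re))) := by
        intro a k hk ha
        have l1 : Tendsto (fun j => fderiv ℝ u (r j * z) 1) atTop (𝓝 (a * e.re)) := by
          have := (Complex.continuous_re.tendsto _).comp ha
          simpa [Function.comp_def, cg_re] using this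
        have l2 : Tendsto (fun j => fderiv ℝ u (r j * z) I) atTop (𝓝 (- (a * e.im))) := by
          have := ((Complex.continuous_im.tendsto _).comp ha).neg
          simpa [Function.comp_def, cg_im] using this
        have hcont : Continuous (fun x : ℝ × ℝ × ℝ => tI d x.1 x.2.1 x.2.2 z (deriv FF (Nn z))) := by
          unfold tI; fun_prop
        have l3 := (hcont.tendsto (a * e.re, - (a * e.im), k)).comp (l1.prodMk_nhds (l2.prodMk_nhds hk))
        refine l3.congr' (by rfl) |>.trans (le_of_eq ?_)
        congr 1
        simp only [tI, hd, Complex.conj_re, Complex.conj_im, Complex.mul_re]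
        have e2 : e.im ^ 2 = 1 - e.re ^ 2 := by linarith
        ring_nf
        simp only [show e.im ^ 3 = e.im * e.im ^ 2 by ring, show e.im ^ 4 = e.im ^ 2 * e.im ^ 2 by ring, e2]
        ring
      rcases lt_or_gt_of_ne hz with hlt | hgt
      · convert lim (-B) κ (hχ2 z hlt) (by simpa using hg2 z hlt) using 2
        simp only [hG, abs_of_neg hlt]; ring
      · convert lim A 1 (hχ1 z hgt) (hg1 z hgt) using 2
        simp only [hG, abs_of_pos hgt]; ring
  have hz : ∫ z, G z = 0 := by
    refine tendsto_nhds_unique key ?_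
    apply tendsto_const_nhds.congr'
    filter_upwards [h.evΩ 1] with j hj
    exact (h.dat.trans_scaled d (h.rpos j) hj FF_cd FF_van).symm
  have i1 : Integrable (fun z => deriv FF (Nn z) * (e * z).re) :=
    (hfN.mul hX).integrable_of_hasCompactSupport (supp_cb (fun z hz => by simp [FF_dvan _ hz]))
  have i2 : Integrable (fun z => deriv FF (Nn z) * |(e * z).re|) :=
    (hfN.mul hXa).integrable_of_hasCompactSupport (supp_cb (fun z hz => by simp [FF_dvan _ hz]))
  have hodd : ∫ z : ℂ, deriv FF (Nn z) * (e * z).re = 0 := by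
    have := integral_neg_eq_self (fun z : ℂ => deriv FF (Nn z) * (e * z).re) volume
    have h2 : ∀ z : ℂ, deriv FF (Nn (-z)) * (e * -z).re = - (deriv FF (Nn z) * (e * z).re) := by
      intro z
      have : Nn (-z) = Nn z := by simp [Nn]
      rw [this]; simp; ring
    simp_rw [h2] at this
    rw [integral_neg] at this
    linarith
  rw [hG, integral_add (i1.const_mul _) (i2.const_mul _), integral_const_mul, integral_const_mul, hodd, mul_zero, zero_add] at hz
  have := (mul_eq_zero.1 hz).resolve_right (fX_int he).ne
  linarith
end Blow

open Complex Metric Set Filter MeasureTheory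
open scoped Topology Classical NNReal

lemma side_of_conn {S P : Set ℂ} (hS : IsPreconnected S) (hf : ∀ x ∈ S, x ∉ frontier P) :
    S ⊆ P ∨ ∀ x ∈ S, x ∉ P := by
  have := hS.subset_or_subset (u := interior P) (v := (closure P)ᶜ) isOpen_interior
    isClosed_closure.isOpen_compl
    (disjoint_compl_right.mono_left (interior_subset.trans subset_closure)) (by
      intro x hx
      by_cases h1 : x ∈ closure P
      · left
        by_contra h2
        exact hf x hx ⟨h1, h2⟩
      · right; exact h1)
  rcases this with h | h
  · left; exact h.trans interior_subset
  · right; exact fun x hx hp => h hx (subset_closure hp)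

namespace Blow
variable {Ω : Set ℂ} {u : ℂ → ℝ} {L c : ℝ} {r : ℕ → ℝ} {v : ℂ → ℝ}

lemma subseq (h : Blow Ω u L c r v) {φ : ℕ → ℕ} (hφ : StrictMono φ) : Blow Ω u L c (r ∘ φ) v where
  dat := h.dat
  c0 := h.c0
  nd := h.nd
  h0 := h.h0
  rpos := fun j => h.rpos _
  rto := h.rto.comp hφ.tendsto_atTop
  conv := fun s hs x => by
    obtain ⟨t, ht, he⟩ := h.conv s hs x
    exact ⟨t, ht, hφ.tendsto_atTop.eventually he⟩

lemma noFB (h : Blow Ω u L c r v) {K U : Set ℂ} (hK : IsCompact K) (hU : IsOpen U) (hKU : K ⊆ U)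
    (hv : ∀ z ∈ U, v z = 0) : ∀ᶠ j in atTop, ∀ z ∈ K, (r j : ℂ) * z ∉ frontier (posSet Ω u) := by
  obtain ⟨δ, hδ, hsub⟩ := hK.exists_cthickening_subset_open hU hKU
  have hK2 := hK.cthickening (r := δ)
  obtain ⟨R, hR⟩ := hK2.isBounded.subset_closedBall 0
  have hc := h.c0
  filter_upwards [h.evΩ R, Metric.tendstoUniformlyOn_iff.1 (h.unif hK2) (c*δ/2) (by positivity)] with j hj1 hj2 z hz hfr
  have hr := h.rpos j
  have hrc : (r j : ℂ) ≠ 0 := by exact_mod_cast hr.ne'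
  have hyy : ∀ y : ℂ, (r j : ℂ) * ((r j : ℂ)⁻¹ * y) = y := fun y => by field_simp
  have hsc : ∀ y ∈ ball ((r j : ℂ) * z) (r j * δ), (r j : ℂ)⁻¹ * y ∈ cthickening δ K := by
    intro y hy
    apply mem_cthickening_of_dist_le _ z _ _ hz
    rw [mem_ball, dist_eq_norm] at *
    have h2 : (r j : ℂ)⁻¹ * y - z = (r j : ℂ)⁻¹ * (y - (r j : ℂ) * z) := by field_simp
    rw [h2, norm_mul, norm_inv, Complex.norm_real, Real.norm_of_nonneg hr.le, inv_mul_le_iff₀ hr]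
    exact hy.le
  have hsub2 : ball ((r j : ℂ) * z) (r j * δ) ⊆ Ω := fun y hy => by
    have := hj1 _ (hR (hsc y hy))
    rwa [hyy] at this
  have h1 := h.nd _ ⟨hsub2 (mem_ball_self (by positivity)), hfr⟩ (r j * δ) (by positivity) hsub2
  have h2 : c * δ / 2 * r j < sSup (u '' ball ((r j : ℂ) * z) (r j * δ)) := lt_of_lt_of_le (by
    have : 0 < c * δ * r j := by positivity
    nlinarith) h1
  obtain ⟨_, ⟨y, hy, rfl⟩, hlt⟩ := exists_lt_of_lt_csSup ((nonempty_ball.2 (by positivity)).image u) h2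
  have h3 := hj2 _ (hsc y hy)
  rw [Real.dist_eq, UU, hyy, hv _ (hsub (hsc y hy))] at h3
  have h4 : c * δ / 2 < (r j)⁻¹ * u y := by
    rw [lt_inv_mul_iff₀ hr]; linarith
  linarith [(abs_lt.1 h3).1]

lemma cg_plus {e : ℂ} {A B : ℝ} (hv : ∀ z, v z = A * max (e*z).re 0 + B * max (-(e*z).re) 0) {z : ℂ}
    (hz : 0 < (e * z).re) : cg v z = A * e := by
  apply cg_of_hasFDerivAt
  have h1 : HasFDerivAt (fun y : ℂ => ((A * e) * y).re) (TT (A * e)) z :=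
    re_hasFDerivAt (by simpa using (hasDerivAt_id z).const_mul ((A:ℂ) * e))
  refine h1.congr_of_eventuallyEq ?_
  have hX : Continuous fun z : ℂ => (e * z).re := Complex.continuous_re.comp (continuous_const.mul continuous_id)
  filter_upwards [(isOpen_lt continuous_const hX).mem_nhds hz] with y hy
  have hy : 0 < (e * y).re := hy
  rw [hv, max_eq_left hy.le, max_eq_right (by linarith), mul_assoc, Complex.re_ofReal_mul]; ring

lemma hv_flip {e : ℂ} {A B : ℝ} (hv : ∀ z, v z = A * max (e*z).re 0 + B * max (-(e*z).re) 0) :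
    ∀ z, v z = B * max ((-e)*z).re 0 + A * max (-((-e)*z).re) 0 := by
  intro z
  rw [hv z, neg_mul, Complex.neg_re, neg_neg]; ring

lemma lim_plus (h : Blow Ω u L c r v) {e : ℂ} {A B : ℝ} (hA : 0 < A)
    (hv : ∀ z, v z = A * max (e*z).re 0 + B * max (-(e*z).re) 0) {z : ℂ} (hz : 0 < (e * z).re) :
    Tendsto (fun j => (posSet Ω u).indicator (fun _ => (1:ℝ)) (r j * z)) atTop (𝓝 1) ∧
    Tendsto (fun j => cg u (r j * z)) atTop (𝓝 (A * e)) := by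
  have hpos : 0 < v z := by
    rw [hv, max_eq_left hz.le, max_eq_right (by linarith)]; simp; positivity
  constructor
  · apply tendsto_const_nhds.congr'
    filter_upwards [h.evpos (isCompact_singleton (x := z)) (by simpa using hpos)] with j hj
    rw [indicator_of_mem (hj z rfl)]
  · obtain ⟨ρ, hρ, _, hT, _⟩ := h.gradconv hpos
    rw [← cg_plus hv hz]
    exact hT.tendsto_at (mem_ball_self hρ)

lemma AB_eq (h : Blow Ω u L c r v) {e : ℂ} (he : ‖e‖ = 1) {A B : ℝ} (hA : 0 < A) (hB : 0 < B)
    (hv : ∀ z, v z = A * max (e*z).re 0 + B * max (-(e*z).re) 0) : A = B := by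
  have hm : ∀ z : ℂ, (e * z).re < 0 → 0 < ((-e) * z).re := fun z hz => by
    rw [neg_mul, Complex.neg_re]; linarith
  have := h.slope he (A := A) (B := B) (κ := 1) (fun z hz => (h.lim_plus hA hv hz).1)
    (fun z hz => (h.lim_plus hA hv hz).2)
    (fun z hz => (h.lim_plus hB (hv_flip hv) (hm z hz)).1)
    (fun z hz => by simpa using (h.lim_plus hB (hv_flip hv) (hm z hz)).2)
  have h2 : A ^ 2 = B ^ 2 := by linarith
  exact (pow_left_inj₀ hA.le hB.le two_ne_zero).1 h2

lemma A_one (h : Blow Ω u L c r v) {e : ℂ} (he : ‖e‖ = 1) {A : ℝ} (hA : 0 < A)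
    (hv : ∀ z, v z = A * max (e*z).re 0 + 0 * max (-(e*z).re) 0) : A = 1 := by
  have hX : Continuous fun z : ℂ => (e * z).re := Complex.continuous_re.comp (continuous_const.mul continuous_id)
  set U : Set ℂ := {z | (e * z).re < 0} with hUd
  have hU : IsOpen U := isOpen_lt hX continuous_const
  have hvU : ∀ z ∈ U, v z = 0 := fun z hz => by
    have hz : (e * z).re < 0 := hz
    rw [hv, max_eq_right hz.le]; simp
  have hconv : Convex ℝ U := by
    have : U = TT e ⁻¹' Iio 0 := by ext z; simp [hUd, TT_apply]
    rw [this]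
    exact (convex_Iio 0).linear_preimage (TT e).toLinearMap
  set p : ℂ := - (starRingEnd ℂ) e with hp
  have hpU : p ∈ U := by
    show (e * p).re < 0
    rw [hp, mul_neg, Complex.mul_conj, Complex.normSq_eq_norm_sq, he]; simp
  -- a subsequence with constant phase at p
  obtain ⟨φ, hφ, κ, hκ, hκc⟩ : ∃ φ : ℕ → ℕ, StrictMono φ ∧ ∃ κ : ℝ, (κ = 0 ∨ κ = 1) ∧
      ∀ j, (posSet Ω u).indicator (fun _ => (1:ℝ)) (r (φ j) * p) = κ := by
    by_cases hfr : ∃ᶠ j in atTop, (r j : ℂ) * p ∈ posSet Ω u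
    · obtain ⟨φ, hφ, hh⟩ := extraction_of_frequently_atTop hfr
      exact ⟨φ, hφ, 1, Or.inr rfl, fun j => indicator_of_mem (hh j) _⟩
    · rw [not_frequently] at hfr
      obtain ⟨φ, hφ, hh⟩ := extraction_of_eventually_atTop hfr
      exact ⟨φ, hφ, 0, Or.inl rfl, fun j => indicator_of_notMem (hh j) _⟩
  have h' := h.subseq hφ
  have side : ∀ (K : Set ℂ), K ⊆ U → IsCompact K → IsPreconnected K → ∀ᶠ j in atTop,
      (∀ z ∈ K, (((r ∘ φ) j : ℝ) : ℂ) * z ∈ posSet Ω u) ∨ (∀ z ∈ K, (((r ∘ φ) j : ℝ) : ℂ) * z ∉ posSet Ω u) := by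
    intro K hKU hK hKc
    filter_upwards [h'.noFB hK hU hKU hvU] with j hj
    have hc1 : IsPreconnected ((fun z : ℂ => (((r ∘ φ) j : ℝ) : ℂ) * z) '' K) :=
      hKc.image _ (by fun_prop)
    rcases side_of_conn (P := posSet Ω u) hc1 (by rintro _ ⟨z, hz, rfl⟩; exact hj z hz) with h1 | h1
    · left; exact fun z hz => h1 ⟨z, hz, rfl⟩
    · right; exact fun z hz => h1 _ ⟨z, hz, rfl⟩
  have := h'.slope he (A := A) (B := 0) (κ := κ) (fun z hz => (h'.lim_plus hA hv hz).1)
    (fun z hz => (h'.lim_plus hA hv hz).2)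
    (fun z hz => by
      apply tendsto_const_nhds.congr'
      have hsc : IsCompact (segment ℝ z p) := by
        rw [segment_eq_image_lineMap]
        exact isCompact_Icc.image (by fun_prop)
      filter_upwards [side (segment ℝ z p) (hconv.segment_subset hz hpU) hsc (convex_segment z p).isPreconnected] with j hj
      rw [← hκc j]
      rcases hj with hj | hj
      · have h1 := hj z (left_mem_segment ℝ z p)
        have h2 := hj p (right_mem_segment ℝ z p)
        rw [indicator_of_mem h1]
        exact indicator_of_mem h2 _
      · have h1 := hj z (left_mem_segment ℝ z p)
        have h2 := hj p (right_mem_segment ℝ z p)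
        rw [indicator_of_notMem h1]
        exact indicator_of_notMem h2 _)
    (fun z hz => by
      simp only [Complex.ofReal_zero, neg_zero, zero_mul]
      obtain ⟨δ, hδ, hsub⟩ := Metric.nhds_basis_closedBall.mem_iff.1 (hU.mem_nhds hz)
      have hK := isCompact_closedBall z δ
      rw [Metric.tendsto_nhds]
      intro ε hε
      set C := 2 * Real.exp 2 / δ with hC
      have hC0 : 0 < C := by positivity
      filter_upwards [side _ hsub hK (convex_closedBall z δ).isPreconnected, h'.evΩ ‖z‖,
        Metric.tendstoUniformlyOn_iff.1 (h'.unif hK) (ε / (2 * C)) (by positivity)] with j hj hΩ hM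
      rw [dist_zero_right]
      rcases hj with hj | hj
      · have hLH := h'.LHU (j := j) (z := z) (ρ := δ) (fun x hx => hj x (ball_subset_closedBall hx))
        have h3 := hLH.grad_le hδ (M := ε / (2 * C)) (by positivity) (fun y hy => by
          have := hM y (ball_subset_closedBall hy)
          rw [hvU y (hsub (ball_subset_closedBall hy)), Real.dist_eq, zero_sub, abs_neg] at this
          exact this.le)
        rw [h'.cgU] at h3
        refine lt_of_le_of_lt h3 ?_
        have : 2 * Real.exp 2 * (ε / (2 * C)) / δ = ε / 2 := by
          rw [hC]; field_simp
        rw [this]; linarith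
      · have h1 := h.dat.fd_zero (hΩ z (by simp)) (hj z (mem_closedBall_self hδ.le))
        rw [cg, h1]; simpa using hε)
  rcases hκ with rfl | rfl
  · have h2 : A ^ 2 = 1 ^ 2 := by linarith
    exact (pow_left_inj₀ hA.le zero_le_one two_ne_zero).1 h2
  · have : A ^ 2 = 0 := by linarith
    nlinarith

lemma form (h : Blow Ω u L c r v) : ∃ e : ℂ, ‖e‖ = 1 ∧ ((∀ z, v z = max (e * z).re 0) ∨
    ∃ s, 0 < s ∧ ∀ z, v z = s * |(e * z).re|) := by
  obtain ⟨e, A, B, he, hA, hB, hv⟩ := h.classify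
  refine ⟨e, he, ?_⟩
  rcases hB.eq_or_lt with rfl | hB
  · left
    have := h.A_one he hA hv
    intro z
    rw [hv, this]; ring
  · right
    have := h.AB_eq he hA hB hv
    refine ⟨A, hA, fun z => ?_⟩
    rw [hv, ← this, ← mul_add]
    congr 1
    rcases le_total 0 (e * z).re with h1 | h1
    · rw [abs_of_nonneg h1, max_eq_left h1, max_eq_right (by linarith), add_zero]
    · rw [abs_of_nonpos h1, max_eq_right h1, max_eq_left (by linarith), zero_add]
end Blow

lemma exists_rot {e : ℂ} (he : ‖e‖ = 1) : ∃ θ : ℝ, ∀ z, e * rot θ z = z := by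
  refine ⟨- Complex.arg e, fun z => ?_⟩
  have h1 : e = Complex.exp (Complex.arg e * I) := by
    have := Complex.norm_mul_exp_arg_mul_I e
    rw [he] at this; simpa using this.symm
  rw [rot]
  nth_rewrite 1 [h1]
  rw [← mul_assoc, ← Complex.exp_add]
  simp

open Complex Metric Set Filter MeasureTheory
open scoped Topology Classical NNReal

lemma circ_lin (c z : ℂ) (r : ℝ) : circleAvg (fun x => (c * x).re) z r = (c * z).re := by
  unfold circleAvg
  have h1 : ∀ θ : ℝ, (c * (z + r * Complex.exp (θ * I))).re =
      (c * z).re + (r * c.re * Real.cos θ - r * c.im * Real.sin θ) := by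
    intro θ
    rw [Complex.exp_mul_I]
    simp [Complex.cos_ofReal_re, Complex.sin_ofReal_re, Complex.cos_ofReal_im, Complex.sin_ofReal_im]; ring
  simp_rw [h1]
  rw [intervalIntegral.integral_add (by simp) (Continuous.intervalIntegrable (by fun_prop) _ _),
    intervalIntegral.integral_sub (Continuous.intervalIntegrable (by fun_prop) _ _)
      (Continuous.intervalIntegrable (by fun_prop) _ _)]
  simp
  field_simp

lemma circ_eq {w : ℂ → ℝ} {c z : ℂ} {r : ℝ} (hr : 0 < r) (hw : ∀ x ∈ closedBall z r, w x = (c * x).re) :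
    circleAvg w z r = w z := by
  rw [hw z (mem_closedBall_self hr.le), ← circ_lin c z r]
  unfold circleAvg
  congr 1
  apply intervalIntegral.integral_congr
  intro θ _
  apply hw
  simp [Complex.norm_exp_ofReal_mul_I, abs_of_pos hr]

lemma e_conj {e : ℂ} (he : ‖e‖ = 1) (t : ℝ) (y : ℂ) : (e * (y + t * (starRingEnd ℂ) e)).re = (e * y).re + t := by
  rw [mul_add, mul_left_comm, Complex.mul_conj, Complex.normSq_eq_norm_sq, he]; simp

lemma e_lip {e : ℂ} (he : ‖e‖ = 1) (x y : ℂ) : |(e * x).re - (e * y).re| ≤ ‖x - y‖ := by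
  rw [← Complex.sub_re, ← mul_sub]
  refine (Complex.abs_re_le_norm _).trans ?_
  rw [norm_mul, he, one_mul]

lemma conj_dist {e : ℂ} (he : ‖e‖ = 1) (t : ℝ) (y : ℂ) : dist (y + t * (starRingEnd ℂ) e) y = |t| := by
  simp [dist_eq_norm, he]

lemma ball_side {e : ℂ} (he : ‖e‖ = 1) {y : ℂ} {ρ : ℝ} (hs : ∀ x ∈ ball y ρ, (e * x).re ≠ 0) :
    ρ ≤ |(e * y).re| := by
  by_contra hcon
  push Not at hcon
  refine hs (y + ((-(e * y).re : ℝ) : ℂ) * (starRingEnd ℂ) e) ?_ ?_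
  · rw [mem_ball, conj_dist he, abs_neg]; exact hcon
  · rw [e_conj he]; ring

/-- a unit direction from an extremal projection -/
lemma dir_eq {e : ℂ} (he : ‖e‖ = 1) {w : ℂ} {ρ : ℝ} (hρ : 0 < ρ) (hw : ‖w‖ = ρ) (h : ρ ≤ (e * w).re) (x : ℂ) :
    dot2 x (w / (ρ : ℂ)) = (e * x).re := by
  have h1 : ‖e * w‖ = ρ := by rw [norm_mul, he, one_mul, hw]
  have h2 : (e * w).re = ρ := le_antisymm (h1 ▸ Complex.re_le_norm _) h
  have h3 : (e * w).im = 0 := by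
    have := Nn_eq (e * w)
    rw [h1, Nn, h2] at this
    nlinarith
  have h4 : e * w = ρ := by apply Complex.ext <;> simp [h2, h3]
  have h5 : w = ρ * (starRingEnd ℂ) e := by
    have : (starRingEnd ℂ) e * e = 1 := by
      rw [mul_comm, Complex.mul_conj, Complex.normSq_eq_norm_sq, he]; simp
    calc w = ((starRingEnd ℂ) e * e) * w := by rw [this, one_mul]
      _ = _ := by rw [mul_assoc, h4, mul_comm]
  have hρc : (ρ : ℂ) ≠ 0 := by exact_mod_cast hρ.ne'
  rw [h5, mul_div_cancel_left₀ _ hρc]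
  simp [dot2]; ring

lemma inner_slope {e : ℂ} (he : ‖e‖ = 1) {v : ℂ → ℝ} {s : ℝ} {x₀ y : ℂ} {ρ C : ℝ} (hρ : 0 < ρ)
    (hx0 : (e * x₀).re = 0) (hs : ∀ x ∈ ball y ρ, (e * x).re ≠ 0) (hv : ∀ x ∈ ball y ρ, v x = s * |(e * x).re|)
    (hd : dist x₀ y = ρ) :
    HasSlopeAt v x₀ ((y - x₀) / (ρ : ℂ)) s (NontangentialIn (ball y ρ) x₀ C) := by
  have hside := ball_side he hs
  have hn : ‖y - x₀‖ = ρ := by rw [← dist_eq_norm, dist_comm]; exact hd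
  unfold HasSlopeAt
  apply tendsto_const_nhds.congr'
  filter_upwards [self_mem_nhdsWithin] with x hx
  have hxb := hx.1
  have hlip := e_lip he x y
  have hxn : ‖x - y‖ < ρ := by rw [← dist_eq_norm]; exact hxb
  have : v x - s * max (dot2 (x - x₀) ((y - x₀) / (ρ : ℂ))) 0 = 0 := by
    rw [hv x hxb]
    rcases le_total 0 (e * y).re with h0 | h0
    · rw [abs_of_nonneg h0] at hside
      rw [dir_eq he hρ hn (by rw [mul_sub, Complex.sub_re, hx0]; linarith), mul_sub, Complex.sub_re, hx0, sub_zero]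
      have : 0 < (e * x).re := by linarith [(abs_le.1 hlip).1]
      rw [abs_of_pos this, max_eq_left this.le]; ring
    · rw [abs_of_nonpos h0] at hside
      rw [dir_eq (e := -e) (by simpa using he) hρ hn (by
        rw [neg_mul, Complex.neg_re, mul_sub, Complex.sub_re, hx0]; linarith), neg_mul, Complex.neg_re,
        mul_sub, Complex.sub_re, hx0, sub_zero]
      have : (e * x).re < 0 := by linarith [(abs_le.1 hlip).2]
      rw [abs_of_neg this, max_eq_left (by linarith)]; ring
  rw [this, zero_div]

lemma v_lin {e : ℂ} (he : ‖e‖ = 1) {v : ℂ → ℝ} {s : ℝ} {z : ℂ} {r : ℝ} (hr : 0 < r)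
    (hs : ∀ x ∈ closedBall z r, (e * x).re ≠ 0) (hv : ∀ x ∈ closedBall z r, v x = s * |(e * x).re|) :
    circleAvg v z r = v z := by
  have hside := ball_side he (fun x hx => hs x (ball_subset_closedBall hx))
  rcases le_total 0 (e * z).re with h0 | h0
  · rw [abs_of_nonneg h0] at hside
    apply circ_eq (c := s * e) hr
    intro x hx
    have hlip := e_lip he x z
    rw [mem_closedBall, dist_eq_norm] at hx
    have : 0 ≤ (e * x).re := by linarith [(abs_le.1 hlip).1]
    rw [hv x (by rwa [mem_closedBall, dist_eq_norm]), abs_of_nonneg this, mul_assoc, Complex.re_ofReal_mul]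
  · rw [abs_of_nonpos h0] at hside
    apply circ_eq (c := - (s * e)) hr
    intro x hx
    have hlip := e_lip he x z
    rw [mem_closedBall, dist_eq_norm] at hx
    have : (e * x).re ≤ 0 := by linarith [(abs_le.1 hlip).2]
    rw [hv x (by rwa [mem_closedBall, dist_eq_norm]), abs_of_nonpos this, neg_mul, Complex.neg_re, mul_assoc, Complex.re_ofReal_mul]
    ring

lemma contX (e : ℂ) : Continuous fun z : ℂ => (e * z).re :=
  Complex.continuous_re.comp (continuous_const.mul continuous_id)

lemma visc_P {e : ℂ} (he : ‖e‖ = 1) {v : ℂ → ℝ} (hv : ∀ z, v z = max (e * z).re 0) :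
    ViscositySolution univ v := by
  have hX := contX e
  have hc : Continuous v := by
    rw [show v = fun z => max (e * z).re 0 from funext hv]; fun_prop
  have hp : posSet univ v = {z | 0 < (e * z).re} := by
    ext z; simp [posSet, hv]
  have hfb : ∀ x ∈ FB univ v, (e * x).re = 0 := by
    rintro x ⟨-, hx⟩
    rw [hp] at hx
    exact (frontier_lt_subset_eq continuous_const hX hx).symm
  have hvp : ∀ x ∈ posSet univ v, (e * x).re ≠ 0 ∧ v x = 1 * |(e * x).re| := by
    intro x hx
    rw [hp] at hx
    have hx : 0 < (e * x).re := hx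
    exact ⟨hx.ne', by rw [hv, abs_of_pos hx, max_eq_left hx.le, one_mul]⟩
  have hnn : ∀ z ∈ (univ : Set ℂ), 0 ≤ v z := fun z _ => by rw [hv]; exact le_max_right _ _
  have hm : ∀ z r, 0 < r → closedBall z r ⊆ posSet univ v → circleAvg v z r = v z := fun z r hr hs =>
    v_lin he hr (fun x hx => (hvp x (hs hx)).1) (fun x hx => (hvp x (hs hx)).2)
  refine ⟨⟨hc.continuousOn, hnn, fun z _ r hr hs => (hm z r hr hs).le, ?_⟩,
    ⟨hc.continuousOn, hnn, fun z _ r hr hs => (hm z r hr hs).ge, ?_⟩⟩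
  · intro x₀ hx y ρ hρ hB hd
    exact ⟨1, le_rfl, fun C _ => inner_slope he hρ (hfb _ hx) (fun x hx => (hvp x (hB hx)).1)
      (fun x hx => (hvp x (hB hx)).2) hd⟩
  · intro x₀ hx y ρ hρ hB hd
    refine ⟨1, le_rfl, fun C _ => ?_⟩
    have hle : ∀ x ∈ ball y ρ, (e * x).re ≤ 0 := fun x hx => by
      have := (hB hx).2
      rw [hv] at this
      exact this ▸ le_max_left _ _
    have hy : (e * y).re ≤ -ρ := by
      by_contra hcon
      push Not at hcon
      have h1 := hle (y + ((max 0 ((ρ - (e*y).re)/2) : ℝ) : ℂ) * (starRingEnd ℂ) e) (by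
        have := hle y (mem_ball_self hρ)
        rw [mem_ball, conj_dist he, abs_of_nonneg (le_max_left _ _)]
        apply max_lt hρ; linarith)
      rw [e_conj he] at h1
      have := le_max_right 0 ((ρ - (e*y).re)/2)
      linarith
    have hx0 := hfb _ hx
    unfold HasSlopeAt
    apply tendsto_const_nhds.congr
    intro x
    rw [dir_eq he hρ (by rw [← dist_eq_norm]; exact hd) (by rw [mul_sub, Complex.sub_re, hx0]; linarith),
      hv, mul_sub, Complex.sub_re, hx0, sub_zero, one_mul, sub_self, zero_div]

lemma visc_W {e : ℂ} (he : ‖e‖ = 1) {v : ℂ → ℝ} {s : ℝ} (hs0 : 0 < s) (hs1 : s ≤ 1)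
    (hv : ∀ z, v z = s * |(e * z).re|) : ViscositySolution univ v := by
  have hX := contX e
  have hc : Continuous v := by
    rw [show v = fun z => s * |(e * z).re| from funext hv]; fun_prop
  have hp : posSet univ v = {z | (e * z).re ≠ 0} := by
    ext z
    show z ∈ univ ∧ 0 < v z ↔ (e * z).re ≠ 0
    rw [hv, mul_pos_iff_of_pos_left hs0, abs_pos]; simp
  have hfb : ∀ x ∈ FB univ v, (e * x).re = 0 := by
    rintro x ⟨-, hx⟩
    rw [hp, (isOpen_ne_fun hX continuous_const).frontier_eq] at hx
    by_contra hne
    exact hx.2 hne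
  have hvp : ∀ x ∈ posSet univ v, (e * x).re ≠ 0 ∧ v x = s * |(e * x).re| := by
    intro x hx
    rw [hp] at hx
    exact ⟨hx, hv x⟩
  have hnn : ∀ z ∈ (univ : Set ℂ), 0 ≤ v z := fun z _ => by rw [hv]; positivity
  have hm : ∀ z r, 0 < r → closedBall z r ⊆ posSet univ v → circleAvg v z r = v z := fun z r hr hs =>
    v_lin he hr (fun x hx => (hvp x (hs hx)).1) (fun x hx => (hvp x (hs hx)).2)
  refine ⟨⟨hc.continuousOn, hnn, fun z _ r hr hs => (hm z r hr hs).le, ?_⟩,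
    ⟨hc.continuousOn, hnn, fun z _ r hr hs => (hm z r hr hs).ge, ?_⟩⟩
  · intro x₀ hx y ρ hρ hB hd
    exact ⟨s, hs1, fun C _ => inner_slope he hρ (hfb _ hx) (fun x hx => (hvp x (hB hx)).1)
      (fun x hx => (hvp x (hB hx)).2) hd⟩
  · intro x₀ hx y ρ hρ hB hd
    exfalso
    have h0 : ∀ x ∈ ball y ρ, (e * x).re = 0 := fun x hx => by
      have := (hB hx).2
      rw [hv] at this
      simpa [hs0.ne'] using this
    have h1 := h0 (y + ((ρ/2 : ℝ) : ℂ) * (starRingEnd ℂ) e) (by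
      rw [mem_ball, conj_dist he, abs_of_pos (by positivity)]; linarith)
    rw [e_conj he, h0 y (mem_ball_self hρ)] at h1
    linarith

open Complex Metric Set Filter MeasureTheory
open scoped Topology Classical NNReal

lemma LH_log (n x : ℂ) : LH (fun y => Real.log ‖y - n‖) x ‖x - n‖ := by
  obtain ⟨F, hF, hw⟩ := InnerProductSpace.HarmonicOnNhd.exists_analyticOnNhd_ball_re_eq
    (f := fun y => Real.log ‖y - n‖) (z := x) (R := ‖x - n‖) (fun y hy => by
      apply AnalyticAt.harmonicAt_log_norm (f := fun y => y - n)
      · fun_prop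
      · intro h0
        have : y = n := sub_eq_zero.1 h0
        subst this
        rw [mem_ball, dist_comm, dist_eq_norm] at hy
        exact lt_irrefl _ hy)
  exact ⟨F, hF.differentiableOn, fun x hx => (hw hx).symm⟩

lemma LH.const_of_min {w : ℂ → ℝ} {z : ℂ} {ρ : ℝ} (h : LH w z ρ) (hρ : 0 < ρ) (hm : IsLocalMin w z) :
    ∀ᶠ y in 𝓝 z, w y = w z := by
  obtain ⟨F, hF, hw⟩ := h
  have hnb := isOpen_ball.mem_nhds (mem_ball_self (x := z) hρ)
  have hn : ∀ y ∈ ball z ρ, ‖Complex.exp (- F y)‖ = Real.exp (- w y) := fun y hy => by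
    rw [Complex.norm_exp, Complex.neg_re, hw y hy]
  have h1 : ∀ᶠ y in 𝓝 z, DifferentiableAt ℂ (fun y => Complex.exp (- F y)) y := by
    filter_upwards [hnb] with y hy
    exact (hF.differentiableAt (isOpen_ball.mem_nhds hy)).neg.cexp
  have h2 : IsLocalMax (norm ∘ fun y => Complex.exp (- F y)) z := by
    filter_upwards [hnb, hm] with y hy hy2
    simp only [Function.comp]
    rw [hn y hy, hn z (mem_ball_self hρ)]
    exact Real.exp_le_exp.2 (by linarith)
  filter_upwards [Complex.norm_eventually_eq_of_isLocalMax h1 h2, hnb] with y h3 hy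
  rw [hn y hy, hn z (mem_ball_self hρ)] at h3
  have := Real.exp_injective h3
  linarith

lemma ann_min {U : ℂ → ℝ} {n : ℂ} {a b q : ℝ} (ha : 0 < a) (hab : a < b)
    (hc : ContinuousOn U {x | a ≤ ‖x - n‖ ∧ ‖x - n‖ ≤ b})
    (hL : ∀ x, a < ‖x - n‖ → ‖x - n‖ < b → ∃ ε, 0 < ε ∧ LH U x ε)
    (hin : ∀ x, ‖x - n‖ = a → q * Real.log (b / a) ≤ U x)
    (hout : ∀ x, ‖x - n‖ = b → 0 ≤ U x) :
    ∀ x, a ≤ ‖x - n‖ → ‖x - n‖ ≤ b → q * Real.log (b / ‖x - n‖) ≤ U x := by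
  set A : Set ℂ := {x | a ≤ ‖x - n‖ ∧ ‖x - n‖ ≤ b} with hA
  have hnc : Continuous fun x : ℂ => ‖x - n‖ := by fun_prop
  have hAcl : IsClosed A := (isClosed_le continuous_const hnc).inter (isClosed_le hnc continuous_const)
  have hAc : IsCompact A := by
    apply (isCompact_closedBall n b).of_isClosed_subset hAcl
    intro x hx
    rw [mem_closedBall, dist_eq_norm]; exact hx.2
  set w : ℂ → ℝ := fun x => U x - q * Real.log (b / ‖x - n‖) with hw
  have hwc : ContinuousOn w A := by
    apply hc.sub
    apply ContinuousOn.mul continuousOn_const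
    apply ContinuousOn.log
    · exact ContinuousOn.div continuousOn_const hnc.continuousOn (fun x hx => by
        have := hx.1; linarith)
    · intro x hx
      have h1 := hx.1
      have : 0 < b / ‖x - n‖ := by
        apply div_pos <;> linarith
      exact this.ne'
  intro x hxa hxb
  by_contra hcon
  push Not at hcon
  have hne : A.Nonempty := ⟨x, hxa, hxb⟩
  obtain ⟨x0, hx0, hmin⟩ := hAc.exists_isMinOn hne hwc
  have hm0 : w x0 < 0 := by
    have h1 : w x0 ≤ w x := hmin ⟨hxa, hxb⟩
    have h2 : w x < 0 := by simp only [hw]; linarith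
    linarith
  have hSc : IsCompact (A ∩ w ⁻¹' {w x0}) :=
    hAc.of_isClosed_subset (hwc.preimage_isClosed_of_isClosed hAcl isClosed_singleton) inter_subset_left
  obtain ⟨x1, ⟨hx1, hx1w⟩, hmax⟩ := hSc.exists_isMaxOn ⟨x0, hx0, rfl⟩ hnc.continuousOn
  have hx1w : w x1 = w x0 := hx1w
  have hlt1 : a < ‖x1 - n‖ := by
    refine lt_of_le_of_ne hx1.1 (fun h => ?_)
    have h1 := hin x1 h.symm
    have : 0 ≤ w x1 := by simp only [hw]; rw [← h]; linarith
    linarith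
  have hlt2 : ‖x1 - n‖ < b := by
    refine lt_of_le_of_ne hx1.2 (fun h => ?_)
    have h1 := hout x1 h
    have : 0 ≤ w x1 := by simp only [hw]; rw [h, div_self (by linarith), Real.log_one]; linarith
    linarith
  have hAn : A ∈ 𝓝 x1 := by
    have h1 : ∀ᶠ y in 𝓝 x1, a < ‖y - n‖ := hnc.continuousAt.eventually (lt_mem_nhds hlt1)
    have h2 : ∀ᶠ y in 𝓝 x1, ‖y - n‖ < b := hnc.continuousAt.eventually (gt_mem_nhds hlt2)
    filter_upwards [h1, h2] with y h1 h2 using ⟨h1.le, h2.le⟩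
  have hlm : IsLocalMin w x1 := by
    filter_upwards [hAn] with y hy
    rw [hx1w]; exact hmin hy
  obtain ⟨ε, hε, hLU⟩ := hL x1 hlt1 hlt2
  have hp : 0 < ‖x1 - n‖ := by linarith
  have hLw : LH w x1 (min ε ‖x1 - n‖) := by
    obtain ⟨F, hF, hF2⟩ := hLU.mono (ball_subset_ball (min_le_left ε ‖x1 - n‖))
    obtain ⟨G, hG, hG2⟩ := (LH_log n x1).mono (ball_subset_ball (min_le_right ε ‖x1 - n‖))
    refine ⟨fun y => F y - ((q * Real.log b : ℝ) : ℂ) + (q : ℂ) * G y,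
      (hF.sub_const _).add (hG.const_mul _), fun y hy => ?_⟩
    have hyn : ‖y - n‖ ≠ 0 := by
      intro h0
      have : y = n := sub_eq_zero.1 (norm_eq_zero.1 h0)
      have h1 : dist y x1 < ‖x1 - n‖ := (mem_ball.1 hy).trans_le (min_le_right _ _)
      rw [this, dist_comm, dist_eq_norm] at h1
      exact lt_irrefl _ h1
    have hg := hG2 y hy
    simp only at hg
    simp only [hw]
    rw [Complex.add_re, Complex.sub_re, Complex.ofReal_re, Complex.re_ofReal_mul, ← hF2 y hy, ← hg,
      Real.log_div (by linarith) hyn]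
    ring
  have hev := hLw.const_of_min (lt_min hε hp) hlm
  have ht : Tendsto (fun t : ℝ => x1 + (t : ℂ) * (x1 - n)) (𝓝[>] 0) (𝓝 x1) := by
    have : Continuous (fun t : ℝ => x1 + (t : ℂ) * (x1 - n)) := by fun_prop
    have := this.tendsto 0
    simp only [Complex.ofReal_zero, zero_mul, add_zero] at this
    exact this.mono_left nhdsWithin_le_nhds
  obtain ⟨t, ⟨h1, h2⟩, h3⟩ := (((ht.eventually hev).and (ht.eventually hAn)).and self_mem_nhdsWithin).exists
  have h3 : 0 < t := h3
  have h4 : ‖x1 + (t : ℂ) * (x1 - n) - n‖ ≤ ‖x1 - n‖ := hmax ⟨h2, h1.trans hx1w⟩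
  have h5 : x1 + (t : ℂ) * (x1 - n) - n = ((1 + t : ℝ) : ℂ) * (x1 - n) := by push_cast; ring
  rw [h5, norm_mul, Complex.norm_real, Real.norm_of_nonneg (by linarith)] at h4
  nlinarith

namespace Blow
variable {Ω : Set ℂ} {u : ℂ → ℝ} {L c : ℝ} {r : ℕ → ℝ} {v : ℂ → ℝ}

/-- geometric part: touching disk with large slope -/
lemma touch (h : Blow Ω u L c r v) {e : ℂ} (he : ‖e‖ = 1) {s : ℝ} (hv : ∀ z, v z = s * |(e * z).re|)
    (hs : 1 < s) : ∃ (j : ℕ) (n x0 : ℂ) (ρ q : ℝ), 1 < q ∧ 0 < ρ ∧ ‖x0 - n‖ = ρ ∧ UU r u j x0 = 0 ∧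
      (∀ x ∈ closedBall n ρ, (r j : ℂ) * x ∈ Ω) ∧ (∀ x ∈ ball n ρ, 0 < UU r u j x) ∧
      ∃ t0 : ℝ, 0 < t0 ∧ t0 < 1 ∧ ∀ t : ℝ, 0 < t → t < t0 → q * (t * ρ) ≤ UU r u j (x0 + t * (n - x0)) := by
  set n : ℂ := (starRingEnd ℂ) e with hn
  have hen : (e * n).re = 1 := by
    have := e_conj he 1 0
    rw [hn]
    rw [zero_add, Complex.ofReal_one, one_mul, mul_zero, Complex.zero_re, zero_add] at this
    exact this
  have hnn : ‖n‖ = 1 := by simp [hn, he]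
  set q := (1 + s) / 2 with hq
  have hq1 : 1 < q := by rw [hq]; linarith
  have hqs : q < s := by rw [hq]; linarith
  set d := (s - q) / (4 * s) with hd
  have hs0 : 0 < s := by linarith
  have hd0 : 0 < d := by rw [hd]; apply div_pos <;> linarith
  have hd4 : d < 1 / 4 := by rw [hd, div_lt_div_iff₀ (by linarith) (by norm_num)]; linarith
  have hds : s * (1 - 2 * d) = (s + q) / 2 := by rw [hd]; field_simp; ring
  set ε := s * d - q * d / (1 - 2 * d) with hε
  have hε0 : 0 < ε := by
    rw [hε, sub_pos, div_lt_iff₀ (by linarith)]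
    nlinarith
  have hεs : ε < s * d := by
    have : 0 < q * d / (1 - 2 * d) := div_pos (by nlinarith) (by linarith)
    rw [hε]; linarith
  obtain ⟨j, hj1, hj2⟩ := ((h.evΩ 4).and
    (Metric.tendstoUniformlyOn_iff.1 (h.unif (isCompact_closedBall n 1)) ε hε0)).exists
  set U := UU r u j with hU
  have hΩ : ∀ x ∈ closedBall n 1, (r j : ℂ) * x ∈ Ω := by
    intro x hx
    apply hj1
    rw [mem_closedBall, dist_eq_norm] at *
    have := norm_add_le (x - n) n
    rw [sub_add_cancel] at this
    rw [sub_zero]; linarith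
  have hX : ∀ x, 1 - ‖x - n‖ ≤ (e * x).re := by
    intro x
    have := (abs_le.1 (e_lip he x n)).1
    linarith
  have hlow : ∀ x, ‖x - n‖ ≤ 1 - d → s * d - ε ≤ U x := by
    intro x hx
    have h1 := hj2 x (by rw [mem_closedBall, dist_eq_norm]; linarith)
    have h2 := hX x
    rw [hv, Real.dist_eq, abs_of_nonneg (a := (e * x).re) (by linarith)] at h1
    have h3 : s * d ≤ s * (e * x).re := by apply mul_le_mul_of_nonneg_left _ hs0.le; linarith
    have := (abs_lt.1 h1).2
    change _ ≤ UU r u j x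
    linarith
  have hUc : ContinuousOn U (closedBall n 1) := by
    have : LipschitzOnWith ⟨L, h.dat.L0⟩ U (closedBall n 1) := LipschitzOnWith.of_dist_le_mul (fun z hz w hw => by
      rw [Real.dist_eq, dist_eq_norm]; exact h.Ulip (hΩ z hz) (hΩ w hw))
    exact this.continuousOn
  have hnc : Continuous fun x : ℂ => ‖x - n‖ := by fun_prop
  have hZc : IsCompact (closedBall n 1 ∩ U ⁻¹' {0}) :=
    (isCompact_closedBall n 1).of_isClosed_subset
      (hUc.preimage_isClosed_of_isClosed isClosed_closedBall isClosed_singleton) inter_subset_left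
  have hU0 : U 0 = 0 := by simp [hU, UU, h.u0]
  have h0Z : (0 : ℂ) ∈ closedBall n 1 ∩ U ⁻¹' {0} := ⟨by simp [hnn], hU0⟩
  obtain ⟨x0, ⟨hx0b, hx0⟩, hmin⟩ := hZc.exists_isMinOn ⟨0, h0Z⟩ hnc.continuousOn
  have hx0 : U x0 = 0 := hx0
  set ρ := ‖x0 - n‖ with hρ
  have hρ1 : ρ ≤ 1 := by rw [mem_closedBall, dist_eq_norm] at hx0b; exact hx0b
  have hρd : 1 - d ≤ ρ := by
    by_contra hcon
    push Not at hcon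
    have := hlow x0 hcon.le
    linarith
  have hpos : ∀ x ∈ ball n ρ, 0 < U x := by
    intro x hx
    rw [mem_ball, dist_eq_norm] at hx
    have hxb : x ∈ closedBall n 1 := by rw [mem_closedBall, dist_eq_norm]; linarith
    refine lt_of_le_of_ne (h.Unn (hΩ x hxb)) (fun h0 => ?_)
    have : ρ ≤ ‖x - n‖ := hmin ⟨hxb, h0.symm⟩
    linarith
  have hann := ann_min (U := U) (n := n) (a := ρ - d) (b := ρ) (q := q) (by linarith) (by linarith)
    (hUc.mono (fun x hx => by rw [mem_closedBall, dist_eq_norm]; linarith [hx.2]))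
    (fun x hx1 hx2 => ⟨ρ - ‖x - n‖, by linarith, h.LHU (fun y hy => by
      have hyn : ‖y - n‖ < ρ := by
        rw [mem_ball, dist_eq_norm] at hy
        have := norm_sub_le_norm_sub_add_norm_sub y x n
        linarith
      rw [← h.Upos (hΩ y (by rw [mem_closedBall, dist_eq_norm]; linarith))]
      exact hpos y (by rw [mem_ball, dist_eq_norm]; exact hyn))⟩)
    (fun x hx => by
      have h1 := hlow x (by linarith)
      have h2 : s * d - ε = q * d / (1 - 2 * d) := by rw [hε]; ring
      have h3 : Real.log (ρ / (ρ - d)) ≤ d / (1 - 2 * d) := by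
        have hp : 0 < ρ - d := by linarith
        have h4 := Real.log_le_sub_one_of_pos (x := ρ / (ρ - d)) (div_pos (by linarith) hp)
        have h5 : ρ / (ρ - d) - 1 = d / (ρ - d) := by field_simp; ring
        rw [h5] at h4
        refine h4.trans ?_
        apply div_le_div_of_nonneg_left hd0.le (by linarith) (by linarith)
      have h4 : q * Real.log (ρ / (ρ - d)) ≤ q * (d / (1 - 2 * d)) :=
        mul_le_mul_of_nonneg_left h3 (by linarith)
      rw [← mul_div_assoc] at h4
      linarith)
    (fun x hx => h.Unn (hΩ x (by rw [mem_closedBall, dist_eq_norm]; linarith)))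
  have hρ0 : 0 < ρ := by linarith
  refine ⟨j, n, x0, ρ, q, hq1, hρ0, rfl, hx0, fun x hx => hΩ x (closedBall_subset_closedBall hρ1 hx), hpos,
    d, hd0, by linarith, fun t ht0 htd => ?_⟩
  have hnorm : ‖x0 + t * (n - x0) - n‖ = (1 - t) * ρ := by
    have : x0 + t * (n - x0) - n = ((1 - t : ℝ) : ℂ) * (x0 - n) := by push_cast; ring
    rw [this, norm_mul, Complex.norm_real, Real.norm_of_nonneg (by linarith)]
  have h1 := hann (x0 + t * (n - x0)) (by rw [hnorm]; nlinarith) (by rw [hnorm]; nlinarith)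
  rw [hnorm] at h1
  have h2 : ρ / ((1 - t) * ρ) = (1 - t)⁻¹ := by
    have : 1 - t ≠ 0 := by linarith
    field_simp
  rw [h2, Real.log_inv] at h1
  have h3 := Real.log_le_sub_one_of_pos (x := 1 - t) (by linarith)
  refine le_trans ?_ h1
  apply mul_le_mul_of_nonneg_left _ (by linarith)
  nlinarith

lemma s_le_one (h : Blow Ω u L c r v) {e : ℂ} (he : ‖e‖ = 1) {s : ℝ} (hv : ∀ z, v z = s * |(e * z).re|)
    (hsup : ViscositySupersolution Ω u) : s ≤ 1 := by
  by_contra hs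
  push Not at hs
  obtain ⟨j, n, x0, ρ, q, hq, hρ, hxn, hx0, hΩ, hpos, t0, ht0, ht1, ht⟩ := h.touch he hv hs
  have hr := h.rpos j
  set R := r j with hR
  have hRc : (R : ℂ) ≠ 0 := by exact_mod_cast hr.ne'
  have hRn : ‖(R : ℂ)‖ = R := by rw [Complex.norm_real, Real.norm_of_nonneg hr.le]
  have hx0b : x0 ∈ closedBall n ρ := by rw [mem_closedBall, dist_eq_norm, hxn]
  have hB : ball ((R : ℂ) * n) (R * ρ) ⊆ posSet Ω u := by
    intro y hy
    have hy' : y = (R : ℂ) * ((R : ℂ)⁻¹ * y) := by field_simp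
    have hm : (R : ℂ)⁻¹ * y ∈ ball n ρ := by
      rw [mem_ball, dist_eq_norm] at *
      have h2 : (R : ℂ)⁻¹ * y - n = (R : ℂ)⁻¹ * (y - (R : ℂ) * n) := by field_simp
      rw [h2, norm_mul, norm_inv, hRn, inv_mul_lt_iff₀ hr]
      exact hy
    rw [hy']
    rw [← h.Upos (hΩ _ (ball_subset_closedBall hm))]
    exact hpos _ hm
  have hdist : dist ((R : ℂ) * x0) ((R : ℂ) * n) = R * ρ := by
    rw [dist_eq_norm, ← mul_sub, norm_mul, hRn, hxn]
  have hRρ : 0 < R * ρ := mul_pos hr hρ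
  have hFB : (R : ℂ) * x0 ∈ FB Ω u := by
    refine ⟨hΩ _ hx0b, ?_⟩
    rw [h.dat.Uop.frontier_eq]
    refine ⟨closure_mono hB ?_, fun hp => ?_⟩
    · rw [closure_ball _ hRρ.ne', mem_closedBall, hdist]
    · rw [← h.Upos (hΩ _ hx0b)] at hp
      linarith
  obtain ⟨α, hα, hsl⟩ := hsup.slope _ hFB ((R : ℂ) * n) (R * ρ) hRρ hB hdist
  have hsl := hsl 2 (by norm_num)
  unfold HasSlopeAt at hsl
  set g : ℝ → ℂ := fun t => (R : ℂ) * (x0 + t * (n - x0)) with hg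
  have hgd : ∀ t, g t - (R : ℂ) * x0 = ((t * R : ℝ) : ℂ) * (n - x0) := fun t => by
    simp only [hg]; push_cast; ring
  have hnx : ‖n - x0‖ = ρ := by rw [norm_sub_rev, hxn]
  have hgn : ∀ t, 0 < t → ‖g t - (R : ℂ) * x0‖ = t * R * ρ := fun t ht => by
    rw [hgd, norm_mul, Complex.norm_real, Real.norm_of_nonneg (by positivity), hnx]
  have hsm : ∀ᶠ t : ℝ in 𝓝[>] 0, 0 < t ∧ t < t0 := by
    filter_upwards [Ioo_mem_nhdsGT ht0] with t ht using ht
  have hgt : Tendsto g (𝓝[>] 0) (𝓝[NontangentialIn (ball ((R : ℂ) * n) (R * ρ)) ((R : ℂ) * x0) 2] ((R : ℂ) * x0)) := by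
    rw [tendsto_nhdsWithin_iff]
    constructor
    · have : Continuous g := by fun_prop
      have := this.tendsto 0
      simp only [hg, Complex.ofReal_zero, zero_mul, add_zero] at this
      exact this.mono_left nhdsWithin_le_nhds
    · filter_upwards [hsm] with t ⟨h1, h2⟩
      have hgc : dist (g t) ((R : ℂ) * n) = (1 - t) * (R * ρ) := by
        have : g t - (R : ℂ) * n = (((1 - t) * R : ℝ) : ℂ) * (x0 - n) := by
          simp only [hg]; push_cast; ring
        rw [dist_eq_norm, this, norm_mul, Complex.norm_real, hxn,
          Real.norm_of_nonneg (mul_nonneg (by linarith) hr.le)]; ring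
      refine ⟨?_, ?_⟩
      · rw [mem_ball, hgc]; nlinarith
      · rw [hgn t h1]
        have : t * (R * ρ) ≤ infDist (g t) (ball ((R : ℂ) * n) (R * ρ))ᶜ := by
          rw [le_infDist ⟨(R : ℂ) * x0, by simp [hdist]⟩]
          intro y hy
          have hy : R * ρ ≤ dist y ((R : ℂ) * n) := by simpa using hy
          have := dist_triangle y (g t) ((R : ℂ) * n)
          rw [dist_comm y (g t)] at this
          linarith
        have : 0 < t * (R * ρ) := by positivity
        linarith
  have hlim := hsl.comp hgt
  have hge : (q - 1) ≤ 0 := by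
    refine ge_of_tendsto hlim ?_
    filter_upwards [hsm] with t ⟨h1, h2⟩
    simp only [Function.comp]
    have hdot : dot2 (g t - (R : ℂ) * x0) (((R : ℂ) * n - (R : ℂ) * x0) / ((R * ρ : ℝ) : ℂ)) = t * R * ρ := by
      have hρc : (ρ : ℂ) ≠ 0 := by exact_mod_cast hρ.ne'
      have h3 : ((R : ℂ) * n - (R : ℂ) * x0) / ((R * ρ : ℝ) : ℂ) = ((ρ⁻¹ : ℝ) : ℂ) * (n - x0) := by
        push_cast; field_simp
      have h4 : (n - x0).re * (n - x0).re + (n - x0).im * (n - x0).im = ρ ^ 2 := by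
        rw [← hnx, ← Complex.normSq_eq_norm_sq, Complex.normSq_apply]
      rw [hgd, h3]
      unfold dot2
      rw [Complex.re_ofReal_mul, Complex.re_ofReal_mul, Complex.im_ofReal_mul, Complex.im_ofReal_mul]
      calc _ = t * R * ρ⁻¹ * ((n - x0).re * (n - x0).re + (n - x0).im * (n - x0).im) := by ring
        _ = _ := by rw [h4]; field_simp
    have hp : 0 < t * R * ρ := by positivity
    rw [hdot, hgn t h1, max_eq_left hp.le, le_div_iff₀ hp]
    have h3 := ht t h1 h2
    have h4 : UU r u j (x0 + t * (n - x0)) = R⁻¹ * u (g t) := rfl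
    rw [h4, le_inv_mul_iff₀ hr] at h3
    have h5 : α * (t * R * ρ) ≤ 1 * (t * R * ρ) := mul_le_mul_of_nonneg_right hα hp.le
    nlinarith
  linarith

end Blow

/-- characterization of blow-up limits of Lipschitz, non-degenerate
variational (and viscosity) solutions at a free boundary point. -/
theorem blowup_classification (Ω : Set ℂ) (hΩ : IsOpen Ω) (u : ℂ → ℝ)
    (hvar : VariationalSolution Ω u)
    (hLip : ∃ L : ℝ≥0, LipschitzOnWith L u Ω)
    (hnd : ∃ c : ℝ, 0 < c ∧ Nondegenerate Ω u c)
    (h0 : (0 : ℂ) ∈ FB Ω u)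
    (r : ℕ → ℝ) (hrpos : ∀ j, 0 < r j) (hr : Filter.Tendsto r atTop (nhds 0))
    (v : ℂ → ℝ)
    (hconv : TendstoLocallyUniformly
      (fun j z => (r j)⁻¹ * u (((r j : ℝ) : ℂ) * z)) v atTop) :
    (∃ θ : ℝ, v ∘ rot θ = Pfun ∨ ∃ s : ℝ, 0 < s ∧ v ∘ rot θ = Wfun s) ∧
    (ViscositySolution Ω u →
      ViscositySolution Set.univ v ∧
      ∃ θ : ℝ, v ∘ rot θ = Pfun ∨ ∃ s : ℝ, 0 < s ∧ s ≤ 1 ∧ v ∘ rot θ = Wfun s) := by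
  obtain ⟨L, hL⟩ := hLip
  obtain ⟨c, hc, hnd⟩ := hnd
  have hb : Blow Ω u L c r v := ⟨⟨hΩ, hvar, L.2, fun z hz w hw => by
    have := hL.dist_le_mul z hz w hw
    rwa [Real.dist_eq, dist_eq_norm] at this⟩, hc, hnd, h0, hrpos, hr, hconv⟩
  obtain ⟨e, he, hcase⟩ := hb.form
  obtain ⟨θ, hθ⟩ := exists_rot he
  rcases hcase with hP | ⟨s, hs, hW⟩
  · have hPf : v ∘ rot θ = Pfun := by
      funext z; simp only [Function.comp]; rw [hP, hθ]; rfl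
    exact ⟨⟨θ, Or.inl hPf⟩, fun _ => ⟨visc_P he hP, θ, Or.inl hPf⟩⟩
  · have hWf : v ∘ rot θ = Wfun s := by
      funext z; simp only [Function.comp]; rw [hW, hθ]; rfl
    refine ⟨⟨θ, Or.inr ⟨s, hs, hWf⟩⟩, fun hvis => ?_⟩
    have h1 := hb.s_le_one he hW hvis.1
    exact ⟨visc_W he hs h1 hW, θ, Or.inr ⟨s, hs, h1, hWf⟩⟩
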